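/- arXiv:1510.04319 — 4 statements merged into one kernel-verified Lean document; each statement's English description precedes it below -/
import Mathlib

section
/- Let s ≥ 2 and Γ = Γ_{2,2,s} = {1324, 1423, 1 2 ⋯ s (s+1)}. Then for all n ≥ 1, the coefficient of y^n in the polynomial U_{Γ,sn}(−y) equals Π_{i=1}^{n} ((i−1)s + 1). -/
open Polynomial

/-- The reduction of a list of distinct integers: replace the i-th smallest entry by i. -/
def redL (l : List ℕ) : List ℕ :=
  l.map (fun x => (l.countP (fun y => decide (y < x))) + 1)

/-- The number of descents of a list. -/
def desL (l : List ℕ) : ℕ :=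
  (l.zip l.tail).countP (fun p => decide (p.2 < p.1))

/-- `σ` has a `Γ`-match: some consecutive factor of length at least 2 reduces to a member of `Γ`. -/
def HasMatch (Γ : Set (List ℕ)) (l : List ℕ) : Prop :=
  ∃ i j : ℕ, 1 ≤ j ∧ i + j + 1 ≤ l.length ∧ redL ((l.drop i).take (j + 1)) ∈ Γ

open scoped Classical in
/-- The set of permutations of `{1,…,n}` (in one-line notation, as lists) with no `Γ`-match. -/
noncomputable def NMfinset (Γ : Set (List ℕ)) (n : ℕ) : Finset (List ℕ) :=
  ((List.range' 1 n).permutations.toFinset).filter (fun l => ¬ HasMatch Γ l)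

/-- `NM_{Γ,n}(y) = Σ_{σ ∈ NM_n(Γ)} y^{1+des(σ)}` for `n ≥ 1`, and `NM_{Γ,0}(y) = 1`. -/
noncomputable def NMpoly (Γ : Set (List ℕ)) (n : ℕ) : Polynomial ℚ :=
  if n = 0 then 1 else ∑ l ∈ NMfinset Γ n, X ^ (1 + desL l)

/-- Global increasing condition with offset `c`. -/
def Pg (s c : ℕ) (l : List ℕ) : Prop :=
  ∀ i j, i < j → j < l.length → ¬ s ∣ (c + i + 1) → l.getD i 0 < l.getD j 0

/-- Blocks of size `s` increase; the first `k - 1` comparisons go up, those from the `k+1`-st go down. -/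
def Hc (s k : ℕ) (l : List ℕ) : Prop :=
  (∀ i, i + 1 < l.length → ¬ s ∣ (i + 1) → l.getD i 0 < l.getD (i + 1) 0) ∧
  (∀ j, (j + 1) * s < l.length →
    (j + 1 < k → l.getD (j * s + (s - 2)) 0 < l.getD ((j + 1) * s) 0) ∧
    (k < j + 1 → l.getD ((j + 1) * s) 0 < l.getD (j * s + (s - 2)) 0))

/-- Auxiliary: comparisons `1..k` go up, the others go down. -/
def Gc (s k : ℕ) (l : List ℕ) : Prop :=
  (∀ i, i + 1 < l.length → ¬ s ∣ (i + 1) → l.getD i 0 < l.getD (i + 1) 0) ∧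
  (∀ j, (j + 1) * s < l.length →
    (j + 1 ≤ k → l.getD (j * s + (s - 2)) 0 < l.getD ((j + 1) * s) 0) ∧
    (k < j + 1 → l.getD ((j + 1) * s) 0 < l.getD (j * s + (s - 2)) 0))

/-- All orderings of `S`. -/
def LS (S : Finset ℕ) : Finset (List ℕ) := S.val.lists.toFinset

open scoped Classical in
/-- Number of orderings of `S` satisfying a predicate. -/
noncomputable def cnt (S : Finset ℕ) (p : List ℕ → Prop) : ℕ :=
  ((LS S).filter p).card

lemma mem_LS {S : Finset ℕ} {l : List ℕ} :
    l ∈ LS S ↔ l.Nodup ∧ l.toFinset = S := by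
  rw [LS, Multiset.mem_toFinset, Multiset.mem_lists_iff]
  constructor
  · intro h
    have h2 : l.Nodup := by
      have := S.nodup
      rw [h] at this
      simpa using this
    refine ⟨h2, ?_⟩
    ext x
    rw [List.mem_toFinset, ← Finset.mem_val, h]
    simp
  · rintro ⟨h1, rfl⟩
    rw [List.toFinset_val, h1.dedup]
    rfl

lemma LS_len {S : Finset ℕ} {l : List ℕ} (h : l ∈ LS S) : l.length = S.card := by
  obtain ⟨h1, rfl⟩ := mem_LS.1 h
  exact (List.toFinset_card_of_nodup h1).symm

lemma Pg_cons (s c x : ℕ) (l : List ℕ) :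
    Pg s c (x :: l) ↔ (¬ s ∣ (c + 1) → ∀ y ∈ l, x < y) ∧ Pg s (c + 1) l := by
  constructor
  · intro h
    constructor
    · intro hc y hy
      obtain ⟨j, hj, rfl⟩ := List.getElem_of_mem hy
      have := h 0 (j + 1) (by omega) (by simpa using hj) hc
      rw [List.getD_cons_succ, List.getD_eq_getElem _ _ hj] at this
      simpa using this
    · intro i j hij hj hd
      have := h (i + 1) (j + 1) (by omega) (by simpa using hj)
        (by rwa [show c + (i + 1) + 1 = c + 1 + i + 1 by ring])
      simpa using this
  · rintro ⟨h1, h2⟩ i j hij hj hd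
    obtain ⟨j, rfl⟩ : ∃ j', j = j' + 1 := ⟨j - 1, by omega⟩
    have hj' : j < l.length := by simpa using hj
    cases i with
    | zero =>
      have := h1 hd (l[j]) (List.getElem_mem hj')
      rw [List.getD_cons_succ, List.getD_eq_getElem _ _ hj']
      simpa using this
    | succ i =>
      have := h2 i j (by omega) hj' (by rwa [show c + 1 + i + 1 = c + (i + 1) + 1 by ring])
      simpa using this

/-- The count for `Pg`. -/
def Q (s : ℕ) : ℕ → ℕ → ℕ
  | _, 0 => 1
  | c, m + 1 => (if s ∣ (c + 1) then (m + 1) else 1) * Q s (c + 1) m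

open scoped Classical in
lemma cnt_head (S : Finset ℕ) (hS : S.Nonempty) (p : List ℕ → Prop) :
    cnt S p = ∑ x ∈ S, cnt (S.erase x) (fun l => p (x :: l)) := by
  unfold cnt
  rw [Finset.card_eq_sum_card_fiberwise (f := fun l => l.headD 0) (t := S)]
  · apply Finset.sum_congr rfl
    intro x hx
    symm
    apply Finset.card_bij (fun l _ => x :: l)
    · intro l hl
      simp only [Finset.mem_filter, mem_LS] at hl ⊢
      obtain ⟨⟨h1, h2⟩, h3⟩ := hl
      have : x ∉ l := by
        rw [← List.mem_toFinset, h2]; simp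
      refine ⟨⟨⟨List.nodup_cons.2 ⟨this, h1⟩, ?_⟩, h3⟩, rfl⟩
      rw [List.toFinset_cons, h2, Finset.insert_erase hx]
    · intro a _ b _ h
      simpa using h
    · intro l hl
      simp only [Finset.mem_filter, mem_LS] at hl
      obtain ⟨⟨⟨h1, h2⟩, h3⟩, h4⟩ := hl
      cases l with
      | nil => simp at h2; subst h2; simp at hx
      | cons y l =>
        simp at h4
        subst h4
        refine ⟨l, ?_, rfl⟩
        simp only [Finset.mem_filter, mem_LS]
        obtain ⟨h5, h6⟩ := List.nodup_cons.1 h1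
        refine ⟨⟨h6, ?_⟩, h3⟩
        rw [← h2, List.toFinset_cons, Finset.erase_insert (by simpa using h5)]
  · intro l hl
    simp only [Finset.mem_coe, Finset.mem_filter, mem_LS] at hl
    obtain ⟨⟨h1, h2⟩, h3⟩ := hl
    cases l with
    | nil => simp at h2; subst h2; simp at hS
    | cons y l => simp [← h2]

open scoped Classical in
lemma cnt_congr {S : Finset ℕ} {p q : List ℕ → Prop}
    (h : ∀ l, l.Nodup → l.toFinset = S → (p l ↔ q l)) : cnt S p = cnt S q := by
  unfold cnt
  congr 1
  apply Finset.filter_congr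
  intro l hl
  rw [mem_LS] at hl
  exact h l hl.1 hl.2

open scoped Classical in
lemma cnt_false {S : Finset ℕ} {p : List ℕ → Prop}
    (h : ∀ l, l.Nodup → l.toFinset = S → ¬ p l) : cnt S p = 0 := by
  unfold cnt
  rw [Finset.card_eq_zero, Finset.filter_eq_empty_iff]
  intro l hl
  rw [mem_LS] at hl
  exact h l hl.1 hl.2

lemma cnt_empty (p : List ℕ → Prop) (h : p []) : cnt ∅ p = 1 := by
  classical
  unfold cnt
  rw [Finset.card_eq_one]
  refine ⟨[], ?_⟩
  ext l
  simp only [Finset.mem_filter, mem_LS, Finset.mem_singleton]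
  constructor
  · rintro ⟨⟨_, h⟩, _⟩
    simpa using h
  · rintro rfl
    simp [h]

lemma cnt_Pg (s m : ℕ) : ∀ (c : ℕ) (S : Finset ℕ), S.card = m → cnt S (Pg s c) = Q s c m := by
  induction m with
  | zero =>
    intro c S hS
    rw [Finset.card_eq_zero] at hS
    subst hS
    rw [cnt_empty]
    · rfl
    · intro i j _ hj
      simp at hj
  | succ m ih =>
    intro c S hS
    have hne : S.Nonempty := by rw [← Finset.card_pos]; omega
    rw [cnt_head S hne]
    simp only [Pg_cons]
    unfold Q
    by_cases hc : s ∣ c + 1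
    · simp only [hc, not_true, false_imp_iff, true_and, if_true]
      rw [Finset.sum_congr rfl (fun x hx => ih (c + 1) (S.erase x)
        (by rw [Finset.card_erase_of_mem hx, hS]; rfl))]
      simp [hS]
    · simp only [hc, not_false_eq_true, true_imp_iff, if_false, one_mul]
      rw [Finset.sum_eq_single_of_mem (S.min' hne) (S.min'_mem hne)]
      · rw [← ih (c + 1) (S.erase (S.min' hne))
          (by rw [Finset.card_erase_of_mem (S.min'_mem hne), hS]; rfl)]
        apply cnt_congr
        intro l _ hl
        simp only [and_iff_right_iff_imp]
        intro _ y hy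
        rw [← List.mem_toFinset, hl] at hy
        exact Finset.min'_lt_of_mem_erase_min' S hne hy
      · intro x hx hxm
        apply cnt_false
        rintro l _ hl ⟨h, _⟩
        have : S.min' hne ∈ l := by
          rw [← List.mem_toFinset, hl, Finset.mem_erase]
          exact ⟨hxm.symm, S.min'_mem hne⟩
        have h1 := h _ this
        have h2 := S.min'_le x hx
        omega

lemma Q_steps (s c m : ℕ) : ∀ r, (∀ i < r, ¬ s ∣ (c + i + 1)) → Q s c (m + r) = Q s (c + r) m := by
  intro r
  induction r generalizing c with
  | zero => intro _; rfl
  | succ r ih =>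
    intro h
    rw [show m + (r + 1) = (m + r) + 1 by ring, Q, if_neg (h 0 (by omega)), one_mul, ih]
    · congr 1; ring
    · intro i hi
      have := h (i + 1) (by omega)
      rwa [show c + 1 + i + 1 = c + (i + 1) + 1 by ring]

lemma Q_eq (s : ℕ) (hs : 2 ≤ s) (k : ℕ) : ∀ c, s ∣ c →
    Q s c (s * k) = ∏ i ∈ Finset.range k, (i * s + 1) := by
  induction k with
  | zero => intro c _; rfl
  | succ k ih =>
    intro c hc
    rw [show s * (k + 1) = (s * k + 1) + (s - 1) by rw [mul_add]; omega, Q_steps]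
    · have h1 : s ∣ c + (s - 1) + 1 := by
        rw [show c + (s - 1) + 1 = c + s by omega]
        exact Dvd.dvd.add hc dvd_rfl
      rw [Q, if_pos h1, ih _ h1, Finset.prod_range_succ]
      ring
    · intro i hi hd
      rw [add_assoc, Nat.dvd_add_right hc] at hd
      have := Nat.le_of_dvd (by omega) hd
      omega

lemma Pg_iff_Hc (s : ℕ) (hs : 2 ≤ s) (k : ℕ) (l : List ℕ) (hl : l.length = s * k) :
    Pg s 0 l ↔ Hc s k l := by
  constructor
  · intro h
    refine ⟨fun i hi hd => h i (i + 1) (by omega) hi (by simpa using hd), fun j hj => ⟨fun _ => ?_, fun hk => ?_⟩⟩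
    · apply h _ _ _ hj
      · intro hd
        rw [show 0 + (j * s + (s - 2)) + 1 = s * j + (s - 1) by rw [mul_comm]; omega,
          Nat.dvd_add_right (dvd_mul_right _ _)] at hd
        have := Nat.le_of_dvd (by omega) hd
        omega
      · rw [add_mul]; omega
    · exfalso
      rw [hl] at hj
      have : s * k ≤ s * (j + 1) := Nat.mul_le_mul_left _ hk.le
      rw [mul_comm] at hj
      omega
  · rintro ⟨h1, h2⟩ i j
    induction j using Nat.strong_induction_on with
    | _ j ih =>
      intro hij hj hd
      rw [zero_add] at hd
      obtain ⟨j, rfl⟩ : ∃ j', j = j' + 1 := ⟨j - 1, by omega⟩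
      by_cases hdj : s ∣ j + 1
      · obtain ⟨q, hq⟩ := hdj
        have hij' : i ≠ j := by rintro rfl; exact hd ⟨q, hq⟩
        obtain ⟨q, rfl⟩ : ∃ q', q = q' + 1 := by
          refine ⟨q - 1, ?_⟩
          rcases q with _ | q
          · simp at hq
          · simp
        have e : j + 1 = (q + 1) * s := by rw [hq, mul_comm]
        have e2 : j - 1 = q * s + (s - 2) := by
          rw [add_mul] at e; omega
        have hk : q + 1 < k := by
          rw [hl, hq] at hj
          exact Nat.lt_of_mul_lt_mul_left hj
        have h3 := (h2 q (by rw [← e]; exact hj)).1 hk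
        rw [← e, ← e2] at h3
        rcases Nat.lt_or_ge i (j - 1) with h4 | h4
        · exact (ih (j - 1) (by omega) h4 (by omega) (by simpa using hd)).trans h3
        · have : i = j - 1 := by omega
          rw [this]; exact h3
      · have h3 := h1 j hj hdj
        rcases Nat.lt_or_ge i j with h4 | h4
        · exact (ih j (by omega) h4 (by omega) (by simpa using hd)).trans h3
        · have : i = j := by omega
          rw [this]; exact h3

lemma cnt_P (s : ℕ) (hs : 2 ≤ s) (k : ℕ) (S : Finset ℕ) (hS : S.card = s * k) :
    cnt S (Hc s k) = ∏ i ∈ Finset.range k, (i * s + 1) := by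
  rw [← Q_eq s hs k 0 (dvd_zero _), ← cnt_Pg s (s * k) 0 S hS]
  apply cnt_congr
  intro l h1 h2
  rw [Pg_iff_Hc s hs]
  rw [← hS, ← h2, List.toFinset_card_of_nodup h1]
open scoped Classical in
lemma cnt_split (S : Finset ℕ) (m : ℕ) (hm : m ≤ S.card) (p q r : List ℕ → Prop)
    (h : ∀ l, l.length = S.card → (p l ↔ q (l.take m) ∧ r (l.drop m))) :
    cnt S p = ∑ T ∈ S.powersetCard m, cnt T q * cnt (S \ T) r := by
  unfold cnt
  rw [Finset.card_eq_sum_card_fiberwise (f := fun l => (l.take m).toFinset) (t := S.powersetCard m)]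
  · apply Finset.sum_congr rfl
    intro T hT
    rw [Finset.mem_powersetCard] at hT
    rw [← Finset.card_product]
    symm
    have key : ∀ a b : List ℕ, a ∈ LS T → (a ++ b).take m = a ∧ (a ++ b).drop m = b := by
      intro a b ha
      have := LS_len ha
      rw [hT.2] at this
      rw [← this]
      simp
    apply Finset.card_bij (fun x _ => x.1 ++ x.2)
    · rintro ⟨a, b⟩ hx
      simp only [Finset.mem_filter, Finset.mem_product] at hx ⊢
      obtain ⟨⟨ha, hq⟩, hb, hr⟩ := hx
      obtain ⟨k1, k2⟩ := key a b ha
      have hab : a ++ b ∈ LS S := by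
        rw [mem_LS] at ha hb ⊢
        constructor
        · rw [List.nodup_append']
          refine ⟨ha.1, hb.1, ?_⟩
          intro x hxa hxb
          rw [← List.mem_toFinset, ha.2] at hxa
          rw [← List.mem_toFinset, hb.2] at hxb
          simp at hxb
          exact hxb.2 hxa
        · rw [List.toFinset_append, ha.2, hb.2]
          exact Finset.union_sdiff_of_subset hT.1
      refine ⟨⟨hab, ?_⟩, ?_⟩
      · rw [h _ (LS_len hab), k1, k2]
        exact ⟨hq, hr⟩
      · rw [k1]; exact (mem_LS.1 ha).2
    · rintro ⟨a, b⟩ hx ⟨a', b'⟩ hx' hh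
      simp only [Finset.mem_filter, Finset.mem_product] at hx hx' hh
      obtain ⟨k1, k2⟩ := key a b hx.1.1
      obtain ⟨k3, k4⟩ := key a' b' hx'.1.1
      rw [hh] at k1 k2
      rw [← k1, ← k2, k3, k4]
    · intro l hl
      simp only [Finset.mem_filter] at hl
      obtain ⟨⟨hl, hp⟩, hT'⟩ := hl
      rw [h _ (LS_len hl)] at hp
      rw [mem_LS] at hl
      have hnd := hl.1
      rw [← List.take_append_drop m l, List.nodup_append'] at hnd
      refine ⟨(l.take m, l.drop m), ?_, List.take_append_drop m l⟩
      simp only [Finset.mem_filter, Finset.mem_product, mem_LS]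
      refine ⟨⟨⟨hnd.1, hT'⟩, hp.1⟩, ⟨hnd.2.1, ?_⟩, hp.2⟩
      ext x
      have h2 := hl.2
      rw [← List.take_append_drop m l, List.toFinset_append, hT'] at h2
      rw [← h2, Finset.mem_sdiff, Finset.mem_union]
      constructor
      · intro hx
        refine ⟨Or.inr hx, ?_⟩
        rw [← hT']
        intro hx'
        rw [List.mem_toFinset] at hx hx'
        exact hnd.2.2 hx' hx
      · rintro ⟨h3 | h3, h4⟩
        · exact absurd h3 h4
        · exact h3
  · intro l hl
    simp only [Finset.mem_coe, Finset.mem_filter] at hl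
    rw [Finset.mem_coe, Finset.mem_powersetCard]
    have h1 := LS_len hl.1
    obtain ⟨h2, h3⟩ := mem_LS.1 hl.1
    constructor
    · rw [← h3]
      intro x hx
      rw [List.mem_toFinset] at hx ⊢
      exact List.mem_of_mem_take hx
    · rw [List.toFinset_card_of_nodup (h2.sublist (List.take_sublist _ _)), List.length_take, h1]
      omega

lemma getD_take' (l : List ℕ) (m i : ℕ) (h : i < m) : (l.take m).getD i 0 = l.getD i 0 := by
  simp [List.getD_eq_getElem?_getD, h]

lemma getD_drop' (l : List ℕ) (m i : ℕ) : (l.drop m).getD i 0 = l.getD (m + i) 0 := by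
  simp [List.getD_eq_getElem?_getD, List.getElem?_drop]

lemma Hc_split (s : ℕ) (hs : 2 ≤ s) (n k : ℕ) (hk : k ≤ n) (l : List ℕ) (hl : l.length = s * n) :
    Hc s k l ↔ Hc s k (l.take (s * k)) ∧ Hc s 0 (l.drop (s * k)) := by
  have hkn : s * k ≤ s * n := Nat.mul_le_mul_left _ hk
  have hlt : (l.take (s * k)).length = s * k := by rw [List.length_take]; omega
  have hld : (l.drop (s * k)).length = s * n - s * k := by rw [List.length_drop]; omega
  constructor
  · rintro ⟨h1, h2⟩
    refine ⟨⟨?_, ?_⟩, ?_, ?_⟩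
    · intro i hi hd
      rw [hlt] at hi
      rw [getD_take' _ _ _ (by omega), getD_take' _ _ _ (by omega)]
      exact h1 i (by omega) hd
    · intro j hj
      rw [hlt] at hj
      have hj2 := hj
      rw [add_mul] at hj2
      rw [getD_take' _ _ _ (by omega), getD_take' _ _ _ (by omega)]
      exact h2 j (by omega)
    · intro i hi hd
      rw [hld] at hi
      rw [getD_drop', getD_drop', ← add_assoc]
      apply h1 _ (by omega)
      rwa [add_assoc, Nat.dvd_add_right (dvd_mul_right _ _)]
    · intro j hj
      rw [hld] at hj
      refine ⟨fun h => by omega, fun _ => ?_⟩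
      rw [getD_drop', getD_drop']
      have e : s * k + (j + 1) * s = (k + j + 1) * s := by ring
      have := (h2 (k + j) (by rw [← e]; omega)).2 (by omega)
      rw [e, ← add_assoc, show s * k + j * s = (k + j) * s by ring]
      exact this
  · rintro ⟨⟨h1, h2⟩, h3, h4⟩
    rw [hlt] at h1 h2
    rw [hld] at h3 h4
    refine ⟨?_, ?_⟩
    · intro i hi hd
      rcases Nat.lt_or_ge (i + 1) (s * k) with h | h
      · have := h1 i h hd
        rwa [getD_take' _ _ _ (by omega), getD_take' _ _ _ (by omega)] at this
      · have hne : i + 1 ≠ s * k := fun e => hd ⟨k, e⟩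
        obtain ⟨i, rfl⟩ := Nat.exists_eq_add_of_le (show s * k ≤ i by omega)
        have := h3 i (by omega) (by rwa [add_assoc, Nat.dvd_add_right (dvd_mul_right _ _)] at hd)
        rwa [getD_drop', getD_drop', ← add_assoc] at this
    · intro j hj
      constructor
      · intro hjk
        have hjk' : (j + 1) * s < s * k := by
          rw [mul_comm]; exact Nat.mul_lt_mul_of_pos_left hjk (by omega)
        have hj2 := hjk'
        rw [add_mul] at hj2
        have := (h2 j hjk').1 hjk
        rwa [getD_take' _ _ _ (by omega), getD_take' _ _ _ (by omega)] at this
      · intro hjk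
        obtain ⟨j, rfl⟩ := Nat.exists_eq_add_of_le (show k ≤ j by omega)
        have e : s * k + (j + 1) * s = (k + j + 1) * s := by ring
        have := (h4 j (by rw [← e] at hj; omega)).2 (by omega)
        rw [getD_drop', getD_drop'] at this
        rw [e, ← add_assoc, show s * k + j * s = (k + j) * s by ring] at this
        exact this

open scoped Classical in
lemma H_step (s : ℕ) (hs : 2 ≤ s) (n k : ℕ) (hk : k + 1 < n) (S : Finset ℕ) (hS : S.card = s * n) :
    cnt S (Hc s (k + 1)) = cnt S (Gc s k) + cnt S (Gc s (k + 1)) := by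
  unfold cnt
  rw [← Finset.card_union_of_disjoint, ← Finset.filter_or]
  · congr 1
    apply Finset.filter_congr
    intro l hl
    have hlen := LS_len hl
    rw [hS] at hlen
    have hnd := (mem_LS.1 hl).1
    constructor
    · rintro ⟨h1, h2⟩
      have hb : (k + 1) * s < l.length := by
        rw [hlen, mul_comm]; exact Nat.mul_lt_mul_of_pos_left hk (by omega)
      have hb2 := hb
      rw [add_mul] at hb2
      have hne : l.getD (k * s + (s - 2)) 0 ≠ l.getD ((k + 1) * s) 0 := by
        rw [List.getD_eq_getElem _ _ hb, List.getD_eq_getElem _ _ (by omega)]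
        intro e
        rw [hnd.getElem_inj_iff, add_mul] at e
        omega
      rcases lt_or_gt_of_ne hne with h | h
      · right
        refine ⟨h1, fun j hj => ⟨fun hjk => ?_, fun hjk => (h2 j hj).2 hjk⟩⟩
        rcases Nat.lt_or_ge j k with h3 | h3
        · exact (h2 j hj).1 (by omega)
        · obtain rfl : j = k := by omega
          exact h
      · left
        refine ⟨h1, fun j hj => ⟨fun hjk => (h2 j hj).1 (by omega), fun hjk => ?_⟩⟩
        rcases Nat.lt_or_ge k j with h3 | h3
        · exact (h2 j hj).2 (by omega)
        · obtain rfl : j = k := by omega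
          exact h
    · rintro (⟨h1, h2⟩ | ⟨h1, h2⟩)
      · exact ⟨h1, fun j hj => ⟨fun h => (h2 j hj).1 (by omega), fun h => (h2 j hj).2 (by omega)⟩⟩
      · exact ⟨h1, fun j hj => ⟨fun h => (h2 j hj).1 (by omega), fun h => (h2 j hj).2 (by omega)⟩⟩
  · rw [Finset.disjoint_filter]
    intro l hl ⟨_, h2⟩ ⟨_, h3⟩
    have hlen := LS_len hl
    rw [hS] at hlen
    have hb : (k + 1) * s < l.length := by
      rw [hlen, mul_comm]; exact Nat.mul_lt_mul_of_pos_left hk (by omega)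
    have h4 := (h2 k hb).2 (by omega)
    have h5 := (h3 k hb).1 (by omega)
    omega

lemma H_zero (s : ℕ) (S : Finset ℕ) : cnt S (Hc s 0) = cnt S (Gc s 0) := by
  apply cnt_congr
  intro l _ _
  unfold Hc Gc
  simp

lemma H_last (s : ℕ) (n : ℕ) (S : Finset ℕ) (hS : S.card = s * (n + 1)) :
    cnt S (Hc s (n + 1)) = cnt S (Gc s n) := by
  apply cnt_congr
  intro l h1 h2
  have hlen : l.length = s * (n + 1) := by
    rw [← hS, ← h2, List.toFinset_card_of_nodup h1]
  have key : ∀ j, (j + 1) * s < l.length → j + 1 < n + 1 := by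
    intro j hj
    rw [hlen, mul_comm] at hj
    exact Nat.lt_of_mul_lt_mul_left hj
  constructor
  · rintro ⟨h1, h2⟩
    exact ⟨h1, fun j hj => ⟨fun h => (h2 j hj).1 (by omega), fun h => by have := key j hj; omega⟩⟩
  · rintro ⟨h1, h2⟩
    exact ⟨h1, fun j hj => ⟨fun h => (h2 j hj).1 (by omega), fun h => by have := key j hj; omega⟩⟩

lemma H_alt (s : ℕ) (hs : 2 ≤ s) (n : ℕ) (S : Finset ℕ) (hS : S.card = s * (n + 1)) :
    ∑ k ∈ Finset.range (n + 2), (-1 : ℤ) ^ k * (cnt S (Hc s k) : ℤ) = 0 := by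
  have key : ∀ m ≤ n, ∑ k ∈ Finset.range (m + 1), (-1 : ℤ) ^ k * (cnt S (Hc s k) : ℤ)
      = (-1) ^ m * (cnt S (Gc s m) : ℤ) := by
    intro m
    induction m with
    | zero => intro _; simp [H_zero]
    | succ m ih =>
      intro hm
      rw [Finset.sum_range_succ, ih (by omega), H_step s hs (n + 1) m (by omega) S hS]
      push_cast
      ring
  rw [Finset.sum_range_succ, key n le_rfl, H_last s n S hS]
  ring

lemma A_alt (s : ℕ) (hs : 2 ≤ s) (n : ℕ) (S : Finset ℕ) (hS : S.card = s * (n + 1)) :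
    ∑ k ∈ Finset.range (n + 2), (-1 : ℤ) ^ k * ((∏ i ∈ Finset.range k, (i * s + 1) : ℕ) : ℤ) *
      (∑ T ∈ S.powersetCard (s * k), (cnt (S \ T) (Hc s 0) : ℤ)) = 0 := by
  rw [← H_alt s hs n S hS]
  apply Finset.sum_congr rfl
  intro k hk
  have hk' : k ≤ n + 1 := by simp at hk; omega
  rw [cnt_split S (s * k) (by rw [hS]; exact Nat.mul_le_mul_left _ hk') (Hc s k) (Hc s k) (Hc s 0)
    (fun l hl => Hc_split s hs (n + 1) k hk' l (by rw [hl, hS]))]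
  rw [mul_assoc]
  congr 1
  push_cast
  rw [Finset.mul_sum]
  apply Finset.sum_congr rfl
  intro T hT
  rw [cnt_P s hs k T (Finset.mem_powersetCard.1 hT).2]
  push_cast
  rfl

/-- The count on the standard set. -/
noncomputable def aN (s n : ℕ) : ℕ := cnt (Finset.Icc 1 (s * n)) (Hc s 0)

lemma A_inv (s : ℕ) (hs : 2 ≤ s) (n : ℕ) : ∀ S : Finset ℕ, S.card = s * n →
    cnt S (Hc s 0) = aN s n := by
  induction n using Nat.strong_induction_on with
  | _ n ih =>
    intro S hS
    rcases n with _ | n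
    · rw [mul_zero, Finset.card_eq_zero] at hS
      subst hS
      simp [aN]
    · have key : ∀ S : Finset ℕ, S.card = s * (n + 1) → (cnt S (Hc s 0) : ℤ) =
        - ∑ k ∈ Finset.range (n + 1), (-1 : ℤ) ^ (k + 1) *
          ((∏ i ∈ Finset.range (k + 1), (i * s + 1) : ℕ) : ℤ) *
          (((s * (n + 1)).choose (s * (k + 1)) : ℤ) * (aN s (n - k) : ℤ)) := by
        intro S hS
        have := A_alt s hs n S hS
        rw [Finset.sum_range_succ'] at this
        simp only [mul_zero, Finset.powersetCard_zero, Finset.sum_singleton, Finset.sdiff_empty,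
          pow_zero, Finset.range_zero, Finset.prod_empty, Nat.cast_one, one_mul] at this
        rw [eq_neg_iff_add_eq_zero, add_comm, ← this]
        congr 1
        apply Finset.sum_congr rfl
        intro k hk
        have hk' : k ≤ n := by simp at hk; omega
        congr 1
        rw [Finset.sum_congr rfl (fun T hT => by
          rw [ih (n - k) (by omega) (S \ T) (by
            rw [Finset.mem_powersetCard] at hT
            rw [Finset.card_sdiff_of_subset hT.1, hS, hT.2, ← Nat.mul_sub]
            congr 1; omega)])]
        simp [hS]
      have h1 := key S hS
      rw [← key (Finset.Icc 1 (s * (n + 1))) (by simp)] at h1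
      exact_mod_cast h1

lemma a_alt (s : ℕ) (hs : 2 ≤ s) (n : ℕ) :
    ∑ k ∈ Finset.range (n + 2), (-1 : ℤ) ^ k * ((∏ i ∈ Finset.range k, (i * s + 1) : ℕ) : ℤ) *
      (((s * (n + 1)).choose (s * k) : ℤ) * (aN s (n + 1 - k) : ℤ)) = 0 := by
  rw [← A_alt s hs n (Finset.Icc 1 (s * (n + 1))) (by simp)]
  apply Finset.sum_congr rfl
  intro k hk
  congr 1
  rw [Finset.sum_congr rfl (fun T hT => by
    rw [A_inv s hs (n + 1 - k) _ (by
            rw [Finset.mem_powersetCard] at hT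
            rw [Finset.card_sdiff_of_subset hT.1, hT.2, Nat.mul_sub]
            simp)])]
  simp

lemma aN_zero (s : ℕ) : aN s 0 = 1 := by
  unfold aN
  rw [show Finset.Icc 1 (s * 0) = ∅ by simp]
  apply cnt_empty
  simp [Hc]
/-- Number of descents among the first `m` adjacent pairs. -/
def gd (l : List ℕ) (m : ℕ) : ℕ :=
  ∑ i ∈ Finset.range m, if l.getD (i + 1) 0 < l.getD i 0 then 1 else 0

lemma desL_eq (l : List ℕ) : desL l = gd l (l.length - 1) := by
  induction l with
  | nil => rfl
  | cons a l ih =>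
    cases l with
    | nil => rfl
    | cons b l =>
      have h1 : desL (a :: b :: l) = desL (b :: l) + (if b < a then 1 else 0) := by
        simp [desL, List.countP_cons]
      rw [h1, ih]
      unfold gd
      simp only [List.length_cons, Nat.add_sub_cancel]
      rw [Finset.sum_range_succ']
      simp

lemma gd_succ (l : List ℕ) (m : ℕ) :
    gd l (m + 1) = gd l m + if l.getD (m + 1) 0 < l.getD m 0 then 1 else 0 := by
  unfold gd
  rw [Finset.sum_range_succ]

lemma gd_mono (l : List ℕ) : Monotone (gd l) := by
  apply monotone_nat_of_le_succ
  intro n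
  rw [gd_succ]
  omega

lemma redL_sorted (l : List ℕ) (h : l.Pairwise (· < ·)) : redL l = List.range' 1 l.length := by
  induction l with
  | nil => rfl
  | cons a l ih =>
    rw [List.pairwise_cons] at h
    have ih' := ih h.2
    have h0 : l.countP (fun y => decide (y < a)) = 0 := by
      rw [List.countP_eq_zero]
      intro y hy
      have := h.1 y hy
      simp; omega
    have h1 : ∀ x ∈ l, (a :: l).countP (fun y => decide (y < x)) =
        l.countP (fun y => decide (y < x)) + 1 := by
      intro x hx
      rw [List.countP_cons_of_pos]
      simpa using h.1 x hx
    unfold redL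
    rw [List.map_cons, List.length_cons, List.range'_succ]
    congr 1
    · simp [h0]
    · have e : List.range' (1 + 1) l.length = (List.range' 1 l.length).map (fun x => 1 + x) := by
        rw [List.map_add_range']
      rw [e, ← ih', redL, List.map_map]
      apply List.map_congr_left
      intro x hx
      rw [h1 x hx]
      simp only [Function.comp]
      omega

lemma countP_lt_mono (l : List ℕ) {x y : ℕ} (h : x ≤ y) :
    l.countP (fun z => decide (z < x)) ≤ l.countP (fun z => decide (z < y)) := by
  apply List.countP_mono_left
  intro z _ hz
  simp at hz ⊢
  omega

lemma redL_lt (w : List ℕ) (i j : ℕ) (hi : i < w.length) (hj : j < w.length)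
    (h : (redL w).getD i 0 < (redL w).getD j 0) : w.getD i 0 < w.getD j 0 := by
  rw [List.getD_eq_getElem _ _ hi, List.getD_eq_getElem _ _ hj]
  rw [List.getD_eq_getElem _ _ (by simpa [redL] using hi),
    List.getD_eq_getElem _ _ (by simpa [redL] using hj)] at h
  simp only [redL, List.getElem_map] at h
  by_contra hc
  have := countP_lt_mono w (not_lt.1 hc)
  omega

lemma window_getD (l : List ℕ) (i j a : ℕ) (ha : a ≤ j) :
    ((l.drop i).take (j + 1)).getD a 0 = l.getD (i + a) 0 := by
  rw [getD_take' _ _ _ (by omega), getD_drop']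

/-- The forbidden set. -/
def Gam (s : ℕ) : Set (List ℕ) := {[1, 3, 2, 4], [1, 4, 2, 3], List.range' 1 (s + 1)}

lemma nm_window (s : ℕ) (hs : 2 ≤ s) (l : List ℕ) (hnd : l.Nodup) (h : ¬ HasMatch (Gam s) l)
    (i : ℕ) (hi : i + s < l.length) : gd l i + 1 ≤ gd l (i + s) := by
  by_contra hc
  apply h
  refine ⟨i, s, by omega, by omega, Or.inr (Or.inr ?_)⟩
  set w := (l.drop i).take (s + 1) with hw
  have hlen : w.length = s + 1 := by
    rw [hw, List.length_take, List.length_drop]; omega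
  rw [Set.mem_singleton_iff, redL_sorted, hlen]
  rw [← List.isChain_iff_pairwise, List.isChain_iff_getElem]
  intro a ha
  have h1 := window_getD l i s a (by omega)
  have h2 := window_getD l i s (a + 1) (by omega)
  rw [← hw, List.getD_eq_getElem _ _ (by omega)] at h1
  rw [← hw, List.getD_eq_getElem _ _ (by omega)] at h2
  rw [h1, h2]
  have h3 := gd_succ l (i + a)
  have h4 := gd_mono l (show i ≤ i + a by omega)
  have h5 := gd_mono l (show i + a + 1 ≤ i + s by omega)
  have h6 : ¬ (l.getD (i + a + 1) 0 < l.getD (i + a) 0) := by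
    intro h6
    rw [if_pos h6] at h3
    omega
  have hne : l.getD (i + a) 0 ≠ l.getD (i + a + 1) 0 := by
    rw [List.getD_eq_getElem _ _ (by omega), List.getD_eq_getElem _ _ (by omega)]
    intro e
    rw [hnd.getElem_inj_iff] at e
    omega
  rw [← add_assoc]
  omega

lemma nm_windows (s : ℕ) (hs : 2 ≤ s) (l : List ℕ) (hnd : l.Nodup) (h : ¬ HasMatch (Gam s) l)
    (i k : ℕ) (hi : i + s * k < l.length) : gd l i + k ≤ gd l (i + s * k) := by
  induction k with
  | zero => simp
  | succ k ih =>
    have e : i + s * (k + 1) = i + s * k + s := by ring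
    rw [e] at hi ⊢
    have := nm_window s hs l hnd h (i + s * k) hi
    have := ih (by omega)
    omega

lemma nm_bound (s : ℕ) (hs : 2 ≤ s) (l : List ℕ) (hnd : l.Nodup) (h : ¬ HasMatch (Gam s) l) :
    l.length ≤ s * (1 + desL l) := by
  by_contra hc
  have := nm_windows s hs l hnd h 0 (1 + desL l) (by omega)
  have h2 := gd_mono l (show 0 + s * (1 + desL l) ≤ l.length - 1 by omega)
  rw [← desL_eq] at h2
  omega

lemma not_dvd_aux (s q r : ℕ) (h0 : 0 < r) (h1 : r < s) : ¬ s ∣ q * s + r := by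
  rw [mul_comm, Nat.dvd_add_right (dvd_mul_right _ _)]
  intro h
  have := Nat.le_of_dvd h0 h
  omega

lemma nm_Hc (s : ℕ) (hs : 2 ≤ s) (n : ℕ) (l : List ℕ) (hnd : l.Nodup)
    (hlen : l.length = s * (n + 1)) (h : ¬ HasMatch (Gam s) l) (hd : desL l = n) : Hc s 0 l := by
  rw [desL_eq, hlen] at hd
  have ha : ∀ j, j ≤ n → gd l (s * j + (s - 1)) = j := by
    intro j hj
    obtain ⟨m, rfl⟩ := Nat.exists_eq_add_of_le hj
    have h1 := nm_windows s hs l hnd h (s - 1) j (by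
      rw [hlen, mul_add, mul_add]; omega)
    have h2 := nm_windows s hs l hnd h (s * j + (s - 1)) m (by
      rw [hlen, mul_add, mul_add]; omega)
    rw [show s * j + (s - 1) + s * m = s * (j + m + 1) - 1 by rw [mul_add, mul_add]; omega, hd] at h2
    rw [add_comm (s - 1) (s * j)] at h1
    omega
  have hb : ∀ j, j ≤ n → gd l (s * j) = j := by
    intro j hj
    have h1 := nm_windows s hs l hnd h 0 j (by
      have := Nat.mul_le_mul_left s hj
      rw [hlen, mul_add]; omega)
    have h2 := gd_mono l (show s * j ≤ s * j + (s - 1) by omega)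
    rw [ha j hj] at h2
    rw [zero_add] at h1
    omega
  have hne : ∀ i j, i < j → j < l.length → l.getD i 0 ≠ l.getD j 0 := by
    intro i j hij hj
    rw [List.getD_eq_getElem _ _ (by omega), List.getD_eq_getElem _ _ (by omega)]
    intro e
    rw [hnd.getElem_inj_iff] at e
    omega
  have hB : ∀ i, i + 1 < l.length → ¬ s ∣ (i + 1) → l.getD i 0 < l.getD (i + 1) 0 := by
    intro i hi hdv
    have e := Nat.div_add_mod i s
    have hr : i % s < s := Nat.mod_lt _ (by omega)
    have hr2 : i % s ≠ s - 1 := by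
      intro e2
      apply hdv
      refine ⟨i / s + 1, ?_⟩
      rw [mul_add]; omega
    have hq : i / s ≤ n := by
      rw [← Nat.lt_succ_iff, Nat.div_lt_iff_lt_mul (by omega)]
      rw [hlen] at hi
      rw [Nat.succ_eq_add_one, mul_comm]; omega
    have h1 := ha _ hq
    have h2 := hb _ hq
    have h3 := gd_mono l (show s * (i / s) ≤ i by omega)
    have h4 := gd_mono l (show i + 1 ≤ s * (i / s) + (s - 1) by omega)
    rw [gd_succ] at h4
    have h5 : ¬ (l.getD (i + 1) 0 < l.getD i 0) := by
      intro h6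
      rw [if_pos h6] at h4
      omega
    have := hne i (i + 1) (by omega) hi
    omega
  refine ⟨hB, fun j hj => ⟨fun h => by omega, fun _ => ?_⟩⟩
  have hjn : j + 1 ≤ n := by
    rw [hlen, mul_comm] at hj
    have := Nat.lt_of_mul_lt_mul_left hj
    omega
  -- the four entries
  have e0 : (j + 1) * s = j * s + (s - 2) + 2 := by rw [add_mul]; omega
  have hj3 : j * s + (s - 2) + 3 < l.length := by
    rw [hlen]
    have := Nat.mul_le_mul_left s (show j + 2 ≤ n + 1 by omega)
    rw [mul_add, mul_comm s j] at this
    omega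
  by_contra hcon
  rw [e0] at hcon
  have w1 : l.getD (j * s + (s - 2)) 0 < l.getD (j * s + (s - 2) + 2) 0 := by
    have := hne (j * s + (s - 2)) (j * s + (s - 2) + 2) (by omega) (by omega)
    omega
  have w2 : l.getD (j * s + (s - 2) + 2) 0 < l.getD (j * s + (s - 2) + 2 + 1) 0 := by
    apply hB _ (by omega)
    rw [← e0]
    exact not_dvd_aux s _ 1 (by omega) (by omega)
  have w3 : l.getD (j * s + (s - 2) + 1 + 1) 0 < l.getD (j * s + (s - 2) + 1) 0 := by
    have h1 := ha j (by omega)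
    have h2 := hb (j + 1) hjn
    rw [show s * (j + 1) = (s * j + (s - 1)) + 1 by rw [mul_add]; omega, gd_succ, h1] at h2
    rw [show s * j + (s - 1) = j * s + (s - 2) + 1 by rw [mul_comm]; omega] at h2
    by_contra h7
    rw [if_neg h7] at h2
    omega
  have w4 := hne (j * s + (s - 2) + 1) (j * s + (s - 2) + 3) (by omega) (by omega)
  apply h
  refine ⟨j * s + (s - 2), 3, by omega, by omega, ?_⟩
  generalize j * s + (s - 2) = p at *
  have hw : (l.drop p).take (3 + 1) =
      [l.getD p 0, l.getD (p + 1) 0, l.getD (p + 2) 0, l.getD (p + 3) 0] := by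
    apply List.ext_getElem
    · simp; omega
    · intro a h1 h2
      have ha : a < 4 := by simpa using h2
      rw [← List.getD_eq_getElem _ 0 h1, window_getD _ _ _ _ (by omega)]
      interval_cases a <;> rfl
  rw [hw]
  generalize l.getD p 0 = a at *
  generalize l.getD (p + 1) 0 = b at *
  generalize l.getD (p + 2) 0 = c at *
  generalize l.getD (p + 3) 0 = d at *
  have w2' : c < d := w2
  have w3' : c < b := w3
  rcases lt_or_gt_of_ne w4 with h8 | h8
  · left
    simp [redL, List.countP_cons, show ¬ b < a by omega, show ¬ c < a by omega, show ¬ d < a by omega,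
      show a < b by omega, show a < c by omega, show a < d by omega, show c < b by omega,
      show ¬ b < c by omega, show b < d by omega, show ¬ d < b by omega, show c < d by omega,
      show ¬ d < c by omega]
  · right; left
    simp [redL, List.countP_cons, show ¬ b < a by omega, show ¬ c < a by omega, show ¬ d < a by omega,
      show a < b by omega, show a < c by omega, show a < d by omega, show c < b by omega,
      show ¬ b < c by omega, show ¬ b < d by omega, show d < b by omega, show c < d by omega,
      show ¬ d < c by omega]

lemma Hc_desc (s : ℕ) (hs : 2 ≤ s) (l : List ℕ) (h : Hc s 0 l) (i : ℕ) (hi : i + 1 < l.length)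
    (hd : s ∣ i + 1) : l.getD (i + 1) 0 < l.getD (i - 1) 0 ∧ l.getD (i - 1) 0 < l.getD i 0 := by
  obtain ⟨q, hq⟩ := hd
  obtain ⟨q, rfl⟩ : ∃ q', q = q' + 1 := by
    refine ⟨q - 1, ?_⟩
    rcases q with _ | q
    · simp at hq
    · simp
  have e : i + 1 = (q + 1) * s := by rw [hq, mul_comm]
  have e2 : i - 1 = q * s + (s - 2) := by rw [add_mul] at e; omega
  have e3 : i = i - 1 + 1 := by rw [add_mul] at e; omega
  constructor
  · rw [e, e2]
    exact (h.2 q (by rw [← e]; exact hi)).2 (by omega)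
  · have := h.1 (i - 1) (by omega) (by
      rw [e2, show q * s + (s - 2) + 1 = q * s + (s - 1) by omega]
      exact not_dvd_aux s q (s - 1) (by omega) (by omega))
    rwa [← e3] at this

lemma Hc_des (s : ℕ) (hs : 2 ≤ s) (n : ℕ) (l : List ℕ)
    (hlen : l.length = s * (n + 1)) (h : Hc s 0 l) : desL l = n := by
  have key : ∀ m, m < l.length → gd l m = m / s := by
    intro m
    induction m with
    | zero => intro _; simp [gd]
    | succ m ih =>
      intro hm
      rw [gd_succ, ih (by omega), Nat.succ_div]
      congr 1
      by_cases hd : s ∣ m + 1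
      · have := Hc_desc s hs l h m hm hd
        rw [if_pos hd, if_pos (by omega)]
      · have := h.1 m hm hd
        rw [if_neg hd, if_neg (by omega)]
  have hpos : 0 < s * (n + 1) := by positivity
  rw [desL_eq, key _ (by omega), hlen]
  rw [show s * (n + 1) - 1 = (s - 1) + s * n by rw [mul_add]; omega,
    Nat.add_mul_div_left _ _ (by omega), Nat.div_eq_of_lt (by omega), zero_add]

lemma Hc_nm (s : ℕ) (hs : 2 ≤ s) (l : List ℕ) (h : Hc s 0 l) : ¬ HasMatch (Gam s) l := by
  rintro ⟨i, j, hj, hij, hm⟩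
  set w := (l.drop i).take (j + 1) with hw
  have hlen : w.length = j + 1 := by
    rw [hw, List.length_take, List.length_drop]; omega
  have hrl : (redL w).length = j + 1 := by simp [redL, hlen]
  have key : ∀ a b, a ≤ j → b ≤ j → (redL w).getD a 0 < (redL w).getD b 0 →
      l.getD (i + a) 0 < l.getD (i + b) 0 := by
    intro a b ha hb hab
    have := redL_lt w a b (by omega) (by omega) hab
    rwa [hw, window_getD _ _ _ _ ha, window_getD _ _ _ _ hb] at this
  have four : ∀ x y : ℕ, redL w = [1, x, 2, y] → 2 < x → False := by
    intro x y e hx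
    rw [e] at hrl key
    have hj3 : j = 3 := by simpa using hrl.symm
    subst hj3
    have k1 := key 0 2 (by omega) (by omega) (by simp)
    have k2 := key 2 1 (by omega) (by omega) (by simpa using hx)
    by_cases hd : s ∣ i + 1 + 1
    · have := (Hc_desc s hs l h (i + 1) (by omega) hd).1
      simp only [Nat.add_sub_cancel] at this
      have e : l.getD (i + 1 + 1) 0 = l.getD (i + 2) 0 := rfl
      have e' : l.getD (i + 0) 0 = l.getD i 0 := rfl
      omega
    · have := h.1 (i + 1) (by omega) hd
      have e : l.getD (i + 1 + 1) 0 = l.getD (i + 2) 0 := rfl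
      omega
  rcases hm with hm | hm | hm
  · exact four _ _ hm (by omega)
  · exact four _ _ hm (by omega)
  · rw [Set.mem_singleton_iff] at hm
    have hjs : j = s := by
      rw [hm] at hrl; simpa using hrl.symm
    subst hjs
    -- find a multiple
    have e := Nat.div_add_mod i j
    have hr : i % j < j := Nat.mod_lt _ (by omega)
    have hdv : j ∣ (i + (j - 1 - i % j)) + 1 := ⟨i / j + 1, by rw [mul_add]; omega⟩
    have := Hc_desc j hs l h _ (by omega) hdv
    have k := key (j - 1 - i % j) (j - 1 - i % j + 1) (by omega) (by omega) (by
      rw [hm, List.getD_eq_getElem _ _ (by simp; omega), List.getD_eq_getElem _ _ (by simp; omega)]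
      simp)
    rw [← add_assoc] at k
    omega
lemma mem_NM (Γ : Set (List ℕ)) (m : ℕ) (l : List ℕ) :
    l ∈ NMfinset Γ m ↔ l ∈ LS (Finset.Icc 1 m) ∧ ¬ HasMatch Γ l := by
  classical
  unfold NMfinset
  rw [Finset.mem_filter, List.mem_toFinset, List.mem_permutations, mem_LS]
  have e : (List.range' 1 m).toFinset = Finset.Icc 1 m := by
    ext x
    rw [List.mem_toFinset, List.mem_range'_1, Finset.mem_Icc]
    omega
  constructor
  · rintro ⟨h1, h2⟩
    refine ⟨⟨h1.nodup_iff.2 (List.nodup_range'), ?_⟩, h2⟩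
    rw [List.toFinset_eq_of_perm _ _ h1, e]
  · rintro ⟨⟨h1, h3⟩, h2⟩
    refine ⟨?_, h2⟩
    rw [← e] at h3
    exact List.perm_of_nodup_nodup_toFinset_eq h1 (List.nodup_range') h3

lemma NM_low (s : ℕ) (hs : 2 ≤ s) (m j : ℕ) (h : s * j < m) : (NMpoly (Gam s) m).coeff j = 0 := by
  unfold NMpoly
  rw [if_neg (by omega), finsetSum_coeff]
  apply Finset.sum_eq_zero
  intro l hl
  rw [mem_NM] at hl
  rw [coeff_X_pow, if_neg]
  rintro rfl
  have := nm_bound s hs l (mem_LS.1 hl.1).1 hl.2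
  have h2 := LS_len hl.1
  simp at h2
  omega

lemma NM_top (s : ℕ) (hs : 2 ≤ s) (n : ℕ) : (NMpoly (Gam s) (s * n)).coeff n = (aN s n : ℚ) := by
  classical
  rcases n with _ | n
  · rw [aN_zero]
    simp [NMpoly]
  · unfold NMpoly
    rw [if_neg (by positivity), finsetSum_coeff]
    simp only [coeff_X_pow]
    rw [Finset.sum_boole]
    unfold aN cnt
    congr 2
    ext l
    rw [Finset.mem_filter, Finset.mem_filter, mem_NM]
    constructor
    · rintro ⟨⟨h1, h2⟩, h3⟩
      refine ⟨h1, nm_Hc s hs n l (mem_LS.1 h1).1 ?_ h2 (by omega)⟩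
      rw [LS_len h1]; simp
    · rintro ⟨h1, h2⟩
      refine ⟨⟨h1, Hc_nm s hs l h2⟩, ?_⟩
      rw [Hc_des s hs n l (by rw [LS_len h1]; simp) h2]
      omega

theorem stmt13 (s : ℕ) (hs : 2 ≤ s) (Γ : Set (List ℕ))
    (hΓ : Γ = {[1, 3, 2, 4], [1, 4, 2, 3], List.range' 1 (s + 1)})
    (U : ℤ → Polynomial ℚ)
    (hUneg : ∀ m : ℤ, m < 0 → U m = 0)
    (hU0 : U 0 = 1)
    (hUrec : ∀ n : ℕ, 1 ≤ n →
      ∑ k ∈ Finset.range (n + 1), (n.choose k : ℚ) • (U (k : ℤ) * NMpoly Γ (n - k)) = 0) :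
    ∀ n : ℕ, 1 ≤ n →
      ((U ((s * n : ℕ) : ℤ)).comp (-X)).coeff n =
        ((∏ i ∈ Finset.Icc 1 n, ((i - 1) * s + 1) : ℕ) : ℚ) := by
  have hG : Γ = Gam s := hΓ
  clear hΓ
  subst hG
  have hNM0 : NMpoly (Gam s) 0 = 1 := by simp [NMpoly]
  have hlow : ∀ m : ℕ, ∀ j, s * j < m → (U (m : ℤ)).coeff j = 0 := by
    intro m
    induction m using Nat.strong_induction_on with
    | _ m ih =>
      intro j hj
      have h := hUrec m (by omega)
      rw [Finset.sum_range_succ] at h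
      simp only [Nat.choose_self, Nat.cast_one, one_smul, Nat.sub_self, hNM0, mul_one] at h
      have h2 := congrArg (fun p => p.coeff j) h
      simp only [coeff_add, finsetSum_coeff, coeff_zero, coeff_smul] at h2
      rw [Finset.sum_eq_zero, zero_add] at h2
      · exact h2
      · intro k hk
        rw [Finset.mem_range] at hk
        rw [coeff_mul, Finset.sum_eq_zero, smul_zero]
        rintro ⟨a, b⟩ hab
        rw [Finset.HasAntidiagonal.mem_antidiagonal] at hab
        simp only at hab ⊢
        rw [← hab, mul_add] at hj
        rcases Nat.lt_or_ge (s * a) k with h3 | h3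
        · rw [ih k hk a h3, zero_mul]
        · rw [NM_low s hs (m - k) b (by omega), mul_zero]
  have hrec : ∀ n : ℕ, ∑ k ∈ Finset.range (n + 2), ((s * (n + 1)).choose (s * k) : ℚ) *
      ((U ((s * k : ℕ) : ℤ)).coeff k * (aN s (n + 1 - k) : ℚ)) = 0 := by
    intro n
    have h := congrArg (fun p => p.coeff (n + 1)) (hUrec (s * (n + 1)) (by
      have : 0 < s * (n + 1) := by positivity
      omega))
    simp only [finsetSum_coeff, coeff_zero, coeff_smul, coeff_mul, smul_eq_mul, Finset.mul_sum] at h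
    rw [Finset.sum_comm, Finset.Nat.sum_antidiagonal_eq_sum_range_succ_mk] at h
    rw [← h]
    apply Finset.sum_congr rfl
    intro k hk
    have hk' : k ≤ n + 1 := by simp at hk; omega
    have hsk : s * k ≤ s * (n + 1) := Nat.mul_le_mul_left _ hk'
    rw [Finset.sum_eq_single_of_mem (s * k) (by simp only [Finset.mem_range]; omega)]
    · simp only
      rw [← Nat.mul_sub, NM_top s hs]
    · intro K hK hne
      rw [Finset.mem_range] at hK
      simp only
      rcases Nat.lt_or_ge (s * k) K with h3 | h3
      · rw [hlow K k h3]; ring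
      · rw [NM_low s hs _ (n + 1 - k) (by rw [Nat.mul_sub]; omega)]; ring
  have hu : ∀ n : ℕ, (U ((s * n : ℕ) : ℤ)).coeff n =
      (-1) ^ n * ((∏ i ∈ Finset.range n, (i * s + 1) : ℕ) : ℚ) := by
    intro n
    induction n using Nat.strong_induction_on with
    | _ n ih =>
      rcases n with _ | n
      · simp [hU0]
      · have h1 := hrec n
        have h2 : ∑ k ∈ Finset.range (n + 2), (-1 : ℚ) ^ k *
            ((∏ i ∈ Finset.range k, (i * s + 1) : ℕ) : ℚ) *
            (((s * (n + 1)).choose (s * k) : ℚ) * (aN s (n + 1 - k) : ℚ)) = 0 := by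
          exact_mod_cast congrArg (Int.cast : ℤ → ℚ) (a_alt s hs n)
        rw [Finset.sum_range_succ] at h1 h2
        rw [Finset.sum_congr rfl (fun k hk => by
          rw [ih k (by simpa using hk)])] at h1
        simp only [Nat.sub_self, aN_zero, Nat.choose_self, Nat.cast_one, one_mul, mul_one] at h1 h2
        have h3 : ∀ x y z : ℚ, x + y = 0 → x + z = 0 → y = z := by intros; linarith
        refine h3 _ _ _ h1 ?_
        rw [← h2]
        congr 1
        apply Finset.sum_congr rfl
        intro k _
        ring
  intro n _
  have hc : ∀ p : Polynomial ℚ, (p.comp (-X)).coeff n = (-1) ^ n * p.coeff n := by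
    intro p
    rw [show (-X : Polynomial ℚ) = C (-1) * X by simp, comp_C_mul_X_coeff, mul_comm]
  rw [hc, hu, ← mul_assoc, ← mul_pow]
  simp only [neg_mul_neg, one_mul, one_pow]
  congr 1
  rw [← Finset.Ico_add_one_right_eq_Icc, Finset.prod_Ico_eq_prod_range]
  simp
end

section
/- Let s ≥ 3 and Γ = Γ_{2,2,s} = {1324, 1423, 1 2 ⋯ s (s+1)}. Then for all n ≥ 1, the coefficient of y^{n+1} in the polynomial U_{Γ,sn+s−1}(−y) equals Π_{i=1}^{n} ((i+1)s + 1). -/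
open Polynomial

namespace S14

/-- permutations of a finset as lists -/
noncomputable def perms (S : Finset ℕ) : Finset (List ℕ) := S.val.lists.toFinset

lemma mem_perms {S : Finset ℕ} {l : List ℕ} : l ∈ perms S ↔ l.Nodup ∧ l.toFinset = S := by
  unfold perms
  rw [Multiset.mem_toFinset, Multiset.mem_lists_iff]
  constructor
  · intro h
    have h1 : l.Nodup := by
      have := S.nodup
      rw [h] at this
      exact this
    refine ⟨h1, ?_⟩
    ext x
    rw [List.mem_toFinset, ← Finset.mem_val, h]
    simp
  · rintro ⟨h1, h2⟩
    subst h2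
    rw [List.toFinset_val, h1.dedup]
    rfl

lemma perms_empty : perms ∅ = {[]} := by
  ext l
  rw [mem_perms]
  simp only [Finset.mem_singleton, List.toFinset_eq_empty_iff]
  constructor
  · exact fun h => h.2
  · rintro rfl
    simp

lemma length_of_mem {S : Finset ℕ} {l : List ℕ} (h : l ∈ perms S) : l.length = S.card := by
  rw [mem_perms] at h
  rw [← h.2, List.toFinset_card_of_nodup h.1]

lemma mem_of_mem {S : Finset ℕ} {l : List ℕ} (h : l ∈ perms S) (x : ℕ) : x ∈ l ↔ x ∈ S := by
  rw [mem_perms] at h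
  rw [← h.2, List.mem_toFinset]

lemma sum_cons {M : Type*} [AddCommMonoid M] (S : Finset ℕ) (hS : S.Nonempty) (f : List ℕ → M) :
    ∑ w ∈ perms S, f w = ∑ x ∈ S, ∑ w ∈ perms (S.erase x), f (x :: w) := by
  rw [Finset.sum_sigma']
  symm
  refine Finset.sum_bij (fun p _ => p.1 :: p.2) ?_ ?_ ?_ ?_
  · rintro ⟨x, w⟩ h
    simp only [Finset.mem_sigma, mem_perms] at h
    obtain ⟨hx, hw, hw2⟩ := h
    rw [mem_perms]
    have : x ∉ w := by
      rw [← List.mem_toFinset, hw2]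
      simp
    refine ⟨List.nodup_cons.2 ⟨this, hw⟩, ?_⟩
    simp only [List.toFinset_cons, hw2]
    exact Finset.insert_erase hx
  · rintro ⟨x, w⟩ _ ⟨x', w'⟩ _ h
    simp only [List.cons.injEq] at h
    obtain ⟨rfl, rfl⟩ := h
    rfl
  · intro l hl
    rw [mem_perms] at hl
    obtain ⟨h1, h2⟩ := hl
    cases l with
    | nil =>
      simp at h2
      subst h2
      simp at hS
    | cons x w =>
      refine ⟨⟨x, w⟩, ?_, rfl⟩
      rw [List.nodup_cons] at h1
      simp only [Finset.mem_sigma, mem_perms]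
      subst h2
      refine ⟨by simp, h1.2, ?_⟩
      rw [List.toFinset_cons, Finset.erase_insert]
      simpa using h1.1
  · rintro ⟨x, w⟩ _
    rfl

lemma sum_split {R : Type*} [CommSemiring R] (S : Finset ℕ) (k : ℕ) (hk : k ≤ S.card)
    (f g : List ℕ → R) :
    ∑ w ∈ perms S, f (w.take k) * g (w.drop k) =
      ∑ A ∈ S.powersetCard k, (∑ u ∈ perms A, f u) * (∑ v ∈ perms (S \ A), g v) := by
  simp_rw [Finset.sum_mul_sum, ← Finset.sum_product']
  rw [Finset.sum_sigma']
  refine Finset.sum_bij' (fun w _ => ⟨(w.take k).toFinset, (w.take k, w.drop k)⟩)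
    (fun p _ => p.2.1 ++ p.2.2) ?_ ?_ ?_ ?_ ?_
  · intro w hw
    have hl := length_of_mem hw
    rw [mem_perms] at hw
    obtain ⟨h1, h2⟩ := hw
    have h3 : (w.take k ++ w.drop k).Nodup := by rw [List.take_append_drop]; exact h1
    rw [List.nodup_append] at h3
    simp only [Finset.mem_sigma, Finset.mem_powersetCard, Finset.mem_product, mem_perms]
    refine ⟨⟨?_, ?_⟩, ⟨h3.1, trivial⟩, h3.2.1, ?_⟩
    · intro x hx
      rw [← h2, List.mem_toFinset]
      exact List.mem_of_mem_take (List.mem_toFinset.1 hx)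
    · rw [List.toFinset_card_of_nodup h3.1, List.length_take]
      omega
    · have : S = (w.take k).toFinset ∪ (w.drop k).toFinset := by
        rw [← List.toFinset_append, List.take_append_drop, h2]
      rw [this, Finset.union_sdiff_left, eq_comm, Finset.sdiff_eq_self_iff_disjoint,
        Finset.disjoint_left]
      intro x hx hx'
      rw [List.mem_toFinset] at hx hx'
      exact h3.2.2 x hx' x hx rfl
  · rintro ⟨A, u, v⟩ h
    simp only [Finset.mem_sigma, Finset.mem_powersetCard, Finset.mem_product, mem_perms] at h
    obtain ⟨⟨hA, hAk⟩, ⟨hu, hu2⟩, hv, hv2⟩ := h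
    rw [mem_perms]
    simp only
    refine ⟨?_, ?_⟩
    · rw [List.nodup_append]
      refine ⟨hu, hv, ?_⟩
      rintro a ha _ hb rfl
      rw [← List.mem_toFinset, hu2] at ha
      rw [← List.mem_toFinset, hv2] at hb
      simp [ha] at hb
    · rw [List.toFinset_append, hu2, hv2, Finset.union_sdiff_of_subset hA]
  · intro w hw
    simp
  · rintro ⟨A, u, v⟩ h
    simp only [Finset.mem_sigma, Finset.mem_powersetCard, Finset.mem_product, mem_perms] at h
    obtain ⟨⟨hA, hAk⟩, ⟨hu, hu2⟩, hv, hv2⟩ := h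
    have hl : u.length = k := by
      rw [← hAk, ← hu2, List.toFinset_card_of_nodup hu]
    subst hu2
    simp [← hl]
  · intro w hw
    rfl

lemma sum_image {M : Type*} [AddCommMonoid M] (S : Finset ℕ) (r : ℕ → ℕ) (hr : Set.InjOn r S)
    (f : List ℕ → M) :
    ∑ w ∈ perms (S.image r), f w = ∑ w ∈ perms S, f (w.map r) := by
  symm
  refine Finset.sum_bij (fun w _ => w.map r) ?_ ?_ ?_ ?_
  · intro w hw
    rw [mem_perms] at hw ⊢
    obtain ⟨h1, rfl⟩ := hw
    refine ⟨h1.map_on ?_, ?_⟩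
    · intro x hx y hy h
      exact hr (by simpa using hx) (by simpa using hy) h
    · ext; simp
  · intro w hw w' hw' h
    have h1 := fun x => mem_of_mem hw x
    have h2 := fun x => mem_of_mem hw' x
    have hlen : w.length = w'.length := by simpa using congrArg List.length h
    refine List.ext_getElem hlen ?_
    intro i hi hi'
    have := congrArg (fun l => l[i]?) h
    simp [hi, hi'] at this
    exact hr ((h1 _).1 (List.getElem_mem _)) ((h2 _).1 (List.getElem_mem _)) this
  · intro l hl
    rw [mem_perms] at hl
    obtain ⟨h1, h2⟩ := hl
    have : ∃ w : List ℕ, (∀ x ∈ w, x ∈ S) ∧ w.map r = l := by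
      have h3 : ∀ x ∈ l, ∃ y ∈ S, r y = x := by
        intro x hx
        rw [← List.mem_toFinset, h2] at hx
        simpa using hx
      clear h1 h2
      induction l with
      | nil => exact ⟨[], by simp, rfl⟩
      | cons a l ih =>
        obtain ⟨w, hw, hw2⟩ := ih (fun x hx => h3 x (by simp [hx]))
        obtain ⟨y, hy, hy2⟩ := h3 a (by simp)
        exact ⟨y :: w, by simpa [hy] using hw, by simp [hy2, hw2]⟩
    obtain ⟨w, hw, rfl⟩ := this
    refine ⟨w, ?_, rfl⟩
    rw [mem_perms]
    refine ⟨h1.of_map _, ?_⟩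
    ext x
    rw [List.mem_toFinset]
    refine ⟨hw x, fun hx => ?_⟩
    have : r x ∈ (w.map r).toFinset := by rw [h2]; exact Finset.mem_image_of_mem _ hx
    simp only [List.mem_toFinset, List.mem_map] at this
    obtain ⟨a, ha, hax⟩ := this
    rw [← hr (hw a ha) hx hax]
    exact ha
  · intro w hw
    rfl

open scoped Classical in
/-- signed weight of a word -/
noncomputable def Nw (Γ : Set (List ℕ)) (l : List ℕ) : ℚ[X] :=
  if l = [] then 1 else if HasMatch Γ l then 0 else (-X) ^ (1 + desL l)

lemma redL_map (l : List ℕ) (r : ℕ → ℕ) (hr : ∀ x ∈ l, ∀ y ∈ l, (r x < r y ↔ x < y)) :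
    redL (l.map r) = redL l := by
  unfold redL
  rw [List.map_map]
  apply List.map_congr_left
  intro x hx
  simp only [Function.comp, List.countP_map]
  congr 1
  apply List.countP_congr
  intro y hy
  simp [hr y hy x hx]

lemma desL_cons_cons (a b : ℕ) (l : List ℕ) :
    desL (a :: b :: l) = (if b < a then 1 else 0) + desL (b :: l) := by
  unfold desL
  simp [List.countP_cons, add_comm]

lemma desL_map (l : List ℕ) (r : ℕ → ℕ) (hr : ∀ x ∈ l, ∀ y ∈ l, (r x < r y ↔ x < y)) :
    desL (l.map r) = desL l := by
  induction l with
  | nil => rfl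
  | cons a l ih =>
    cases l with
    | nil => rfl
    | cons b l =>
      have := ih (fun x hx y hy => hr x (by simp [hx]) y (by simp [hy]))
      simp only [List.map_cons] at this ⊢
      rw [desL_cons_cons, desL_cons_cons, this]
      simp [hr b (by simp) a (by simp)]

lemma Nw_map (Γ : Set (List ℕ)) (l : List ℕ) (r : ℕ → ℕ)
    (hr : ∀ x ∈ l, ∀ y ∈ l, (r x < r y ↔ x < y)) : Nw Γ (l.map r) = Nw Γ l := by
  have h1 : HasMatch Γ (l.map r) ↔ HasMatch Γ l := by
    unfold HasMatch
    refine exists_congr fun i => exists_congr fun j => ?_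
    rw [List.length_map, ← List.map_drop, ← List.map_take, redL_map]
    intro x hx y hy
    exact hr x (List.mem_of_mem_drop (List.mem_of_mem_take hx)) y
      (List.mem_of_mem_drop (List.mem_of_mem_take hy))
  unfold Nw
  rw [desL_map l r hr]
  by_cases h : HasMatch Γ l
  · have h' := h1.2 h
    simp [h, h']
  · have h' : ¬ HasMatch Γ (l.map r) := fun h2 => h (h1.1 h2)
    simp [h, h']

lemma sum_Nw_Icc (Γ : Set (List ℕ)) (n : ℕ) :
    ∑ w ∈ perms (Finset.Icc 1 n), Nw Γ w = (NMpoly Γ n).comp (-X) := by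
  classical
  unfold NMpoly
  split_ifs with h
  · subst h
    simp [perms_empty, Nw]
  · rw [Polynomial.sum_comp]
    unfold NMfinset
    rw [Finset.sum_filter]
    have : perms (Finset.Icc 1 n) = (List.range' 1 n).permutations.toFinset := by
      ext l
      rw [mem_perms, List.mem_toFinset, List.mem_permutations]
      have h1 : (List.range' 1 n).toFinset = Finset.Icc 1 n := by
        ext x
        simp
        omega
      rw [← h1]
      constructor
      · rintro ⟨h2, h3⟩
        exact (List.perm_ext_iff_of_nodup h2 List.nodup_range').2 (fun a => by
          rw [← List.mem_toFinset, h3, List.mem_toFinset])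
      · intro h2
        exact ⟨h2.nodup_iff.2 List.nodup_range', List.toFinset_eq_of_perm _ _ h2⟩
    rw [← this]
    apply Finset.sum_congr rfl
    intro l hl
    have hl2 : l ≠ [] := by
      rintro rfl
      have := length_of_mem hl
      simp at this
      omega
    unfold Nw
    simp [hl2]

lemma sum_Nw (Γ : Set (List ℕ)) (S : Finset ℕ) :
    ∑ w ∈ perms S, Nw Γ w = (NMpoly Γ S.card).comp (-X) := by
  rw [← sum_Nw_Icc]
  set r : ℕ → ℕ := fun x => (S.filter (fun y => y < x)).card + 1 with hr
  have hmono : ∀ x ∈ S, ∀ y ∈ S, x < y → r x < r y := by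
    intro x hx y hy hxy
    simp only [hr]
    apply Nat.succ_lt_succ
    apply Finset.card_lt_card
    rw [Finset.ssubset_iff_of_subset]
    · exact ⟨x, by simp [hx, hxy], by simp⟩
    · intro z
      simp only [Finset.mem_filter]
      rintro ⟨h1, h2⟩
      exact ⟨h1, by omega⟩
  have hiff : ∀ x ∈ S, ∀ y ∈ S, (r x < r y ↔ x < y) := by
    intro x hx y hy
    refine ⟨fun h => ?_, hmono x hx y hy⟩
    by_contra hc
    rcases Nat.lt_or_ge y x with h1 | h1
    · have := hmono y hy x hx h1
      omega
    · have : x = y := by omega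
      subst this
      omega
  have hinj : Set.InjOn r S := by
    intro x hx y hy h
    have h1 := hiff x hx y hy
    have h2 := hiff y hy x hx
    omega
  have him : S.image r = Finset.Icc 1 S.card := by
    apply Finset.eq_of_subset_of_card_le
    · intro z hz
      simp only [Finset.mem_image] at hz
      obtain ⟨x, hx, rfl⟩ := hz
      simp only [Finset.mem_Icc, hr]
      refine ⟨by omega, ?_⟩
      apply Nat.succ_le_of_lt
      apply Finset.card_lt_card
      rw [Finset.ssubset_iff_of_subset (Finset.filter_subset _ _)]
      exact ⟨x, hx, by simp⟩
    · rw [Finset.card_image_of_injOn hinj]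
      simp
  rw [← him, sum_image S r hinj]
  apply Finset.sum_congr rfl
  intro w hw
  rw [Nw_map]
  intro x hx y hy
  exact hiff x ((mem_of_mem hw x).1 hx) y ((mem_of_mem hw y).1 hy)

lemma lt_of_cnt_lt {l : List ℕ} {x y : ℕ}
    (h : l.countP (fun z => decide (z < x)) + 1 < l.countP (fun z => decide (z < y)) + 1) :
    x < y := by
  by_contra hc
  have : l.countP (fun z => decide (z < y)) ≤ l.countP (fun z => decide (z < x)) := by
    apply List.countP_mono_left
    intro z _ hz
    simp only [decide_eq_true_eq] at hz ⊢
    omega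
  omega

lemma redL_quad {a b c d : ℕ} (hbd : b ≠ d) :
    (redL [a, b, c, d] = [1, 3, 2, 4] ∨ redL [a, b, c, d] = [1, 4, 2, 3]) ↔
      a < c ∧ c < b ∧ c < d := by
  constructor
  · intro h
    unfold redL at h
    simp only [List.map_cons, List.map_nil, List.cons.injEq, and_true] at h
    rcases h with ⟨h1, h2, h3, h4⟩ | ⟨h1, h2, h3, h4⟩ <;>
    exact ⟨lt_of_cnt_lt (by rw [h1, h3]; norm_num), lt_of_cnt_lt (by rw [h2, h3]; norm_num),
      lt_of_cnt_lt (by rw [h4, h3]; norm_num)⟩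
  · rintro ⟨h1, h2, h3⟩
    have e1 : a < b := by omega
    have e2 : a < d := by omega
    have f1 : ¬ c < a := by omega
    have f2 : ¬ b < c := by omega
    have f3 : ¬ d < c := by omega
    have f4 : ¬ b < a := by omega
    have f5 : ¬ d < a := by omega
    rcases Nat.lt_or_ge b d with h | h
    · left
      have g : ¬ d < b := by omega
      simp [redL, List.countP_cons, *]
    · right
      have g : ¬ b < d := by omega
      have g2 : d < b := by omega
      simp [redL, List.countP_cons, *]

lemma redL_length (l : List ℕ) : (redL l).length = l.length := by simp [redL]

lemma redL_sorted (l : List ℕ) (h : l.Pairwise (· < ·)) : redL l = List.range' 1 l.length := by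
  induction l with
  | nil => rfl
  | cons x l ih =>
    rw [List.pairwise_cons] at h
    have ih := ih h.2
    have h2 : redL (x :: l) = 1 :: (redL l).map (fun z => z + 1) := by
      unfold redL
      rw [List.map_cons, List.map_map]
      congr 1
      · simp only [List.countP_cons, lt_self_iff_false, decide_false]
        have : l.countP (fun y => decide (y < x)) = 0 := by
          rw [List.countP_eq_zero]
          intro y hy
          have := h.1 y hy
          simp
          omega
        simp [this]
      · apply List.map_congr_left
        intro y hy
        simp [h.1 y hy]
    rw [h2, ih, List.length_cons, List.range'_succ]
    congr 1
    rw [List.range'_eq_map_range, List.range'_eq_map_range, List.map_map]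
    apply List.map_congr_left
    intro z _
    simp only [Function.comp]
    omega

lemma redL_eq_range {l : List ℕ} {m : ℕ} :
    redL l = List.range' 1 m ↔ l.length = m ∧ l.Pairwise (· < ·) := by
  constructor
  · intro h
    refine ⟨by simpa [redL_length] using congrArg List.length h, ?_⟩
    have h2 : (redL l).Pairwise (· < ·) := by
      rw [h]
      exact List.pairwise_lt_range'
    unfold redL at h2
    rw [List.pairwise_map] at h2
    exact h2.imp (fun h => lt_of_cnt_lt h)
  · rintro ⟨rfl, h⟩
    exact redL_sorted l h

/-- the set of patterns -/
def Gam (s : ℕ) : Set (List ℕ) := {[1, 3, 2, 4], [1, 4, 2, 3], List.range' 1 (s + 1)}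

/-- match at the start -/
def MS (s : ℕ) (l : List ℕ) : Prop :=
  (∃ a b c d t, l = a :: b :: c :: d :: t ∧ a < c ∧ c < b ∧ c < d) ∨
    (s + 1 ≤ l.length ∧ (l.take (s + 1)).Pairwise (· < ·))

lemma start_iff (s : ℕ) (hs : 1 ≤ s) (l : List ℕ) (hl : l.Nodup) :
    (∃ j, 1 ≤ j ∧ j + 1 ≤ l.length ∧ redL (l.take (j + 1)) ∈ Gam s) ↔ MS s l := by
  unfold MS Gam
  simp only [Set.mem_insert_iff, Set.mem_singleton_iff]
  constructor
  · rintro ⟨j, hj, hjl, h⟩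
    rw [← or_assoc] at h
    rcases h with h | h
    · left
      have hj3 : j = 3 := by
        have : (redL (l.take (j+1))).length = 4 := by
          rcases h with h | h <;> rw [h] <;> rfl
        rw [redL_length, List.length_take] at this
        omega
      subst hj3
      match l, hjl, hl, h with
      | a :: b :: c :: d :: t, _, hl, h =>
        refine ⟨a, b, c, d, t, rfl, ?_⟩
        apply (redL_quad ?_).1 h
        rintro rfl
        simp at hl
    · right
      rw [redL_eq_range, List.length_take] at h
      have : j = s := by omega
      subst this
      exact ⟨hjl, h.2⟩
  · rintro (⟨a, b, c, d, t, rfl, h⟩ | ⟨h1, h2⟩)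
    · refine ⟨3, by norm_num, by simp, ?_⟩
      rw [← or_assoc]
      left
      refine (redL_quad ?_).2 h
      rintro rfl
      simp at hl
    · refine ⟨s, hs, h1, ?_⟩
      right; right
      rw [redL_eq_range, List.length_take]
      exact ⟨by omega, h2⟩

lemma hasMatch_nil (Γ : Set (List ℕ)) : ¬ HasMatch Γ [] := by
  rintro ⟨i, j, h1, h2, _⟩
  simp at h2

lemma hasMatch_cons' (Γ : Set (List ℕ)) (x : ℕ) (l : List ℕ) :
    HasMatch Γ (x :: l) ↔
      (∃ j, 1 ≤ j ∧ j + 1 ≤ (x :: l).length ∧ redL ((x :: l).take (j + 1)) ∈ Γ) ∨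
        HasMatch Γ l := by
  constructor
  · rintro ⟨i, j, h1, h2, h3⟩
    cases i with
    | zero => exact Or.inl ⟨j, h1, by omega, h3⟩
    | succ i =>
      right
      refine ⟨i, j, h1, ?_, h3⟩
      simp at h2
      omega
  · rintro (⟨j, h1, h2, h3⟩ | ⟨i, j, h1, h2, h3⟩)
    · exact ⟨0, j, h1, by omega, h3⟩
    · refine ⟨i + 1, j, h1, ?_, h3⟩
      simp
      omega

lemma hasMatch_cons (s : ℕ) (hs : 1 ≤ s) (x : ℕ) (l : List ℕ) (hl : (x :: l).Nodup) :
    HasMatch (Gam s) (x :: l) ↔ MS s (x :: l) ∨ HasMatch (Gam s) l := by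
  rw [hasMatch_cons', start_iff s hs _ hl]

lemma hasMatch_sorted (s : ℕ) (hs : 1 ≤ s) (l : List ℕ) (h : l.Pairwise (· < ·))
    (hl : l.length ≤ s) : ¬ HasMatch (Gam s) l := by
  induction l with
  | nil => exact hasMatch_nil _
  | cons x l ih =>
    have hnd : (x :: l).Nodup := h.imp (fun h => Nat.ne_of_lt h)
    rw [hasMatch_cons s hs x l hnd]
    rintro (h1 | h1)
    · rcases h1 with ⟨a, b, c, d, t, h2, h3⟩ | ⟨h2, h3⟩
      · rw [h2] at h
        simp at h
        omega
      · omega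
    · refine ih (List.pairwise_cons.1 h).2 ?_ h1
      simp at hl
      omega

lemma desL_sorted (l : List ℕ) (h : l.Pairwise (· < ·)) : desL l = 0 := by
  induction l with
  | nil => rfl
  | cons x l ih =>
    cases l with
    | nil => rfl
    | cons y l =>
      have ih := ih (List.pairwise_cons.1 h).2
      rw [desL_cons_cons, ih]
      have := (List.pairwise_cons.1 h).1 y (by simp)
      simp
      omega

/-- descent start -/
lemma hasMatch_desc (s : ℕ) (hs : 1 ≤ s) (y x : ℕ) (w : List ℕ) (hl : (y :: x :: w).Nodup)
    (hyx : x < y) : HasMatch (Gam s) (y :: x :: w) ↔ HasMatch (Gam s) (x :: w) := by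
  rw [hasMatch_cons s hs _ _ hl]
  constructor
  · rintro (h | h)
    · exfalso
      rcases h with ⟨a, b, c, d, t, h2, h3⟩ | ⟨h2, h3⟩
      · simp at h2
        omega
      · obtain ⟨s, rfl⟩ : ∃ t, s = t + 1 := ⟨s - 1, by omega⟩
        simp at h3
        omega
    · exact h
  · exact Or.inr

lemma hasMatch_asc_desc (s : ℕ) (hs : 2 ≤ s) (q y x : ℕ) (w : List ℕ)
    (hl : (q :: y :: x :: w).Nodup)
    (hyx : x < y) : HasMatch (Gam s) (q :: y :: x :: w) ↔
      (q < x ∧ ∃ d ∈ w.head?, x < d) ∨ HasMatch (Gam s) (x :: w) := by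
  rw [hasMatch_cons s (by omega) _ _ hl, hasMatch_desc s (by omega) _ _ _ (List.nodup_cons.1 hl).2 hyx]
  apply or_congr_left
  constructor
  · rintro (⟨a, b, c, d, t, h2, h3⟩ | ⟨h2, h3⟩)
    · simp only [List.cons.injEq] at h2
      obtain ⟨rfl, rfl, rfl, rfl⟩ := h2
      exact ⟨h3.1, d, by simp, h3.2.2⟩
    · obtain ⟨s, rfl⟩ : ∃ t, s = t + 2 := ⟨s - 2, by omega⟩
      simp at h3
      omega
  · rintro ⟨h1, d, h2, h3⟩
    left
    cases w with
    | nil => simp at h2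
    | cons d' t =>
      simp at h2
      subst h2
      exact ⟨q, y, x, d', t, rfl, h1, hyx, h3⟩

lemma hasMatch_front (s : ℕ) (c : List ℕ) (q y x : ℕ) (w : List ℕ)
    (hl : (c ++ q :: y :: x :: w).Nodup) (hc : (c ++ [q, y]).Pairwise (· < ·))
    (hlen : c.length + 2 ≤ s) (hyx : x < y) :
    (HasMatch (Gam s) (c ++ q :: y :: x :: w) ↔ HasMatch (Gam s) (q :: y :: x :: w)) ∧
    desL (c ++ q :: y :: x :: w) = 1 + desL (x :: w) := by
  induction c with
  | nil =>
    refine ⟨Iff.rfl, ?_⟩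
    simp at hc
    simp [desL_cons_cons, hyx]
    omega
  | cons z c ih =>
    have ih := ih (List.nodup_cons.1 hl).2 (List.pairwise_cons.1 hc).2 (by simp at hlen; omega)
    simp only [List.cons_append] at hl hc ⊢
    constructor
    · rw [hasMatch_cons s (by omega) _ _ hl, ih.1]
      constructor
      · rintro (h | h)
        · exfalso
          rcases h with ⟨a, b, e, d, t, h2, h3⟩ | ⟨h2, h3⟩
          · -- second and third letters ascend
            have h4 : b < e := by
              rcases c with _ | ⟨c1, _ | ⟨c2, c⟩⟩
              · simp at h2 hc; omega
              · simp at h2 hc; omega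
              · simp at h2 hc; omega
            omega
          · have h5 : ((z :: (c ++ [q, y, x])) ++ w).take (z :: (c ++ [q, y, x])).length
                <+: (z :: (c ++ q :: y :: x :: w)).take (s + 1) := by
              have e : (z :: (c ++ [q, y, x])) ++ w = z :: (c ++ q :: y :: x :: w) := by simp
              rw [e]
              apply List.take_prefix_take_left
              simp at hlen ⊢
              omega
            rw [List.take_left] at h5
            have h6 := h3.sublist h5.sublist
            simp [List.pairwise_append] at h6
            omega
        · exact h
      · exact Or.inr
    · rw [← ih.2]
      cases c with
      | nil =>
        simp only [List.nil_append] at hc ⊢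
        rw [desL_cons_cons z]
        simp at hc ⊢
        omega
      | cons c1 c =>
        simp only [List.cons_append] at hc ⊢
        rw [desL_cons_cons z]
        simp at hc ⊢
        omega

lemma Nw_sorted (s : ℕ) (hs : 1 ≤ s) (l : List ℕ) (h : l.Pairwise (· < ·)) (hne : l ≠ [])
    (hl : l.length ≤ s) : Nw (Gam s) l = -X := by
  unfold Nw
  rw [if_neg hne, if_neg (hasMatch_sorted s hs l h hl), desL_sorted l h]
  simp

lemma Nw_long (s : ℕ) (hs : 1 ≤ s) (l w : List ℕ) (h : l.Pairwise (· < ·))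
    (hl : l.length = s + 1) : Nw (Gam s) (l ++ w) = 0 := by
  have : HasMatch (Gam s) (l ++ w) := by
    refine ⟨0, s, hs, by simp; omega, ?_⟩
    rw [List.drop_zero, ← hl, List.take_left, redL_sorted l h, hl]
    simp [Gam]
  unfold Nw
  rw [if_neg (by rintro h; simp at h; simp [h.1] at hl), if_pos this]

open scoped Classical in
lemma Nw_desc (s : ℕ) (hs : 2 ≤ s) (y x : ℕ) (b w : List ℕ)
    (hl : ((y :: b).reverse ++ x :: w).Nodup) (hc : (y :: b).reverse.Pairwise (· < ·))
    (hlen : b.length + 1 ≤ s) (hyx : x < y) :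
    Nw (Gam s) ((y :: b).reverse ++ x :: w) =
      if (∃ q ∈ b.head?, q < x) ∧ ∃ d ∈ w.head?, x < d then 0 else -X * Nw (Gam s) (x :: w) := by
  cases b with
  | nil =>
    simp only [List.reverse_cons, List.reverse_nil, List.nil_append, List.cons_append] at hl ⊢
    unfold Nw
    simp only [hasMatch_desc s (by omega) _ _ _ hl hyx, desL_cons_cons, hyx]
    by_cases h : HasMatch (Gam s) (x :: w)
    · simp [h]
    · simp [h]
      ring
  | cons q b =>
    have e : (y :: q :: b).reverse ++ x :: w = b.reverse ++ q :: y :: x :: w := by simp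
    have e2 : (y :: q :: b).reverse = b.reverse ++ [q, y] := by simp
    rw [e] at hl ⊢
    rw [e2] at hc
    obtain ⟨h1, h2⟩ := hasMatch_front s b.reverse q y x w hl hc (by simp at hlen ⊢; omega) hyx
    rw [hasMatch_asc_desc s hs q y x w (List.nodup_append.1 hl).2.1 hyx] at h1
    unfold Nw
    simp only [h1, h2]
    by_cases h3 : (∃ q' ∈ (q :: b).head?, q' < x) ∧ ∃ d ∈ w.head?, x < d
    · have h4 : q < x ∧ ∃ d ∈ w.head?, x < d := by simpa using h3
      rw [if_neg (by simp), if_pos (Or.inl h4), if_pos h3]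
    · have h4 : ¬ (q < x ∧ ∃ d ∈ w.head?, x < d) := by simpa using h3
      rw [if_neg (by simp), if_neg h3]
      by_cases h : HasMatch (Gam s) (x :: w)
      · simp [h]
      · rw [if_neg (by simp only [h4, h, or_self, not_false_iff]), if_neg (by simp), if_neg h]
        ring

open scoped Classical in
/-- Brick structures: `y :: b` is the current brick in reverse, the first argument is the remaining
word; the power of `X` counts the bricks that are still to be started. -/
noncomputable def Z (s : ℕ) : List ℕ → ℕ → List ℕ → ℚ[X]
  | [], _, _ => 1
  | [x], y, b =>
      if y < x then (if b.length + 1 < s then 1 else 0) + X else 0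
  | x :: d :: w, y, b =>
      if y < x then (if b.length + 1 < s then Z s (d :: w) x (y :: b) else 0) + X * Z s (d :: w) x []
      else if (∃ q ∈ b.head?, q < x) ∧ x < d then X * Z s w d [x] else 0

/-- start of a brick at a descent -/
noncomputable def Z2 (s : ℕ) (x : ℕ) : List ℕ → ℚ[X]
  | [] => 0
  | d :: w => if x < d then Z s w d [x] else 0

lemma Z_nil (s y : ℕ) (b : List ℕ) : Z s [] y b = 1 := by rw [Z]

open scoped Classical in
lemma Z_cons (s x : ℕ) (w : List ℕ) (y : ℕ) (b : List ℕ) :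
    Z s (x :: w) y b =
      if y < x then (if b.length + 1 < s then Z s w x (y :: b) else 0) + X * Z s w x []
      else if (∃ q ∈ b.head?, q < x) then X * Z2 s x w else 0 := by
  cases w with
  | nil =>
    simp only [Z2, Z_nil, mul_zero, mul_one, ite_self]
    rw [Z]
  | cons d w =>
    rw [Z]
    by_cases h : (∃ q ∈ b.head?, q < x)
    · by_cases h2 : x < d
      · simp only [h, h2, Z2, and_self, if_true]
      · simp only [h, h2, Z2, and_false, if_true, if_false, mul_zero]
    · simp only [h, false_and, if_false]

/-- fresh start -/
noncomputable def Z0 (s : ℕ) : List ℕ → ℚ[X]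
  | [] => 1
  | x :: w => X * Z s w x []

noncomputable def G (s : ℕ) (w : List ℕ) (y : ℕ) (b : List ℕ) : ℚ[X] :=
  ∑ k ∈ Finset.range (w.length + 1), Z s (w.take k) y b * Nw (Gam s) (w.drop k)

lemma Nw_nil (Γ : Set (List ℕ)) : Nw Γ [] = 1 := by simp [Nw]

lemma G_eq (s : ℕ) (hs : 2 ≤ s) (n : ℕ) : ∀ (w : List ℕ) (y : ℕ) (b : List ℕ), w.length = n →
    ((y :: b).reverse ++ w).Nodup → (y :: b).reverse.Pairwise (· < ·) → b.length + 1 ≤ s →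
    -X * G s w y b = Nw (Gam s) ((y :: b).reverse ++ w) := by
  induction n using Nat.strong_induction_on with
  | _ n ih =>
  intro w y b hn hnd hsort hlen
  cases w with
  | nil =>
    rw [List.append_nil, Nw_sorted s (by omega) _ hsort (by simp) (by simpa using hlen)]
    simp [G, Z_nil, Nw_nil]
  | cons x w =>
    have hG : G s (x :: w) y b = Nw (Gam s) (x :: w) +
        ∑ k ∈ Finset.range (w.length + 1),
          Z s (x :: w.take k) y b * Nw (Gam s) (w.drop k) := by
      unfold G
      rw [List.length_cons, Finset.sum_range_succ']
      simp [Z_nil, add_comm]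
    rw [hG]
    have hxw : (x :: w).Nodup := (List.nodup_append.1 hnd).2.1
    have hx1 : -X * G s w x [] = Nw (Gam s) (x :: w) := by
      have := ih w.length (by simp at hn; omega) w x [] rfl (by simpa using hxw) (by simp)
        (by simp; omega)
      simpa using this
    have hxy : y ≠ x := by
      rintro rfl
      rw [List.nodup_append] at hnd
      exact hnd.2.2 y (by simp) y (by simp) rfl
    rcases Nat.lt_or_ge y x with h | h
    · have e : (y :: b).reverse ++ x :: w = (x :: y :: b).reverse ++ w := by simp
      have hsort' : (x :: y :: b).reverse.Pairwise (· < ·) := by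
        rw [List.pairwise_reverse] at hsort ⊢
        rw [List.pairwise_cons]
        refine ⟨?_, hsort⟩
        intro a ha
        rcases List.mem_cons.1 ha with rfl | ha
        · exact h
        · exact lt_trans ((List.pairwise_cons.1 hsort).1 a ha) h
      rw [e] at hnd ⊢
      simp only [Z_cons, h, if_true]
      by_cases h2 : b.length + 1 < s
      · simp only [h2, if_true]
        have hx2 := ih w.length (by simp at hn; omega) w x (y :: b) rfl hnd hsort'
          (by simp; omega)
        have : ∑ k ∈ Finset.range (w.length + 1),
            (Z s (w.take k) x (y :: b) + X * Z s (w.take k) x []) * Nw (Gam s) (w.drop k) =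
            G s w x (y :: b) + X * G s w x [] := by
          unfold G
          rw [Finset.mul_sum, ← Finset.sum_add_distrib]
          apply Finset.sum_congr rfl
          intros
          ring
        rw [this, ← hx2, ← hx1]
        ring
      · simp only [h2, if_false, zero_add]
        have : ∑ k ∈ Finset.range (w.length + 1),
            (X * Z s (w.take k) x []) * Nw (Gam s) (w.drop k) = X * G s w x [] := by
          unfold G
          rw [Finset.mul_sum]
          apply Finset.sum_congr rfl
          intros
          ring
        rw [this, Nw_long s (by omega) _ _ hsort' (by simp; omega), ← hx1]
        ring
    · have h' : x < y := by omega
      have h3 : ¬ y < x := by omega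
      rw [Nw_desc s hs y x b w hnd hsort hlen h']
      simp only [Z_cons, h3, if_false]
      by_cases h4 : ∃ q ∈ b.head?, q < x
      · simp only [h4, if_true, true_and]
        cases w with
        | nil => simp [Z2]
        | cons d w =>
          rw [List.length_cons, Finset.sum_range_succ']
          simp only [List.take_succ_cons, List.drop_succ_cons, Z2, List.take_zero, mul_zero,
            zero_mul, add_zero, List.head?_cons, Option.mem_some_iff, exists_eq_left']
          by_cases h5 : x < d
          · simp only [h5, if_true]
            have hx2 := ih w.length (by simp at hn; omega) w d [x] rfl (by simpa using hxw)
              (by simpa using h5) (by simpa using hs)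
            have : ∑ k ∈ Finset.range (w.length + 1),
                (X * Z s (w.take k) d [x]) * Nw (Gam s) (w.drop k) = X * G s w d [x] := by
              unfold G
              rw [Finset.mul_sum]
              apply Finset.sum_congr rfl
              intros
              ring
            have e : [d, x].reverse ++ w = x :: d :: w := by simp
            rw [e] at hx2
            rw [this, ← hx2]
            ring
          · simp [h5]
      · simp only [h4, if_false, false_and, zero_mul, Finset.sum_const_zero, add_zero]

lemma G0 (s : ℕ) (hs : 2 ≤ s) (w : List ℕ) (hne : w ≠ []) (hnd : w.Nodup) :
    ∑ k ∈ Finset.range (w.length + 1), Z0 s (w.take k) * Nw (Gam s) (w.drop k) = 0 := by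
  cases w with
  | nil => simp at hne
  | cons x w =>
    rw [List.length_cons, Finset.sum_range_succ']
    have := G_eq s hs w.length w x [] rfl (by simpa using hnd) (by simp) (by simp; omega)
    simp only [List.reverse_cons, List.reverse_nil, List.nil_append, List.singleton_append] at this
    simp only [List.take_succ_cons, List.drop_succ_cons, Z0, List.take_zero, List.drop_zero,
      one_mul]
    rw [← this]
    unfold G
    rw [Finset.mul_sum, ← Finset.sum_add_distrib]
    apply Finset.sum_eq_zero
    intros
    ring

lemma U_eq (s : ℕ) (hs : 2 ≤ s) (U : ℤ → ℚ[X]) (hU0 : U 0 = 1)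
    (hUrec : ∀ n : ℕ, 1 ≤ n →
      ∑ k ∈ Finset.range (n + 1), (n.choose k : ℚ) • (U (k : ℤ) * NMpoly (Gam s) (n - k)) = 0)
    (n : ℕ) : ∀ S : Finset ℕ, S.card = n → ∑ w ∈ perms S, Z0 s w = (U n).comp (-X) := by
  induction n using Nat.strong_induction_on with
  | _ n ih =>
  intro S hS
  rcases Nat.eq_zero_or_pos n with rfl | hn
  · rw [Finset.card_eq_zero] at hS
    subst hS
    simp [perms_empty, Z0, hU0]
  have h1 : ∑ k ∈ Finset.range (n + 1), ∑ w ∈ perms S,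
      Z0 s (w.take k) * Nw (Gam s) (w.drop k) = 0 := by
    rw [Finset.sum_comm]
    apply Finset.sum_eq_zero
    intro w hw
    have hl := length_of_mem hw
    rw [← hS, ← hl]
    apply G0 s hs
    · rintro rfl
      simp at hl
      omega
    · exact (mem_perms.1 hw).1
  have h2 := congrArg (fun p => p.comp (-X)) (hUrec n hn)
  simp only [Polynomial.sum_comp, Polynomial.smul_comp, Polynomial.mul_comp,
    Polynomial.zero_comp] at h2
  rw [Finset.sum_range_succ] at h1 h2
  have h3 : ∑ k ∈ Finset.range n, ∑ w ∈ perms S, Z0 s (w.take k) * Nw (Gam s) (w.drop k) =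
      ∑ k ∈ Finset.range n,
        (n.choose k : ℚ) • ((U (k : ℤ)).comp (-X) * (NMpoly (Gam s) (n - k)).comp (-X)) := by
    apply Finset.sum_congr rfl
    intro k hk
    rw [Finset.mem_range] at hk
    rw [sum_split S k (by omega)]
    rw [Finset.sum_congr rfl (g := fun _ => 
      (U (k : ℤ)).comp (-X) * (NMpoly (Gam s) (n - k)).comp (-X))]
    · rw [Finset.sum_const, Finset.card_powersetCard, hS, Nat.cast_smul_eq_nsmul]
    · intro A hA
      rw [Finset.mem_powersetCard] at hA
      rw [ih k hk A hA.2, sum_Nw, Finset.card_sdiff_of_subset hA.1, hS, hA.2]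
  rw [h3] at h1
  have h4 : ∑ w ∈ perms S, Z0 s (w.take n) * Nw (Gam s) (w.drop n) = ∑ w ∈ perms S, Z0 s w := by
    apply Finset.sum_congr rfl
    intro w hw
    have hl := length_of_mem hw
    rw [List.take_of_length_le (by omega), List.drop_of_length_le (by omega), Nw_nil, mul_one]
  rw [h4] at h1
  have h5 : NMpoly (Gam s) 0 = 1 := by simp [NMpoly]
  simp only [Nat.choose_self, Nat.sub_self, h5, Nat.cast_one, one_smul, Polynomial.one_comp,
    mul_one] at h2
  exact add_left_cancel (h1.trans h2.symm)

open scoped Classical in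
/-- the part of `Z` where a new brick starts -/
noncomputable def T (s : ℕ) (y : ℕ) (b : List ℕ) : List ℕ → ℚ[X]
  | [] => 1
  | x :: w => if y < x then X * Z s w x [] else
      if (∃ q ∈ b.head?, q < x) then X * Z2 s x w else 0

/-- the part of `Z` where the brick is extended -/
noncomputable def Ex (s : ℕ) (y : ℕ) (b : List ℕ) : List ℕ → ℚ[X]
  | [] => 0
  | x :: w => if y < x then (if b.length + 1 < s then Z s w x (y :: b) else 0) else 0

lemma Z_eq (s y : ℕ) (b w : List ℕ) : Z s w y b = T s y b w + Ex s y b w := by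
  cases w with
  | nil => simp [Z_nil, T, Ex]
  | cons x w =>
    rw [Z_cons, T, Ex]
    by_cases h : y < x
    · simp only [h, if_true]
      ring
    · simp only [h, if_false, add_zero]

lemma Z_deg (s : ℕ) (hs : 2 ≤ s) (n : ℕ) : ∀ (w : List ℕ) (k y : ℕ) (b : List ℕ), w.length = n →
    b.length + 1 ≤ s → (Z s w y b).coeff k ≠ 0 → w.length + (b.length + 1) ≤ s * (k + 1) := by
  induction n using Nat.strong_induction_on with
  | _ n ih =>
  intro w k y b hn hb h
  cases w with
  | nil =>
    rw [Nat.mul_succ]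
    simp
    omega
  | cons x w =>
    rw [Z_cons] at h
    simp only [List.length_cons] at hn ⊢
    have ih1 := ih w.length (by omega) w
    split_ifs at h with h1 h2 h3
    · rw [Polynomial.coeff_add] at h
      by_cases h4 : (Z s w x (y :: b)).coeff k = 0
      · rw [h4, zero_add] at h
        cases k with
        | zero => simp at h
        | succ k =>
          rw [Polynomial.coeff_X_mul] at h
          have := ih1 k x [] rfl (by simp; omega) h
          simp at this
          rw [Nat.mul_succ]
          omega
      · have := ih1 k x (y :: b) rfl (by simp; omega) h4
        simp at this
        omega
    · rw [zero_add] at h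
      cases k with
      | zero => simp at h
      | succ k =>
        rw [Polynomial.coeff_X_mul] at h
        have := ih1 k x [] rfl (by simp; omega) h
        simp at this
        rw [Nat.mul_succ]
        omega
    · cases k with
      | zero => simp at h
      | succ k =>
        rw [Polynomial.coeff_X_mul] at h
        cases w with
        | nil => simp [Z2] at h
        | cons d w =>
          rw [Z2] at h
          split_ifs at h with h5
          · have := ih w.length (by simp at hn; omega) w k d [x] rfl (by simp; omega) h
            simp at this ⊢
            rw [Nat.mul_succ]
            omega
          · simp at h
    · simp at h

lemma T_deg (s : ℕ) (hs : 2 ≤ s) (w : List ℕ) (k y : ℕ) (b : List ℕ)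
    (h : (T s y b w).coeff k ≠ 0) : w.length ≤ s * k := by
  cases w with
  | nil => simp
  | cons x w =>
    rw [T] at h
    split_ifs at h with h1 h2
    · cases k with
      | zero => simp at h
      | succ k =>
        rw [Polynomial.coeff_X_mul] at h
        have := Z_deg s hs _ w k x [] rfl (by simp; omega) h
        simpa using this
    · cases k with
      | zero => simp at h
      | succ k =>
        rw [Polynomial.coeff_X_mul] at h
        cases w with
        | nil => simp [Z2] at h
        | cons d w =>
          rw [Z2] at h
          split_ifs at h with h5
          · have := Z_deg s hs _ w k d [x] rfl (by simp; omega) h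
            simp at this ⊢
            omega
          · simp at h
    · simp at h

lemma Z_min (s : ℕ) (n : ℕ) : ∀ (w : List ℕ) (y : ℕ) (b : List ℕ), w.length = n →
    (∀ q ∈ b.head?, q < y) → Z s w y b ≠ 0 →
    ∀ z ∈ w, (b = [] → y < z) ∧ ∀ q ∈ b.head?, q < z := by
  induction n using Nat.strong_induction_on with
  | _ n ih =>
  intro w y b hn hb h
  cases w with
  | nil => simp
  | cons x w =>
    rw [Z_cons] at h
    simp only [List.length_cons] at hn
    have ih1 := ih w.length (by omega) w
    have key1 : y < x → Z s w x [] ≠ 0 →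
        ∀ z ∈ x :: w, (b = [] → y < z) ∧ ∀ q ∈ b.head?, q < z := by
      intro h1 h2 z hz
      have hyz : y < z := by
        rcases List.mem_cons.1 hz with rfl | hz
        · exact h1
        · exact lt_trans h1 ((ih1 x [] rfl (by simp) h2 z hz).1 rfl)
      exact ⟨fun _ => hyz, fun q hq => lt_trans (hb q hq) hyz⟩
    have key2 : y < x → Z s w x (y :: b) ≠ 0 →
        ∀ z ∈ x :: w, (b = [] → y < z) ∧ ∀ q ∈ b.head?, q < z := by
      intro h1 h2 z hz
      have hyz : y < z := by
        rcases List.mem_cons.1 hz with rfl | hz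
        · exact h1
        · exact (ih1 x (y :: b) rfl (by simpa using h1) h2 z hz).2 y (by simp)
      exact ⟨fun _ => hyz, fun q hq => lt_trans (hb q hq) hyz⟩
    split_ifs at h with h1 h2 h3
    · by_cases h4 : Z s w x (y :: b) = 0
      · rw [h4, zero_add] at h
        exact key1 h1 (right_ne_zero_of_mul h)
      · exact key2 h1 h4
    · rw [zero_add] at h
      exact key1 h1 (right_ne_zero_of_mul h)
    · have h := right_ne_zero_of_mul h
      cases w with
      | nil => simp [Z2] at h
      | cons d w =>
        rw [Z2] at h
        split_ifs at h with h5
        · have h6 := ih w.length (by simp at hn; omega) w d [x] rfl (by simpa using h5) h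
          obtain ⟨q, hq, hqx⟩ := h3
          intro z hz
          have hxz : x ≤ z := by
            rcases List.mem_cons.1 hz with rfl | hz
            · exact le_rfl
            · rcases List.mem_cons.1 hz with rfl | hz
              · exact h5.le
              · exact ((h6 z hz).2 x (by simp)).le
          refine ⟨?_, ?_⟩
          · rintro rfl
            simp at hq
          · intro q' hq'
            have : q' = q := Option.mem_unique hq' hq
            omega
        · simp at h
    · simp at h

open scoped Classical in
lemma T_coeff (s : ℕ) (hs : 3 ≤ s) (w : List ℕ) (k y q : ℕ) (b : List ℕ) (hq : q < y)
    (hk : s * k ≤ w.length + 1) :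
    (T s y (q :: b) w).coeff k = if ∀ z ∈ w, q < z then (Z0 s w).coeff k else 0 := by
  cases w with
  | nil => simp [T, Z0]
  | cons x w =>
    have h1 : (T s y (q :: b) (x :: w)).coeff k = if q < x then (Z0 s (x :: w)).coeff k else 0 := by
      rw [T, Z0]
      by_cases h1 : y < x
      · have : q < x := by omega
        simp only [h1, this, if_true]
      · by_cases h2 : q < x
        · have h3 : ∃ q' ∈ (q :: b).head?, q' < x := by simpa using h2
          simp only [h1, h2, h3, if_true, if_false]
          cases k with
          | zero => simp
          | succ k =>
            rw [Polynomial.coeff_X_mul, Polynomial.coeff_X_mul]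
            cases w with
            | nil =>
              rw [Z2, Z_nil]
              cases k with
              | zero =>
                simp at hk
                omega
              | succ k => simp [Polynomial.coeff_one]
            | cons d w =>
              rw [Z2, Z_cons]
              by_cases h4 : x < d
              · have h5 : ([] : List ℕ).length + 1 < s := by simp; omega
                simp only [h4, h5, if_true]
                rw [Polynomial.coeff_add, left_eq_add]
                cases k with
                | zero => simp
                | succ k =>
                  rw [Polynomial.coeff_X_mul]
                  by_contra h6
                  have := Z_deg s (by omega) _ w k d [] rfl (by simp; omega) h6
                  simp at this hk
                  rw [Nat.mul_succ] at hk
                  omega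
              · simp [h4]
        · have h3 : ¬ ∃ q' ∈ (q :: b).head?, q' < x := by simpa using h2
          simp only [h1, h2, h3, if_false, Polynomial.coeff_zero]
    rw [h1]
    by_cases h2 : q < x
    · rw [if_pos h2]
      split_ifs with h3
      · rfl
      · by_contra h4
        apply h3
        have h5 : Z s w x [] ≠ 0 := by
          intro h5
          rw [Z0, h5] at h4
          simp at h4
        intro z hz
        rcases List.mem_cons.1 hz with rfl | hz
        · exact h2
        · exact lt_trans h2 ((Z_min s _ w x [] rfl (by simp) h5 z hz).1 rfl)
    · rw [if_neg h2, if_neg]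
      intro h3
      exact h2 (h3 x (by simp))

open scoped Classical in
lemma T_sum (s : ℕ) (hs : 3 ≤ s) (S : Finset ℕ) (k y q : ℕ) (b : List ℕ) (hq : q < y)
    (hk : s * k ≤ S.card + 1) :
    ∑ w ∈ perms S, (T s y (q :: b) w).coeff k =
      if ∀ z ∈ S, q < z then ∑ w ∈ perms S, (Z0 s w).coeff k else 0 := by
  have : ∀ w ∈ perms S, (T s y (q :: b) w).coeff k =
      if ∀ z ∈ S, q < z then (Z0 s w).coeff k else 0 := by
    intro w hw
    rw [T_coeff s hs w k y q b hq (by rw [length_of_mem hw]; exact hk)]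
    simp only [mem_of_mem hw]
  rw [Finset.sum_congr rfl this]
  split_ifs <;> simp

lemma T_sum_zero (s : ℕ) (hs : 3 ≤ s) (S : Finset ℕ) (k y : ℕ) (b : List ℕ)
    (hk : s * k < S.card) :
    ∑ w ∈ perms S, (T s y b w).coeff k = 0 := by
  apply Finset.sum_eq_zero
  intro w hw
  by_contra h
  have := T_deg s (by omega) w k y b h
  rw [length_of_mem hw] at this
  omega

open scoped Classical in
lemma Ex_sum (s : ℕ) (S : Finset ℕ) (k y : ℕ) (b : List ℕ) (hb : b.length + 1 < s) :
    ∑ w ∈ perms S, (Ex s y b w).coeff k =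
      if ∀ z ∈ S, y < z then
        ∑ x ∈ S, ∑ w ∈ perms (S.erase x), (Z s w x (y :: b)).coeff k else 0 := by
  rcases S.eq_empty_or_nonempty with rfl | hS
  · simp [perms_empty, Ex]
  rw [sum_cons S hS]
  split_ifs with h
  · apply Finset.sum_congr rfl
    intro x hx
    apply Finset.sum_congr rfl
    intro w hw
    rw [Ex, if_pos (h x hx), if_pos hb]
  · apply Finset.sum_eq_zero
    intro x hx
    apply Finset.sum_eq_zero
    intro w hw
    by_contra h1
    rw [Ex] at h1
    split_ifs at h1 with h2
    · apply h
      have h3 : Z s w x (y :: b) ≠ 0 := by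
        intro h3
        rw [h3] at h1
        simp at h1
      intro z hz
      by_cases hzx : z = x
      · subst hzx
        exact h2
      · have : z ∈ w := (mem_of_mem hw z).2 (by simp [hzx, hz])
        exact (Z_min s _ w x (y :: b) rfl (by simpa using h2) h3 z this).2 y (by simp)
    · simp at h1

open scoped Classical in
lemma sum_min (S : Finset ℕ) (hS : S.Nonempty) (v : ℚ) :
    ∑ x ∈ S, (if ∀ z ∈ S.erase x, x < z then v else 0) = v := by
  rw [Finset.sum_eq_single (S.min' hS)]
  · rw [if_pos]
    intro z hz
    exact S.min'_lt_of_mem_erase_min' hS hz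
  · intro x hx hne
    rw [if_neg]
    intro h
    have := h (S.min' hS) (by simp [S.min'_mem hS, Ne.symm hne])
    have := S.min'_le x hx
    omega
  · intro h
    exact absurd (S.min'_mem hS) h

/-- full bricks -/
noncomputable def E (s : ℕ) : ℕ → ℚ
  | 0 => 1
  | k + 1 => (s * k + 1) * E s k

/-- one short brick -/
noncomputable def D (s : ℕ) : ℕ → ℚ
  | 0 => 0
  | k + 1 => s * k * D s k + (s * k + 1) * E s k

def Fresh (s k : ℕ) : Prop := ∀ S : Finset ℕ,
  (S.card = s * k → ∑ w ∈ perms S, (Z0 s w).coeff k = E s k) ∧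
  (S.card + 1 = s * k → ∑ w ∈ perms S, (Z0 s w).coeff k = D s k)

open scoped Classical in
/-- the extension sum for a brick of size `s - 1` -/
lemma Ex_last (s : ℕ) (hs : 3 ≤ s) (k m : ℕ) (v : ℚ) (S : Finset ℕ) (hS : S.card = m)
    (hm : s * k ≤ m)
    (hv : ∀ S : Finset ℕ, S.card + 1 = m → ∑ w ∈ perms S, (Z0 s w).coeff k = v)
    (y : ℕ) (b : List ℕ) (hb : b.length + 2 = s) :
    ∑ w ∈ perms S, (Ex s y b w).coeff k = if ∀ z ∈ S, y < z then m * v else 0 := by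
  rw [Ex_sum s S k y b (by omega)]
  split_ifs with h
  · rw [Finset.sum_congr rfl (g := fun _ => v)]
    · simp [hS]
    · intro x hx
      have hc : (S.erase x).card + 1 = m := by rw [← hS]; exact Finset.card_erase_add_one hx
      have h1 : ∀ w ∈ perms (S.erase x), (Z s w x (y :: b)).coeff k =
          (T s x (y :: b) w).coeff k := by
        intro w hw
        rw [Z_eq]
        cases w with
        | nil => simp [Ex]
        | cons x' w =>
          have : ¬ ((y :: b).length + 1 < s) := by simp; omega
          rw [Ex, if_neg this, ite_self, add_zero]
      rw [Finset.sum_congr rfl h1, T_sum s hs _ k x y b (h x hx) (by omega), if_pos]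
      · exact hv _ hc
      · intro z hz
        exact h z (Finset.mem_of_mem_erase hz)
  · rfl

open scoped Classical in
lemma stage (s : ℕ) (hs : 3 ≤ s) (k : ℕ) (hF : Fresh s k) (r : ℕ) :
    ∀ (y : ℕ) (b : List ℕ) (S : Finset ℕ), (∀ q ∈ b.head?, q < y) → b.length + 3 + r = s →
    (S.card = s * k + r + 2 → ∑ w ∈ perms S, (Z s w y b).coeff k =
      if ∀ z ∈ S, y < z then E s (k + 1) else 0) ∧
    (S.card = s * k + r + 1 → ∑ w ∈ perms S, (Z s w y b).coeff k =
      if ∀ z ∈ S, y < z then D s (k + 1) else 0) := by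
  induction r with
  | zero =>
    intro y b S hq hb
    constructor
    · intro hS
      simp only [Z_eq s y b, Polynomial.coeff_add]
      rw [Finset.sum_add_distrib, T_sum_zero s hs S k y b (by omega), zero_add,
        Ex_sum s S k y b (by omega)]
      split_ifs with h
      · rw [Finset.sum_congr rfl (g := fun x =>
          if ∀ z ∈ S.erase x, x < z then E s (k + 1) else 0)]
        · exact sum_min S (Finset.card_pos.1 (by omega)) _
        · intro x hx
          have hc := Finset.card_erase_add_one hx
          simp only [Z_eq s x (y :: b), Polynomial.coeff_add]
          rw [Finset.sum_add_distrib, T_sum_zero s hs _ k x _ (by omega), zero_add,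
            Ex_last s hs k (s * k + 1) (E s k) _ (by omega) (by omega)
              (fun S' hS' => (hF S').1 (by omega)) x (y :: b) (by simp; omega)]
          simp [E]
      · rfl
    · intro hS
      simp only [Z_eq s y b, Polynomial.coeff_add]
      rw [Finset.sum_add_distrib, T_sum_zero s hs S k y b (by omega), zero_add,
        Ex_sum s S k y b (by omega)]
      split_ifs with h
      · rw [Finset.sum_congr rfl (g := fun x =>
          E s k + if ∀ z ∈ S.erase x, x < z then s * k * D s k else 0)]
        · rw [Finset.sum_add_distrib, sum_min S (Finset.card_pos.1 (by omega)),
            Finset.sum_const, hS, D]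
          simp
          ring
        · intro x hx
          have hc := Finset.card_erase_add_one hx
          simp only [Z_eq s x (y :: b), Polynomial.coeff_add]
          rw [Finset.sum_add_distrib, T_sum s hs _ k x y b (h x hx) (by omega),
            Ex_last s hs k (s * k) (D s k) _ (by omega) (by omega)
              (fun S' hS' => (hF S').2 (by omega)) x (y :: b) (by simp; omega),
            if_pos (fun z hz => h z (Finset.mem_of_mem_erase hz)), (hF _).1 (by omega)]
          simp
      · rfl
  | succ r ih =>
    intro y b S hq hb
    have main : ∀ v : ℚ, s * k + r + 1 < S.card →
        (∀ x ∈ S, y < x → ∑ w ∈ perms (S.erase x), (Z s w x (y :: b)).coeff k =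
          if ∀ z ∈ S.erase x, x < z then v else 0) →
        ∑ w ∈ perms S, (Z s w y b).coeff k = if ∀ z ∈ S, y < z then v else 0 := by
      intro v hS hv
      simp only [Z_eq s y b, Polynomial.coeff_add]
      rw [Finset.sum_add_distrib, T_sum_zero s hs S k y b (by omega), zero_add,
        Ex_sum s S k y b (by omega)]
      split_ifs with h
      · rw [Finset.sum_congr rfl (fun x hx => hv x hx (h x hx))]
        exact sum_min S (Finset.card_pos.1 (by omega)) _
      · rfl
    constructor
    · intro hS
      apply main _ (by omega)
      intro x hx hyx
      have hc := Finset.card_erase_add_one hx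
      exact (ih x (y :: b) (S.erase x) (by simpa using hyx) (by simp; omega)).1 (by omega)
    · intro hS
      apply main _ (by omega)
      intro x hx hyx
      have hc := Finset.card_erase_add_one hx
      exact (ih x (y :: b) (S.erase x) (by simpa using hyx) (by simp; omega)).2 (by omega)

lemma fresh (s : ℕ) (hs : 3 ≤ s) (k : ℕ) : Fresh s k := by
  classical
  induction k with
  | zero =>
    intro S
    constructor
    · intro h
      simp at h
      subst h
      simp [perms_empty, Z0, E]
    · intro h
      simp at h
  | succ k ih =>
    intro S
    have main : ∀ v : ℚ, S.Nonempty →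
        (∀ x ∈ S, ∑ w ∈ perms (S.erase x), (Z s w x []).coeff k =
          if ∀ z ∈ S.erase x, x < z then v else 0) →
        ∑ w ∈ perms S, (Z0 s w).coeff (k + 1) = v := by
      intro v hS hv
      rw [sum_cons S hS]
      simp only [Z0, Polynomial.coeff_X_mul]
      rw [Finset.sum_congr rfl hv]
      exact sum_min S hS _
    rw [Nat.mul_succ]
    constructor
    · intro hS
      apply main _ (Finset.card_pos.1 (by omega))
      intro x hx
      have hc := Finset.card_erase_add_one hx
      exact (stage s hs k ih (s - 3) x [] (S.erase x) (by simp) (by simp; omega)).1 (by omega)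
    · intro hS
      apply main _ (Finset.card_pos.1 (by omega))
      intro x hx
      have hc := Finset.card_erase_add_one hx
      exact (stage s hs k ih (s - 3) x [] (S.erase x) (by simp) (by simp; omega)).2 (by omega)

lemma D_eq (s k : ℕ) :
    E s (k + 2) = (s + 1) * ((∏ i ∈ Finset.Icc 1 k, ((i + 1) * s + 1) : ℕ) : ℚ) ∧
    D s (k + 1) = ((∏ i ∈ Finset.Icc 1 k, ((i + 1) * s + 1) : ℕ) : ℚ) := by
  induction k with
  | zero => simp [E, D]
  | succ k ih =>
    rw [Finset.prod_Icc_succ_top (by omega)]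
    constructor
    · rw [E, ih.1]
      push_cast
      ring
    · have h : D s (k + 1 + 1) = s * (k + 1) * D s (k + 1) + E s (k + 2) := by
        rw [D, show E s (k + 2) = (s * (k + 1 : ℕ) + 1) * E s (k + 1) from rfl]
        push_cast
        ring
      rw [h, ih.1, ih.2]
      push_cast
      ring

end S14

theorem stmt14 (s : ℕ) (hs : 3 ≤ s) (Γ : Set (List ℕ))
    (hΓ : Γ = {[1, 3, 2, 4], [1, 4, 2, 3], List.range' 1 (s + 1)})
    (U : ℤ → Polynomial ℚ)
    (hUneg : ∀ m : ℤ, m < 0 → U m = 0)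
    (hU0 : U 0 = 1)
    (hUrec : ∀ n : ℕ, 1 ≤ n →
      ∑ k ∈ Finset.range (n + 1), (n.choose k : ℚ) • (U (k : ℤ) * NMpoly Γ (n - k)) = 0) :
    ∀ n : ℕ, 1 ≤ n →
      ((U ((s * n + s - 1 : ℕ) : ℤ)).comp (-X)).coeff (n + 1) =
        ((∏ i ∈ Finset.Icc 1 n, ((i + 1) * s + 1) : ℕ) : ℚ) := by

  intro n hn
  have hΓ' : Γ = S14.Gam s := hΓ
  subst hΓ'
  have h1 := S14.U_eq s (by omega) U hU0 hUrec (s * n + s - 1) (Finset.range (s * n + s - 1))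
    (by simp)
  rw [← h1, Polynomial.finsetSum_coeff]
  rw [(S14.fresh s hs (n + 1) _).2 (by rw [Finset.card_range, Nat.mul_succ]; omega)]
  exact (S14.D_eq s n).2
end

section
/- Let Γ = Γ_{2,2,3} = {1324, 1423, 1234}, and for k ≥ 1 let A_k denote the coefficient of y^{k+1} in the polynomial U_{Γ,3k+1}(−y). Then A_1 = 5, and for all k ≥ 2, A_k = (3k−1)·A_{k−1} + 3k·Π_{i=1}^{k−1} (3i+4). -/
open Polynomial

noncomputable section Helpers15

/-- Sum of `h` over all listings of the finite set `S`. -/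
def Phi (S : Finset ℕ) (h : List ℕ → ℚ[X]) : ℚ[X] := ∑ l ∈ S.val.lists.toFinset, h l

/-- Convolution by splitting a list. -/
def conv : (List ℕ → ℚ[X]) → (List ℕ → ℚ[X]) → List ℕ → ℚ[X]
  | f, g, [] => f [] * g []
  | f, g, a :: l => f [] * g (a :: l) + conv (fun t => f (a :: t)) g l

def mu (g : List ℕ → ℚ[X]) : List ℕ → ℚ[X]
  | [] => 0
  | a :: l => if ∀ x ∈ l, a < x then g l else 0

def skp (g : List ℕ → ℚ[X]) : List ℕ → ℚ[X]
  | [] => 0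
  | _ :: l => g l

lemma mem_lists' (S : Finset ℕ) (l : List ℕ) : l ∈ S.val.lists.toFinset ↔ l.Nodup ∧ l.toFinset = S := by
  rw [Multiset.mem_toFinset, Multiset.mem_lists_iff]
  constructor
  · intro h
    have h' : S.val = (l : Multiset ℕ) := h
    have hn : l.Nodup := by
      have := S.nodup; rw [h'] at this; exact_mod_cast this
    refine ⟨hn, ?_⟩
    ext x
    rw [List.mem_toFinset, ← Finset.mem_val, h']; simp
  · rintro ⟨h, rfl⟩
    show _ = (l : Multiset ℕ)
    rw [List.toFinset_val, h.dedup]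

lemma Phi_congr {S : Finset ℕ} {f g : List ℕ → ℚ[X]}
    (h : ∀ l : List ℕ, l.Nodup → l.toFinset = S → f l = g l) : Phi S f = Phi S g := by
  apply Finset.sum_congr rfl
  intro l hl
  rw [mem_lists'] at hl
  exact h l hl.1 hl.2

lemma Phi_empty (f : List ℕ → ℚ[X]) : Phi ∅ f = f [] := by
  unfold Phi
  have : (∅ : Finset ℕ).val.lists.toFinset = {[]} := by
    ext l; rw [mem_lists']; simp
    rintro rfl; simp
  rw [this]; simp

lemma Phi_rec (S : Finset ℕ) (hS : S.Nonempty) (f : List ℕ → ℚ[X]) :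
    Phi S f = ∑ a ∈ S, Phi (S.erase a) (fun l => f (a :: l)) := by
  unfold Phi
  rw [Finset.sum_sigma']
  symm
  refine Finset.sum_bij (fun p _ => p.1 :: p.2) ?_ ?_ ?_ ?_
  · rintro ⟨a, l⟩ h
    rw [Finset.mem_sigma, mem_lists'] at h
    obtain ⟨ha, hn, hl⟩ := h
    dsimp only at ha hn hl ⊢
    rw [mem_lists', List.nodup_cons, List.toFinset_cons, hl]
    refine ⟨⟨?_, hn⟩, Finset.insert_erase ha⟩
    rw [← List.mem_toFinset, hl]; simp
  · rintro ⟨a, l⟩ _ ⟨b, m⟩ _ h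
    simp only [List.cons.injEq] at h
    obtain ⟨rfl, rfl⟩ := h
    rfl
  · intro l hl
    rw [mem_lists'] at hl
    obtain ⟨hn, hl⟩ := hl
    cases l with
    | nil => simp at hl; subst hl; simp at hS
    | cons a l =>
      refine ⟨⟨a, l⟩, ?_, rfl⟩
      rw [List.nodup_cons] at hn
      rw [List.toFinset_cons] at hl
      rw [Finset.mem_sigma, mem_lists']
      refine ⟨?_, hn.2, ?_⟩
      · rw [← hl]; simp
      · dsimp only; rw [← hl, Finset.erase_insert]; simpa using hn.1
  · intros; rfl

lemma Phi_add (S f g) : Phi S (fun l => f l + g l) = Phi S f + Phi S g := Finset.sum_add_distrib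
lemma Phi_mul (S) (c : ℚ[X]) (g) : Phi S (fun l => c * g l) = c * Phi S g := by
  unfold Phi; rw [Finset.mul_sum]
lemma Phi_mul_right (S) (c : ℚ[X]) (g) : Phi S (fun l => g l * c) = Phi S g * c := by
  unfold Phi; rw [Finset.sum_mul]
lemma Phi_zero (S) : Phi S (fun _ => 0) = 0 := by simp [Phi]

lemma Phi_conv (n : ℕ) : ∀ (S : Finset ℕ) (_ : S.card = n) (f g : List ℕ → ℚ[X]),
    Phi S (conv f g) = ∑ T ∈ S.powerset, Phi T f * Phi (S \ T) g := by
  induction n with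
  | zero =>
    intro S hS f g
    rw [Finset.card_eq_zero] at hS
    subst hS
    simp [Phi_empty, conv]
  | succ n ih =>
    intro S hS f g
    have hne : S.Nonempty := by rw [← Finset.card_pos]; omega
    rw [Phi_rec S hne]
    simp only [conv]
    have h1 : ∑ a ∈ S, Phi (S.erase a) (fun l => f [] * g (a :: l) + conv (fun t => f (a :: t)) g l)
        = f [] * Phi S g + ∑ a ∈ S, ∑ T ∈ (S.erase a).powerset,
            Phi T (fun t => f (a :: t)) * Phi (S.erase a \ T) g := by
      rw [Phi_rec S hne g, Finset.mul_sum, ← Finset.sum_add_distrib]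
      apply Finset.sum_congr rfl
      intro a ha
      rw [Phi_add, Phi_mul]
      congr 1
      exact ih _ (by rw [Finset.card_erase_of_mem ha]; omega) _ _
    rw [h1, ← Finset.add_sum_erase _ _ (Finset.empty_mem_powerset S), Phi_empty, Finset.sdiff_empty]
    congr 1
    have h2 : ∀ T ∈ S.powerset.erase ∅, Phi T f * Phi (S \ T) g
        = ∑ a ∈ T, Phi (T.erase a) (fun t => f (a :: t)) * Phi (S \ T) g := by
      intro T hT
      rw [Finset.mem_erase] at hT
      rw [Phi_rec T (Finset.nonempty_iff_ne_empty.2 hT.1), Finset.sum_mul]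
    rw [Finset.sum_congr rfl h2, Finset.sum_sigma', Finset.sum_sigma']
    refine Finset.sum_bij' (fun p _ => ⟨insert p.1 p.2, p.1⟩) (fun p _ => ⟨p.2, p.1.erase p.2⟩)
      ?_ ?_ ?_ ?_ ?_
    · rintro ⟨a, T⟩ h
      simp only [Finset.mem_sigma, Finset.mem_powerset, Finset.mem_erase] at h ⊢
      refine ⟨⟨Finset.insert_ne_empty _ _, Finset.insert_subset h.1 (h.2.trans (Finset.erase_subset _ _))⟩, by simp⟩
    · rintro ⟨T, a⟩ h
      simp only [Finset.mem_sigma, Finset.mem_powerset, Finset.mem_erase] at h ⊢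
      exact ⟨h.1.2 h.2, Finset.erase_subset_erase _ h.1.2⟩
    · rintro ⟨a, T⟩ h
      simp only [Finset.mem_sigma, Finset.mem_powerset] at h
      have : a ∉ T := fun h' => by simpa using h.2 h'
      simp [Finset.erase_insert this]
    · rintro ⟨T, a⟩ h
      simp only [Finset.mem_sigma] at h
      simp [Finset.insert_erase h.2]
    · rintro ⟨a, T⟩ h
      simp only [Finset.mem_sigma, Finset.mem_powerset] at h
      have : a ∉ T := fun h' => by simpa using h.2 h'
      simp only [Finset.erase_insert this]
      congr 2
      ext x
      simp; tauto

/-- The value of `Phi` only depends on the cardinality. -/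
def HasVal (g : List ℕ → ℚ[X]) (n : ℕ) (c : ℚ[X]) : Prop := ∀ T : Finset ℕ, T.card = n → Phi T g = c

lemma HasVal.nil (g) : HasVal g 0 (g []) := by
  intro T hT
  rw [Finset.card_eq_zero] at hT
  rw [hT, Phi_empty]

lemma HasVal.hmu {g n c} (h : HasVal g n c) : HasVal (mu g) (n + 1) c := by
  intro S hS
  have hne : S.Nonempty := by rw [← Finset.card_pos]; omega
  rw [Phi_rec S hne]
  have : ∀ a ∈ S, Phi (S.erase a) (fun l => mu g (a :: l))
      = if a = S.min' hne then c else 0 := by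
    intro a ha
    split_ifs with h1
    · rw [← h (S.erase a) (by rw [Finset.card_erase_of_mem ha]; omega)]
      apply Phi_congr
      intro l _ hl
      simp only [mu]
      rw [if_pos]
      intro x hx
      rw [← List.mem_toFinset, hl, Finset.mem_erase] at hx
      have := S.min'_le x hx.2
      have := hx.1
      omega
    · rw [← Phi_zero (S.erase a)]
      apply Phi_congr
      intro l _ hl
      simp only [mu]
      rw [if_neg]
      intro h2
      have := h2 (S.min' hne) (by
        rw [← List.mem_toFinset, hl, Finset.mem_erase]
        exact ⟨fun h => h1 h.symm, S.min'_mem hne⟩)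
      have := S.min'_le a ha
      omega
  rw [Finset.sum_congr rfl this, Finset.sum_ite_eq', if_pos (S.min'_mem hne)]

lemma HasVal.hskp {g n c} (h : HasVal g n c) : HasVal (skp g) (n + 1) ((n + 1 : ℚ[X]) * c) := by
  intro S hS
  have hne : S.Nonempty := by rw [← Finset.card_pos]; omega
  rw [Phi_rec S hne]
  have : ∀ a ∈ S, Phi (S.erase a) (fun l => skp g (a :: l)) = c := by
    intro a ha
    exact h (S.erase a) (by rw [Finset.card_erase_of_mem ha]; omega)
  rw [Finset.sum_congr rfl this, Finset.sum_const, hS]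
  simp

lemma HasVal.add {f g n c d} (h : HasVal f n c) (h' : HasVal g n d) :
    HasVal (fun l => f l + g l) n (c + d) := by
  intro S hS
  rw [Phi_add, h S hS, h' S hS]

lemma HasVal.mul {g n c} (e : ℚ[X]) (h : HasVal g n c) :
    HasVal (fun l => e * g l) n (e * c) := by
  intro S hS
  rw [Phi_mul, h S hS]

/-- pair (v, z) -/
def VZ : List ℕ → ℚ[X] × ℚ[X]
  | [] => (0, 1)
  | [_] => (-X, 0)
  | [a, b] => (mu (fun _ => -X * ((VZ [b]).1 + (VZ [b]).2)) [a, b],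
      if a < b then -X else 0)
  | a :: b :: c :: l =>
    (mu (fun _ => -X * ((VZ (b :: c :: l)).1 + (VZ (b :: c :: l)).2)) (a :: b :: c :: l),
     -X * (mu (mu fun _ => (VZ (c :: l)).1) (a :: b :: c :: l)
          + mu (skp fun _ => (VZ (c :: l)).2) (a :: b :: c :: l)
          + mu (mu (mu fun _ => (VZ l).1)) (a :: b :: c :: l)
          + mu (mu (skp fun _ => (VZ l).2)) (a :: b :: c :: l)))

def vv (l : List ℕ) := (VZ l).1
def zz (l : List ℕ) := (VZ l).2

lemma vv_eq (l) : vv l = mu (fun l => -X * (vv l + zz l)) l := by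
  match l with
  | [] => simp [vv, VZ, mu]
  | [a] => simp [vv, zz, VZ, mu]
  | [a, b] => simp [vv, zz, VZ, mu]
  | a :: b :: c :: l => simp only [vv, zz, VZ, mu]

lemma zz_eq (l) (h : l ≠ []) : zz l = -X * (mu (mu vv) l + mu (skp zz) l + mu (mu (mu vv)) l
    + mu (mu (skp zz)) l) := by
  match l with
  | [] => simp at h
  | [a] => simp [zz, VZ, mu, skp]
  | [a, b] => simp [vv, zz, VZ, mu, skp]
  | a :: b :: c :: l => simp only [vv, zz, VZ, mu, skp]

/-- values on sets -/
def PP : ℕ → ℚ[X] × ℚ[X]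
  | 0 => (0, 1)
  | 1 => (-X, 0)
  | 2 => (X ^ 2, -X)
  | n + 3 => (-X * ((PP (n + 2)).1 + (PP (n + 2)).2),
      -X * ((PP (n + 1)).1 + ((n : ℚ[X]) + 2) * (PP (n + 1)).2 + (PP n).1 + ((n : ℚ[X]) + 1) * (PP n).2))

lemma HasVal.zz_of {n c} (h : HasVal (fun l => mu (mu vv) l + mu (skp zz) l + mu (mu (mu vv)) l
    + mu (mu (skp zz)) l) (n + 1) c) : HasVal zz (n + 1) (-X * c) := by
  intro S hS
  rw [← (h.mul (-X)) S hS]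
  apply Phi_congr
  intro l _ hl
  apply zz_eq
  rintro rfl
  simp at hl; subst hl; simp at hS

lemma HasVal.vv_of {n c d} (h : HasVal vv n c) (h' : HasVal zz n d) :
    HasVal vv (n + 1) (-X * (c + d)) := by
  have := ((h.add h').mul (-X)).hmu
  have e : vv = mu (fun l => -X * (vv l + zz l)) := funext vv_eq
  rw [e]
  exact this

lemma HasVal.mu0 (g) : HasVal (mu g) 0 0 := HasVal.nil _
lemma HasVal.skp0 (g) : HasVal (skp g) 0 0 := HasVal.nil _

lemma hasVal_PP (n : ℕ) : HasVal vv n (PP n).1 ∧ HasVal zz n (PP n).2 := by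
  induction n using Nat.strong_induction_on with
  | _ n ih =>
  match n, ih with
  | 0, _ => exact ⟨HasVal.nil _, HasVal.nil zz⟩
  | 1, ih =>
    have h0 := ih 0 (by omega)
    refine ⟨?_, ?_⟩
    · convert h0.1.vv_of h0.2 using 1; simp [PP]
    · convert HasVal.zz_of ((((HasVal.mu0 _).hmu.add (HasVal.skp0 _).hmu).add (HasVal.mu0 _).hmu).add
        (HasVal.mu0 _).hmu) using 1
      simp [PP]
  | 2, ih =>
    have h0 := ih 0 (by omega)
    have h1 := ih 1 (by omega)
    refine ⟨?_, ?_⟩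
    · convert h1.1.vv_of h1.2 using 1; simp [PP]; ring
    · convert HasVal.zz_of (((h0.1.hmu.hmu.add h0.2.hskp.hmu).add (HasVal.mu0 _).hmu.hmu).add
        (HasVal.skp0 _).hmu.hmu) using 1
      simp [PP]
  | n + 3, ih =>
    have h0 := ih n (by omega)
    have h1 := ih (n + 1) (by omega)
    have h2 := ih (n + 2) (by omega)
    refine ⟨?_, ?_⟩
    · convert h2.1.vv_of h2.2 using 1
      rw [PP]
    · convert HasVal.zz_of (((h1.1.hmu.hmu.add h1.2.hskp.hmu).add h0.1.hmu.hmu.hmu).add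
        h0.2.hskp.hmu.hmu) using 1
      rw [PP]; push_cast; ring

/-- recursive form of the weight -/
def ww : List ℕ → ℚ[X]
  | [] => 1
  | [_] => X
  | [a, b] => (if b < a then X else 1) * ww [b]
  | [a, b, c] => (if b < a then X else 1) * ww [b, c]
  | a :: b :: c :: d :: l => if a < b ∧ a < c ∧ c < d then 0 else
      (if b < a then X else 1) * ww (b :: c :: d :: l)

lemma ww_desc {a b : ℕ} (h : b < a) (l) : ww (a :: b :: l) = X * ww (b :: l) := by
  have h' : ¬ a < b := by omega
  match l with
  | [] => simp [ww, h]
  | [c] => simp [ww, h]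
  | c :: d :: l => rw [ww]; simp [h, h']

lemma ww_asc2 {a b : ℕ} (h : a < b) : ww [a, b] = X := by
  have h' : ¬ b < a := by omega
  simp [ww, h']

lemma ww_asc3 {a b c : ℕ} (h : a < b) : ww [a, b, c] = ww [b, c] := by
  have h' : ¬ b < a := by omega
  simp [ww, h']

lemma ww_asc4 {a b c d : ℕ} (h : a < b) (l) (h2 : ¬ (a < c ∧ c < d)) :
    ww (a :: b :: c :: d :: l) = ww (b :: c :: d :: l) := by
  have h' : ¬ b < a := by omega
  rw [ww]; simp only [h, true_and, h2, h', if_false, one_mul]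

lemma ww_bad {a b c d : ℕ} (h : a < b) (l) (h2 : a < c) (h3 : c < d) :
    ww (a :: b :: c :: d :: l) = 0 := by
  rw [ww]; simp [h, h2, h3]

lemma conv_add (f g w) (l) : conv (fun t => f t + g t) w l = conv f w l + conv g w l := by
  induction l generalizing f g with
  | nil => simp [conv]; ring
  | cons a l ih => simp [conv, ih]; ring

lemma conv_mul (e : ℚ[X]) (f w) (l) : conv (fun t => e * f t) w l = e * conv f w l := by
  induction l generalizing f with
  | nil => simp [conv]; ring
  | cons a l ih => simp [conv, ih]; ring

lemma conv_zero (w) (l) : conv (fun _ => 0) w l = 0 := by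
  induction l with
  | nil => simp [conv]
  | cons a l ih => simp [conv, ih]

lemma conv_if (p : Prop) [Decidable p] (f w) (l) :
    conv (fun t => if p then f t else 0) w l = if p then conv f w l else 0 := by
  split_ifs
  · rfl
  · exact conv_zero w l

lemma conv_all_cons (a : ℕ) (g : List ℕ → ℚ[X]) (hg : ∀ b l, ¬ (∀ x ∈ l, b < x) → g (b :: l) = 0)
    (w) (b l) : conv (fun t => if ∀ x ∈ t, a < x then g t else 0) w (b :: l)
      = if a < b then conv g w (b :: l) else g [] * w (b :: l) := by
  simp only [conv]
  have : (fun t => if ∀ x ∈ b :: t, a < x then g (b :: t) else 0)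
      = fun t => if a < b then g (b :: t) else 0 := by
    funext t
    by_cases h1 : a < b
    · by_cases h2 : ∀ x ∈ t, b < x
      · rw [if_pos, if_pos h1]
        intro x hx
        rcases List.mem_cons.1 hx with rfl | hx
        · exact h1
        · exact h1.trans (h2 x hx)
      · simp [hg b t h2]
    · simp [h1]
  rw [this, conv_if, if_pos (by simp)]
  split_ifs
  · rfl
  · simp

lemma conv_all_nil (a : ℕ) (g w : List ℕ → ℚ[X]) :
    conv (fun t => if ∀ x ∈ t, a < x then g t else 0) w [] = g [] * w [] := by
  simp [conv]

lemma vv_supp : ∀ b l, ¬ (∀ x ∈ l, b < x) → vv (b :: l) = 0 := by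
  intro b l h
  rw [vv_eq]; simp only [mu]; rw [if_neg h]

lemma zz_supp : ∀ b l, ¬ (∀ x ∈ l, b < x) → zz (b :: l) = 0 := by
  intro b l h
  rw [zz_eq _ (by simp)]; simp only [mu]; simp only [if_neg h]; simp

lemma vv_nil : vv [] = 0 := rfl
lemma zz_nil : zz [] = 1 := rfl
lemma ww_nil : ww [] = 1 := rfl
lemma zz_one (a) : zz [a] = 0 := rfl

/-- block of length three -/
def QQ (b : ℕ) : List ℕ → ℚ[X]
  | [] => 0
  | c :: t => if b < c then (if ∀ x ∈ t, c < x then vv t else 0)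
      + (if ∀ x ∈ t, b < x then zz t else 0) else 0

lemma zz_two (a b : ℕ) (t) : zz (a :: b :: t) = if a < b then
    -X * ((if ∀ x ∈ t, b < x then vv t else 0) + (if ∀ x ∈ t, a < x then zz t else 0) + QQ b t)
    else 0 := by
  rw [zz_eq _ (by simp)]
  by_cases hab : a < b
  · rw [if_pos hab]
    congr 1
    have e1 : mu (mu vv) (a :: b :: t) = if ∀ x ∈ t, b < x then vv t else 0 := by
      simp only [mu]
      by_cases h : ∀ x ∈ t, b < x
      · have : ∀ x ∈ b :: t, a < x := by
          intro x hx
          rcases List.mem_cons.1 hx with rfl | hx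
          · exact hab
          · exact hab.trans (h x hx)
        simp only [if_pos h, if_pos this]
      · simp [h]
    have e2 : mu (skp zz) (a :: b :: t) = if ∀ x ∈ t, a < x then zz t else 0 := by
      simp [mu, skp, hab]
    rw [e1, e2, add_assoc]
    congr 1
    cases t with
    | nil => simp [mu, QQ, skp]
    | cons c t =>
      simp only [mu, skp, QQ]
      by_cases hbc : b < c
      · by_cases h : ∀ x ∈ t, b < x
        · have h1 : ∀ x ∈ t, a < x := fun x hx => hab.trans (h x hx)
          have h3 : ∀ x ∈ c :: t, b < x := by simpa [hbc] using h
          have h4 : ∀ x ∈ b :: c :: t, a < x := by simpa [hab, hab.trans hbc] using h1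
          rw [if_pos h4, if_pos h4, if_pos h3, if_pos h3, if_pos hbc, if_pos h]
        · have h2 : ¬ ∀ x ∈ t, c < x := fun h' => h fun x hx => hbc.trans (h' x hx)
          simp [h, h2]
      · simp [hbc]
  · simp [mu, hab]

lemma VC_one (a : ℕ) : conv vv ww [a] = -X := by
  simp only [conv, vv_nil, vv_eq [a], mu]
  simp [zz_nil, ww_nil]

lemma VC_cons (a b : ℕ) (l) (ih : conv vv ww (b :: l) + conv zz ww (b :: l) = 0) :
    conv vv ww (a :: b :: l) = if a < b then 0 else -X * ww (b :: l) := by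
  rw [conv, vv_nil, zero_mul, zero_add]
  have : (fun t => vv (a :: t)) = fun t => if ∀ x ∈ t, a < x then -X * (vv t + zz t) else 0 := by
    funext t
    rw [vv_eq]; rfl
  rw [this, conv_all_cons]
  · rw [conv_mul, conv_add, ih, vv_nil, zz_nil]; simp
  · intro c l h
    simp [vv_supp c l h, zz_supp c l h]

lemma ZC_one (a : ℕ) : conv zz ww [a] = X := by
  simp [conv, zz_nil, zz_one, ww]

lemma ZC_cons (a b : ℕ) (l) : conv zz ww (a :: b :: l) = ww (a :: b :: l) +
    if a < b then -X * (conv (fun t => if ∀ x ∈ t, b < x then vv t else 0) ww l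
      + conv (fun t => if ∀ x ∈ t, a < x then zz t else 0) ww l + conv (QQ b) ww l) else 0 := by
  rw [conv, conv]
  simp only [zz_nil, zz_one, zz_two]
  rw [conv_if, conv_mul, conv_add, conv_add]
  simp

lemma QC_nil (b) : conv (QQ b) ww [] = 0 := by simp [conv, QQ]
lemma QC_cons (b c : ℕ) (l) : conv (QQ b) ww (c :: l) = if b < c then
    conv (fun t => if ∀ x ∈ t, c < x then vv t else 0) ww l
      + conv (fun t => if ∀ x ∈ t, b < x then zz t else 0) ww l else 0 := by
  rw [conv]
  simp only [QQ]
  rw [conv_if, conv_add]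
  simp

lemma UC_zero (n : ℕ) : ∀ l : List ℕ, l.length = n + 1 → l.Nodup →
    conv vv ww l + conv zz ww l = 0 := by
  induction n using Nat.strong_induction_on with
  | _ n IH =>
  intro l hl hn
  have ih : ∀ m : List ℕ, m ≠ [] → m.length < l.length → m.Nodup →
      conv vv ww m + conv zz ww m = 0 := by
    intro m h1 h2 h3
    have := List.length_pos_iff.2 h1
    exact IH (m.length - 1) (by omega) m (by omega) h3
  clear IH
  match l, hl, hn, ih with
  | [a], _, _, _ => rw [VC_one, ZC_one]; ring
  | a :: b :: l, hl, hn, ih =>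
    have hn1 := hn
    rw [List.nodup_cons] at hn1
    obtain ⟨hab', hn1⟩ := hn1
    have hab : a ≠ b := fun h => hab' (by simp [h])
    rw [VC_cons a b l (ih _ (by simp) (by simp) hn1), ZC_cons]
    rcases lt_or_gt_of_ne hab with hab | hab
    swap
    · rw [if_neg (by omega), if_neg (by omega), ww_desc hab]; ring
    rw [if_pos hab, if_pos hab]
    match l, hl, hn, hn1, ih with
    | [], _, _, _, _ =>
      rw [conv_all_nil, conv_all_nil, QC_nil, vv_nil, zz_nil, ww_nil, ww_asc2 hab]; ring
    | c :: l, hl, hn, hn1, ih =>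
      have hn2 := hn1
      rw [List.nodup_cons] at hn2
      obtain ⟨hbc', hn2⟩ := hn2
      have hbc : b ≠ c := fun h => hbc' (by simp [h])
      have hac : a ≠ c := by rintro rfl; simp at hn
      have ihc := ih (c :: l) (by simp) (by simp) hn2
      have Zc := eq_neg_of_add_eq_zero_right ihc
      rw [conv_all_cons _ _ vv_supp, conv_all_cons _ _ zz_supp, QC_cons, vv_nil, zz_nil, Zc]
      rcases lt_or_gt_of_ne hbc with hbc | hbc
      · -- a < b < c
        rw [if_pos hbc, if_pos hbc, if_pos (hab.trans hbc)]
        match l, hl, hn, hn1, hn2, ih with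
        | [], _, _, _, _, _ =>
          rw [conv_all_nil, conv_all_nil, vv_nil, zz_nil, ww_nil, ww_asc3 hab, ww_asc2 hbc]; ring
        | d :: l, hl, hn, hn1, hn2, ih =>
          have hn3 := hn2
          rw [List.nodup_cons] at hn3
          obtain ⟨hcd', hn3⟩ := hn3
          have hcd : c ≠ d := fun h => hcd' (by simp [h])
          have hbd : b ≠ d := by rintro rfl; simp at hn1
          have ihd := ih (d :: l) (by simp) (by simp) hn3
          have Zd := eq_neg_of_add_eq_zero_right ihd
          rw [conv_all_cons _ _ vv_supp, conv_all_cons _ _ zz_supp, vv_nil, zz_nil, Zd]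
          rcases lt_or_gt_of_ne hcd with hcd | hcd
          · rw [ww_bad hab _ (by omega) hcd, if_pos hcd, if_pos (by omega)]; ring
          rw [ww_asc4 hab _ (by omega), if_neg (by omega)]
          match l, hl, hn, hn1, hn2, hn3, ih with
          | [], _, _, _, _, _, _ =>
            rw [ww_asc3 hbc, ww_desc hcd, VC_one, ww]
            split_ifs
            · ring
            · ring
          | e :: l, hl, hn, hn1, hn2, hn3, ih =>
            have hn4 := hn3
            rw [List.nodup_cons] at hn4
            obtain ⟨hde', hn4⟩ := hn4
            have hde : d ≠ e := fun h => hde' (by simp [h])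
            rw [VC_cons d e l (ih _ (by simp) (by simp) hn4)]
            rcases lt_or_gt_of_ne hbd with hbd | hbd
            · rcases lt_or_gt_of_ne hde with hde | hde
              · rw [ww_bad hbc _ hbd hde, if_pos hbd, if_pos hde]; ring
              · rw [ww_asc4 hbc _ (by omega), ww_desc hcd, ww_desc hde, if_pos hbd,
                  if_neg (by omega)]; ring
            · rw [ww_asc4 hbc _ (by omega), ww_desc hcd, if_neg (by omega)]; ring
      · have hbc2 : ¬ b < c := by omega
        simp only [if_neg hbc2]
        match l, hl, hn, hn1, hn2, ih with
        | [], _, _, _, _, _ =>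
          rw [ww_asc3 hab, ww_desc hbc, VC_one, ww]
          split_ifs
          · ring
          · ring
        | d :: l, hl, hn, hn1, hn2, ih =>
          have hn3 := hn2
          rw [List.nodup_cons] at hn3
          obtain ⟨hcd', hn3⟩ := hn3
          have hcd : c ≠ d := fun h => hcd' (by simp [h])
          rw [VC_cons c d l (ih _ (by simp) (by simp) hn3)]
          rcases lt_or_gt_of_ne hac with hac | hac
          · rcases lt_or_gt_of_ne hcd with hcd | hcd
            · rw [ww_bad hab _ hac hcd, if_pos hac, if_pos hcd]; ring
            · rw [ww_asc4 hab _ (by omega), ww_desc hbc, ww_desc hcd, if_pos hac,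
                if_neg (by omega)]; ring
          · rw [ww_asc4 hab _ (by omega), ww_desc hbc, if_neg (by omega)]; ring

def UU (n : ℕ) : ℚ[X] := (PP n).1 + (PP n).2
def GG (n : ℕ) : ℚ[X] := Phi (Finset.Icc 1 n) ww

lemma Phi_UC (S : Finset ℕ) (hS : S.Nonempty) :
    ∑ T ∈ S.powerset, UU T.card * Phi (S \ T) ww = 0 := by
  have h1 : Phi S (conv (fun t => vv t + zz t) ww) = 0 := by
    rw [← Phi_zero S]
    apply Phi_congr
    intro l hn hl
    rw [conv_add]
    refine UC_zero (l.length - 1) l ?_ hn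
    have : l ≠ [] := by rintro rfl; simp at hl; subst hl; simp at hS
    have := List.length_pos_iff.2 this
    omega
  rw [Phi_conv _ S rfl] at h1
  rw [← h1]
  apply Finset.sum_congr rfl
  intro T _
  congr 1
  exact (((hasVal_PP T.card).1.add (hasVal_PP T.card).2) T rfl).symm

lemma UU_zero : UU 0 = 1 := by simp [UU, PP]

lemma hasVal_ww (n : ℕ) : HasVal ww n (GG n) ∧
    (1 ≤ n → ∑ k ∈ Finset.range (n + 1), n.choose k • (UU k * GG (n - k)) = 0) := by
  induction n using Nat.strong_induction_on with
  | _ n ih =>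
  by_cases h0 : n = 0
  · subst h0
    refine ⟨?_, by omega⟩
    simpa [GG, Phi_empty] using HasVal.nil ww
  have key : ∀ S : Finset ℕ, S.card = n → Phi S ww - GG n +
      ∑ k ∈ Finset.range (n + 1), n.choose k • (UU k * GG (n - k)) = 0 := by
    intro S hS
    have hne : S.Nonempty := by rw [← Finset.card_pos]; omega
    have h1 := Phi_UC S hne
    have h2 := Finset.sum_powerset_apply_card (fun k => UU k * GG (n - k)) (x := S)
    rw [hS] at h2
    rw [← h2, ← Finset.add_sum_erase _ _ (Finset.empty_mem_powerset S)]
    rw [← Finset.add_sum_erase _ _ (Finset.empty_mem_powerset S)] at h1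
    have h3 : ∑ T ∈ S.powerset.erase ∅, UU T.card * Phi (S \ T) ww
        = ∑ T ∈ S.powerset.erase ∅, UU T.card * GG (n - T.card) := by
      apply Finset.sum_congr rfl
      intro T hT
      rw [Finset.mem_erase, Finset.mem_powerset] at hT
      have hc : 0 < T.card := by
        rw [Finset.card_pos]; exact Finset.nonempty_iff_ne_empty.2 hT.1
      rw [(ih (n - T.card) (by omega)).1 (S \ T) (by rw [Finset.card_sdiff_of_subset hT.2, hS])]
    rw [h3] at h1
    simp only [Finset.card_empty, UU_zero, Finset.sdiff_empty, one_mul, Nat.sub_zero] at h1 ⊢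
    linear_combination h1
  have hs := key (Finset.Icc 1 n) (by simp)
  have hs' : ∑ k ∈ Finset.range (n + 1), n.choose k • (UU k * GG (n - k)) = 0 := by
    simpa [GG] using hs
  refine ⟨?_, fun _ => hs'⟩
  intro S hS
  have := key S hS
  rw [hs'] at this
  linear_combination this

/-- signed coefficients -/
def cv (n m : ℕ) : ℚ := (-1) ^ m * (PP n).1.coeff m
def cz (n m : ℕ) : ℚ := (-1) ^ m * (PP n).2.coeff m

lemma PP_v (n : ℕ) : (PP (n + 1)).1 = -X * ((PP n).1 + (PP n).2) := by
  match n with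
  | 0 => simp [PP]
  | 1 => simp [PP]; ring
  | n + 2 => rw [PP]

lemma cv_zero (m) : cv 0 m = 0 := by simp [cv, PP]
lemma cv_succ_zero (n) : cv (n + 1) 0 = 0 := by simp [cv, PP_v]
lemma cv_succ (n m) : cv (n + 1) (m + 1) = cv n m + cz n m := by
  simp [cv, cz, PP_v, pow_succ]; ring

lemma cz_zero_zero : cz 0 0 = 1 := by simp [cz, PP]
lemma cz_zero_succ (m) : cz 0 (m + 1) = 0 := by simp [cz, PP, coeff_one]
lemma cz_one (m) : cz 1 m = 0 := by simp [cz, PP]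
lemma cz_two_zero : cz 2 0 = 0 := by simp [cz, PP]
lemma cz_two (m) : cz 2 (m + 1) = cz 0 m := by
  simp only [cz, PP, pow_succ]; cases m <;> simp [coeff_X, coeff_one]
lemma cz_succ_zero (n) : cz (n + 3) 0 = 0 := by simp [cz, PP]
lemma cz_succ (n m) : cz (n + 3) (m + 1) = cv (n + 1) m + (n + 2) * cz (n + 1) m + cv n m
    + (n + 1) * cz n m := by
  have e1 : ∀ p : ℚ[X], ((n : ℚ[X]) + 2) * p = C ((n : ℚ) + 2) * p := by intro p; rw [C_add, C_ofNat]; simp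
  have e2 : ∀ p : ℚ[X], ((n : ℚ[X]) + 1) * p = C ((n : ℚ) + 1) * p := by intro p; simp
  simp only [cz, cv]
  rw [PP]
  dsimp only
  rw [e1, e2, neg_mul, coeff_neg, coeff_X_mul]
  simp only [coeff_add, coeff_C_mul, pow_succ]
  ring

lemma c_vanish (m : ℕ) : ∀ n, 3 * m < n → cv n m = 0 ∧ cz n m = 0 := by
  induction m with
  | zero =>
    intro n hn
    match n, hn with
    | 1, _ => exact ⟨cv_succ_zero _, cz_one _⟩
    | 2, _ => exact ⟨cv_succ_zero _, cz_two_zero⟩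
    | n + 3, _ => exact ⟨cv_succ_zero _, cz_succ_zero _⟩
  | succ m ih =>
    intro n hn
    match n, hn with
    | n + 3, hn =>
      refine ⟨?_, ?_⟩
      · rw [cv_succ, (ih _ (by omega)).1, (ih _ (by omega)).2]; simp
      · rw [cz_succ, (ih _ (by omega)).1, (ih _ (by omega)).2, (ih _ (by omega)).1,
          (ih _ (by omega)).2]; simp

def al (k : ℕ) : ℚ := cz (3 * k) k
def be (k : ℕ) : ℚ := cz (3 * k + 2) (k + 1)
def aa (k : ℕ) : ℚ := cv (3 * k + 1) (k + 1) + cz (3 * k + 1) (k + 1)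

lemma cv_al (k : ℕ) : cv (3 * k) k = 0 := by
  cases k with
  | zero => exact cv_zero _
  | succ k =>
    rw [show 3 * (k + 1) = (3 * k + 2) + 1 by ring, cv_succ]
    rw [(c_vanish k _ (by omega)).1, (c_vanish k _ (by omega)).2]; simp

lemma cv_be (k : ℕ) : cv (3 * k + 2) (k + 1) = 0 := by
  rw [cv_succ, (c_vanish k _ (by omega)).1, (c_vanish k _ (by omega)).2]; simp

lemma cv_aa (k : ℕ) : cv (3 * k + 1) (k + 1) = al k := by
  rw [cv_succ, cv_al]; simp [al]

lemma al_succ (k : ℕ) : al (k + 1) = (3 * k + 1) * al k := by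
  rw [al, show 3 * (k + 1) = 3 * k + 3 by ring, cz_succ, cv_al, (c_vanish k _ (by omega)).1,
    (c_vanish k _ (by omega)).2, al]
  push_cast; ring

lemma be_succ (k : ℕ) : be (k + 1) = (3 * k + 4) * al (k + 1) + (3 * k + 3) * be k := by
  rw [be, show 3 * (k + 1) + 2 = (3 * k + 2) + 3 by ring, cz_succ,
    show 3 * k + 2 + 1 = 3 * (k + 1) by ring, cv_al, cv_be, al, be]
  push_cast; ring

lemma aa_succ (k : ℕ) : aa (k + 1) = (3 * k + 2) * aa k + (3 * k + 3) * be k := by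
  have h1 : aa k - al k = cz (3 * k + 1) (k + 1) := by rw [aa, cv_aa]; ring
  rw [aa, cv_aa, show 3 * (k + 1) + 1 = (3 * k + 1) + 3 by ring, cz_succ,
    show 3 * k + 1 + 1 = 3 * k + 2 by ring, cv_be, cv_aa, ← h1, al_succ, be]
  push_cast; ring

lemma be_closed (k : ℕ) : be k = ((∏ i ∈ Finset.Icc 1 k, (3 * i + 4) : ℕ) : ℚ) ∧
    (3 * (k : ℚ) + 4) * al (k + 1) = 4 * be k := by
  induction k with
  | zero =>
    have h0 : be 0 = 1 := by simp [be, cz_two, cz_zero_zero]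
    have h1 : al 0 = 1 := by simp [al, cz_zero_zero]
    simp [h0, al_succ, h1]
  | succ k ih =>
    have h1 : be (k + 1) = (3 * k + 7) * be k := by
      rw [be_succ]; linear_combination ih.2
    refine ⟨?_, ?_⟩
    · rw [Finset.prod_Icc_succ_top (by omega), h1, ih.1]
      push_cast; ring
    · rw [al_succ (k + 1), h1]
      push_cast
      linear_combination (3 * (k : ℚ) + 7) * ih.2

lemma aa_zero : aa 0 = 1 := by
  rw [aa, cv_aa]; simp [al, cz_zero_zero, cz_one]

lemma red_mem {a b c d : ℕ} (h : [a, b, c, d].Nodup) :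
    redL [a, b, c, d] ∈ ({[1, 3, 2, 4], [1, 4, 2, 3], [1, 2, 3, 4]} : Set (List ℕ)) ↔
      a < b ∧ a < c ∧ c < d := by
  simp only [List.nodup_cons, List.mem_cons, List.not_mem_nil, or_false, not_or] at h
  obtain ⟨⟨h1, h2, h3⟩, ⟨h4, h5⟩, h6, -⟩ := h
  have e : ∀ x y : ℕ, x ≠ y → (x < y ∧ ¬ y < x) ∨ (y < x ∧ ¬ x < y) := by omega
  simp only [redL, List.map_cons, List.map_nil, List.countP_cons, List.countP_nil,
    decide_eq_true_eq, Set.mem_insert_iff, Set.mem_singleton_iff, List.cons.injEq, and_true,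
    lt_irrefl, if_false]
  rcases e a b h1 with ⟨p1, q1⟩ | ⟨p1, q1⟩ <;> rcases e a c h2 with ⟨p2, q2⟩ | ⟨p2, q2⟩ <;>
  rcases e a d h3 with ⟨p3, q3⟩ | ⟨p3, q3⟩ <;> rcases e b c h4 with ⟨p4, q4⟩ | ⟨p4, q4⟩ <;>
  rcases e b d h5 with ⟨p5, q5⟩ | ⟨p5, q5⟩ <;> rcases e c d h6 with ⟨p6, q6⟩ | ⟨p6, q6⟩ <;>
  first
  | (exfalso; omega)
  | simp [p1, q1, p2, q2, p3, q3, p4, q4, p5, q5, p6, q6]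

lemma redL_length (l) : (redL l).length = l.length := by simp [redL]

lemma hm_iff (l : List ℕ) : HasMatch {[1, 3, 2, 4], [1, 4, 2, 3], [1, 2, 3, 4]} l ↔
    ∃ i, i + 4 ≤ l.length ∧ redL ((l.drop i).take 4) ∈
      ({[1, 3, 2, 4], [1, 4, 2, 3], [1, 2, 3, 4]} : Set (List ℕ)) := by
  constructor
  · rintro ⟨i, j, hj, hij, h⟩
    have hl : (redL ((l.drop i).take (j + 1))).length = 4 := by
      rcases h with h | h | h <;> rw [h] <;> rfl
    rw [redL_length, List.length_take, List.length_drop] at hl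
    have : j = 3 := by omega
    subst this
    exact ⟨i, by omega, h⟩
  · rintro ⟨i, hi, h⟩
    exact ⟨i, 3, by omega, by omega, h⟩

lemma hm_cons {a b c d : ℕ} {l : List ℕ} (hn : (a :: b :: c :: d :: l).Nodup) :
    HasMatch {[1, 3, 2, 4], [1, 4, 2, 3], [1, 2, 3, 4]} (a :: b :: c :: d :: l) ↔
    (a < b ∧ a < c ∧ c < d) ∨
      HasMatch {[1, 3, 2, 4], [1, 4, 2, 3], [1, 2, 3, 4]} (b :: c :: d :: l) := by
  have hn' : [a, b, c, d].Nodup := hn.sublist (by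
    simp)
  rw [hm_iff, hm_iff, ← red_mem hn']
  constructor
  · rintro ⟨i, hi, h⟩
    cases i with
    | zero => left; exact h
    | succ i => right; exact ⟨i, by simp at hi ⊢; omega, h⟩
  · rintro (h | ⟨i, hi, h⟩)
    · exact ⟨0, by simp, h⟩
    · exact ⟨i + 1, by simp at hi ⊢; omega, h⟩

lemma hm_short {l : List ℕ} (h : l.length < 4) :
    ¬ HasMatch {[1, 3, 2, 4], [1, 4, 2, 3], [1, 2, 3, 4]} l := by
  rw [hm_iff]
  rintro ⟨i, hi, -⟩
  omega

lemma des_cons (a b : ℕ) (l) :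
    (X : ℚ[X]) ^ (1 + desL (a :: b :: l)) = (if b < a then X else 1) * X ^ (1 + desL (b :: l)) := by
  simp only [desL, List.tail_cons, List.zip_cons_cons, List.countP_cons, decide_eq_true_eq]
  split_ifs
  · ring
  · simp

open scoped Classical in
lemma ww_eq : ∀ (l : List ℕ), l.Nodup → l ≠ [] →
    ww l = if HasMatch {[1, 3, 2, 4], [1, 4, 2, 3], [1, 2, 3, 4]} l then 0 else X ^ (1 + desL l)
  | [], _, h => absurd rfl h
  | [a], _, _ => by
    rw [if_neg (hm_short (by simp))]; simp [ww, desL]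
  | [a, b], hn, _ => by
    have := ww_eq [b] (by simp) (by simp)
    rw [if_neg (hm_short (by simp))] at this
    rw [if_neg (hm_short (by simp)), ww, this, des_cons a]
  | [a, b, c], hn, _ => by
    have := ww_eq [b, c] (List.nodup_cons.1 hn).2 (by simp)
    rw [if_neg (hm_short (by simp))] at this
    rw [if_neg (hm_short (by simp)), ww, this, des_cons a]
  | a :: b :: c :: d :: l, hn, _ => by
    have := ww_eq (b :: c :: d :: l) (List.nodup_cons.1 hn).2 (by simp)
    rw [ww, this, des_cons a, hm_cons hn]
    by_cases h1 : a < b ∧ a < c ∧ c < d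
    · rw [if_pos h1, if_pos (Or.inl h1)]
    · rw [if_neg h1]
      by_cases h2 : HasMatch {[1, 3, 2, 4], [1, 4, 2, 3], [1, 2, 3, 4]} (b :: c :: d :: l)
      · rw [if_pos h2, if_pos (Or.inr h2), mul_zero]
      · rw [if_neg h2, if_neg (not_or.2 ⟨h1, h2⟩)]

lemma NM_eq (n : ℕ) : NMpoly {[1, 3, 2, 4], [1, 4, 2, 3], [1, 2, 3, 4]} n = GG n := by
  classical
  by_cases h : n = 0
  · subst h; simp [NMpoly, GG, Phi_empty, ww]
  · rw [NMpoly, if_neg h, NMfinset, Finset.sum_filter, GG, Phi]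
    have e : (List.range' 1 n).permutations.toFinset
        = (Finset.Icc 1 n).val.lists.toFinset := by
      ext l
      rw [mem_lists', List.mem_toFinset, List.mem_permutations]
      have hr : (List.range' 1 n).toFinset = Finset.Icc 1 n := by
        ext x; simp [List.mem_range'_1]; omega
      constructor
      · intro hp
        refine ⟨hp.nodup_iff.2 List.nodup_range', ?_⟩
        rw [List.toFinset_eq_of_perm _ _ hp, hr]
      · rintro ⟨h1, h2⟩
        exact List.perm_of_nodup_nodup_toFinset_eq h1 List.nodup_range' (h2.trans hr.symm)
    rw [e]
    apply Finset.sum_congr rfl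
    intro l hl
    rw [mem_lists'] at hl
    rw [ww_eq l hl.1]
    · simp only [ite_not]
    · rintro rfl
      have := hl.2
      simp at this
      have h3 : (1 : ℕ) ∈ Finset.Icc 1 n := by simp; omega
      rw [← this] at h3; simp at h3

end Helpers15

theorem stmt15 (Γ : Set (List ℕ)) (hΓ : Γ = {[1, 3, 2, 4], [1, 4, 2, 3], [1, 2, 3, 4]})
    (U : ℤ → Polynomial ℚ)
    (hUneg : ∀ m : ℤ, m < 0 → U m = 0)
    (hU0 : U 0 = 1)
    (hUrec : ∀ n : ℕ, 1 ≤ n →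
      ∑ k ∈ Finset.range (n + 1), (n.choose k : ℚ) • (U (k : ℤ) * NMpoly Γ (n - k)) = 0)
    (A : ℕ → ℚ) (hA : ∀ k : ℕ, A k = ((U ((3 * k + 1 : ℕ) : ℤ)).comp (-X)).coeff (k + 1)) :
    A 1 = 5 ∧ ∀ k : ℕ, 2 ≤ k →
      A k = (3 * (k : ℚ) - 1) * A (k - 1) +
        3 * (k : ℚ) * ((∏ i ∈ Finset.Icc 1 (k - 1), (3 * i + 4) : ℕ) : ℚ) := by
  subst hΓ
  have hU : ∀ n : ℕ, U (n : ℤ) = UU n := by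
    intro n
    induction n using Nat.strong_induction_on with
    | _ n ih =>
    by_cases h0 : n = 0
    · subst h0; rw [UU_zero]; exact_mod_cast hU0
    have h1 := hUrec n (by omega)
    have h2 := (hasVal_ww n).2 (by omega)
    rw [Finset.sum_range_succ] at h1 h2
    have h3 : ∑ k ∈ Finset.range n, (n.choose k : ℚ) • (U (k : ℤ) *
          NMpoly {[1, 3, 2, 4], [1, 4, 2, 3], [1, 2, 3, 4]} (n - k))
        = ∑ k ∈ Finset.range n, n.choose k • (UU k * GG (n - k)) := by
      apply Finset.sum_congr rfl
      intro k hk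
      rw [ih k (Finset.mem_range.1 hk), NM_eq, Nat.cast_smul_eq_nsmul]
    rw [h3, NM_eq] at h1
    have hG : GG 0 = 1 := by simp [GG, Phi_empty, ww]
    simp only [Nat.choose_self, Nat.sub_self, hG, Nat.cast_one, one_smul, mul_one] at h1 h2
    linear_combination h1 - h2
  have hAa : ∀ k, A k = aa k := by
    intro k
    have e : (-X : ℚ[X]) = C (-1) * X := by simp
    rw [hA, hU, e, comp_C_mul_X_coeff, UU, coeff_add, aa, cv, cz]
    ring
  have hstep : ∀ k, A (k + 1) = (3 * k + 2) * A k + (3 * k + 3) *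
      ((∏ i ∈ Finset.Icc 1 k, (3 * i + 4) : ℕ) : ℚ) := by
    intro k
    rw [hAa, hAa, aa_succ, (be_closed k).1]
  constructor
  · rw [hstep 0, hAa, aa_zero]; norm_num
  · intro k hk
    obtain ⟨k, rfl⟩ : ∃ j, k = j + 1 := ⟨k - 1, by omega⟩
    rw [hstep k, Nat.add_sub_cancel]
    push_cast
    ring
end

section
/- Let τ = 1432 and Γ = {τ}. Then U_{Γ,1}(y) = −y, and for all n ≥ 2, U_{Γ,n}(y) = (1−y)·U_{Γ,n−1}(y) − y²·binom(n−2, 2)·U_{Γ,n−3}(y). -/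
open Polynomial

/-- edge weight when prepending `x` to `l` -/
noncomputable def eW (x : ℕ) : List ℕ → Polynomial ℚ
  | [] => X
  | [b] => if x < b then 1 else X
  | [b, _] => if x < b then 1 else X
  | b :: c :: d :: _ => if x < b then (if x < d ∧ d < c ∧ c < b then 0 else 1) else X

noncomputable def W : List ℕ → Polynomial ℚ
  | [] => 1
  | x :: l => eW x l * W l

noncomputable def wP : ℕ → Polynomial ℚ
  | 0 => 0
  | 1 => 1
  | 2 => 1 - X
  | (n + 3) => (1 - X) * wP (n + 2) - X ^ 2 * ((n + 1).choose 2 : Polynomial ℚ) * wP n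

/-- arrangements -/
def PL (S : Finset ℕ) : Finset (List ℕ) :=
  ⟨Multiset.lists S.val, Multiset.lists_nodup_finset S⟩

lemma mem_PL (S : Finset ℕ) (l : List ℕ) : l ∈ PL S ↔ l.Nodup ∧ l.toFinset = S := by
  rw [← Finset.mem_val]
  show l ∈ Multiset.lists S.val ↔ _
  rw [Multiset.mem_lists_iff]
  constructor
  · intro h
    have h' : S.val = (l : Multiset ℕ) := h
    have hn : l.Nodup := by
      have := S.nodup
      rw [h'] at this
      exact Multiset.coe_nodup.1 this
    refine ⟨hn, ?_⟩
    ext a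
    rw [List.mem_toFinset, ← Finset.mem_val, h']
    simp
  · rintro ⟨hn, rfl⟩
    show (l.toFinset).val = _
    rw [List.toFinset_val, hn.dedup]
    rfl

lemma sum_PL (S : Finset ℕ) (f : List ℕ → Polynomial ℚ) (h0 : S.Nonempty ∨ f [] = 0) :
    ∑ l ∈ PL S, f l = ∑ z ∈ S, ∑ l ∈ PL (S.erase z), f (z :: l) := by
  rw [Finset.sum_sigma']
  symm
  have key : ∑ l ∈ PL S, f l = ∑ l ∈ (PL S).filter (fun l => l ≠ []), f l := by
    symm
    apply Finset.sum_subset (Finset.filter_subset _ _)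
    intro l hl hl'
    have : l = [] := by simpa [hl] using hl'
    subst this
    rcases h0 with h | h
    · rw [mem_PL] at hl
      simp at hl
      rw [← hl] at h
      simp at h
    · exact h
  rw [key]
  refine Finset.sum_bij (fun p _ => p.1 :: p.2) ?_ ?_ ?_ ?_
  · rintro ⟨z, l⟩ h
    simp only [Finset.mem_sigma, mem_PL, Finset.mem_filter] at h ⊢
    obtain ⟨hz, hn, hl⟩ := h
    have : z ∉ l := by
      rw [← List.mem_toFinset, hl]; simp
    refine ⟨⟨by simp [hn, this], ?_⟩, by simp⟩
    simp [hl, hz]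
  · rintro ⟨z, l⟩ h ⟨z', l'⟩ h' heq
    simp at heq
    obtain ⟨rfl, rfl⟩ := heq
    rfl
  · intro l hl
    simp only [mem_PL, Finset.mem_filter] at hl
    obtain ⟨⟨hn, hl⟩, hne⟩ := hl
    cases l with
    | nil => exact absurd rfl hne
    | cons z l =>
      refine ⟨⟨z, l⟩, ?_, rfl⟩
      simp only [Finset.mem_sigma, mem_PL]
      simp at hn hl
      subst hl
      refine ⟨by simp, hn.2, ?_⟩
      rw [Finset.erase_insert]
      simpa using hn.1
  · rintro ⟨z, l⟩ h
    rfl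

noncomputable def NS (S : Finset ℕ) : Polynomial ℚ := ∑ l ∈ PL S, W l
noncomputable def FS (x : ℕ) (S : Finset ℕ) : Polynomial ℚ := ∑ l ∈ PL S, W (x :: l)

lemma NS_empty : NS ∅ = 1 := by
  have : PL ∅ = {[]} := by
    ext l
    rw [mem_PL]
    simp
    rintro rfl
    simp
  simp [NS, this, W]

lemma NS_eq (S : Finset ℕ) (h : S.Nonempty) : NS S = ∑ z ∈ S, FS z (S.erase z) :=
  sum_PL S W (Or.inl h)

noncomputable def h1 (x : ℕ) : List ℕ → Polynomial ℚ
  | [] => 0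
  | b :: l => if x < b then W (b :: l) else 0

noncomputable def h2 (x : ℕ) : List ℕ → Polynomial ℚ
  | b :: c :: d :: l => if x < d ∧ d < c ∧ c < b then X ^ 2 * W (d :: l) else 0
  | _ => 0

lemma eW_desc (x b : ℕ) (l : List ℕ) (h : b < x) : eW x (b :: l) = X := by
  have : ¬ x < b := by omega
  rcases l with _ | ⟨c, _ | ⟨d, l⟩⟩ <;> simp [eW, this]

lemma W_cons (x : ℕ) (l : List ℕ) :
    W (x :: l) = X * W l + (1 - X) * h1 x l - h2 x l := by
  rcases l with _ | ⟨b, _ | ⟨c, _ | ⟨d, l⟩⟩⟩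
  · simp [W, eW, h1, h2]
  · simp only [W, eW, h1, h2]; split_ifs <;> ring
  · simp only [W, eW, h1, h2]; split_ifs <;> ring
  · by_cases h : x < d ∧ d < c ∧ c < b
    · have hb : x < b := by omega
      have e1 : eW b (c :: d :: l) = X := eW_desc _ _ _ h.2.2
      have e2 : eW c (d :: l) = X := eW_desc _ _ _ h.2.1
      have e3 : eW x (b :: c :: d :: l) = 0 := by simp [eW, h, hb]
      simp only [W, h1, h2, e1, e2, e3, if_pos h, if_pos hb]; ring
    · have e3 : eW x (b :: c :: d :: l) = if x < b then 1 else X := by simp [eW, h]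
      rw [W, e3, h2, if_neg h, h1]; split_ifs <;> ring

lemma FS_eq (x : ℕ) (S : Finset ℕ) : FS x S = X * NS S
    + (1 - X) * (∑ z ∈ S, if x < z then FS z (S.erase z) else 0)
    - X ^ 2 * ∑ b ∈ S, ∑ c ∈ S.erase b, ∑ d ∈ (S.erase b).erase c,
        if x < d ∧ d < c ∧ c < b then FS d (((S.erase b).erase c).erase d) else 0 := by
  have a1 : ∑ l ∈ PL S, h1 x l = ∑ z ∈ S, if x < z then FS z (S.erase z) else 0 := by
    rw [sum_PL S _ (Or.inr rfl)]
    refine Finset.sum_congr rfl fun z _ => ?_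
    simp only [h1]
    split_ifs
    · rfl
    · simp
  have a2 : ∑ l ∈ PL S, h2 x l = X ^ 2 * ∑ b ∈ S, ∑ c ∈ S.erase b, ∑ d ∈ (S.erase b).erase c,
        if x < d ∧ d < c ∧ c < b then FS d (((S.erase b).erase c).erase d) else 0 := by
    rw [sum_PL S _ (Or.inr rfl), Finset.mul_sum]
    refine Finset.sum_congr rfl fun b _ => ?_
    rw [sum_PL _ _ (Or.inr rfl), Finset.mul_sum]
    refine Finset.sum_congr rfl fun c _ => ?_
    rw [sum_PL _ _ (Or.inr rfl), Finset.mul_sum]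
    refine Finset.sum_congr rfl fun d _ => ?_
    simp only [h2]
    split_ifs
    · rw [FS, Finset.mul_sum]
    · simp
  rw [← a1, ← a2]
  simp only [FS, NS, Finset.mul_sum]
  rw [← Finset.sum_add_distrib, ← Finset.sum_sub_distrib]
  exact Finset.sum_congr rfl fun l _ => W_cons x l

lemma J1 (S : Finset ℕ) (z : ℕ) (hz : z ∈ S) (g : Finset ℕ → Polynomial ℚ) :
    (∑ T ∈ (S.erase z).powerset, if ∀ t ∈ T, z < t then g (insert z T) else 0)
    = ∑ T ∈ S.powerset, if z ∈ T ∧ ∀ t ∈ T, z ≤ t then g T else 0 := by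
  rw [← Finset.sum_filter, ← Finset.sum_filter]
  refine Finset.sum_bij' (fun T _ => insert z T) (fun T _ => T.erase z) ?_ ?_ ?_ ?_ ?_
  · intro T hT
    simp only [Finset.mem_filter, Finset.mem_powerset] at hT ⊢
    grind
  · intro T hT
    simp only [Finset.mem_filter, Finset.mem_powerset] at hT ⊢
    grind
  · intro T hT
    simp only [Finset.mem_filter, Finset.mem_powerset] at hT ⊢
    grind
  · intro T hT
    simp only [Finset.mem_filter, Finset.mem_powerset] at hT ⊢
    grind
  · intro T hT
    rfl

lemma J2 (S : Finset ℕ) (b c d : ℕ) (hb : b ∈ S) (hc : c ∈ S) (hd : d ∈ S) (hdc : d < c)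
    (hcb : c < b) (g : Finset ℕ → Polynomial ℚ) :
    (∑ T ∈ (((S.erase b).erase c).erase d).powerset,
      if ∀ t ∈ T, d < t then g (insert b (insert c (insert d T))) else 0)
    = ∑ T ∈ S.powerset, if (d ∈ T ∧ ∀ t ∈ T, d ≤ t) ∧ c ∈ T ∧ b ∈ T then g T else 0 := by
  rw [← Finset.sum_filter, ← Finset.sum_filter]
  refine Finset.sum_bij' (fun T _ => insert b (insert c (insert d T)))
    (fun T _ => ((T.erase b).erase c).erase d) ?_ ?_ ?_ ?_ ?_
  · intro T hT
    simp only [Finset.mem_filter, Finset.mem_powerset] at hT ⊢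
    grind
  · intro T hT
    simp only [Finset.mem_filter, Finset.mem_powerset] at hT ⊢
    grind
  · intro T hT
    simp only [Finset.mem_filter, Finset.mem_powerset] at hT ⊢
    grind
  · intro T hT
    simp only [Finset.mem_filter, Finset.mem_powerset] at hT ⊢
    grind
  · intro T hT
    rfl

lemma wP_rec (k : ℕ) (hk : 1 ≤ k) :
    wP (k + 1) = (1 - X) * wP k - X ^ 2 * ((k - 1).choose 2 : Polynomial ℚ) * wP (k - 2) := by
  rcases k with _ | _ | n
  · omega
  · simp [wP]
  · simp only [wP]; simp

lemma min_sum (S T : Finset ℕ) (hTS : T ⊆ S) (f : ℕ → Polynomial ℚ) (h : T.Nonempty) :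
    (∑ z ∈ S, if z ∈ T ∧ ∀ t ∈ T, z ≤ t then f z else 0) = f (T.min' h) := by
  rw [Finset.sum_eq_single (T.min' h)]
  · rw [if_pos]
    exact ⟨T.min'_mem h, fun t ht => T.min'_le t ht⟩
  · intro z _ hz
    rw [if_neg]
    rintro ⟨h1, h2⟩
    apply hz
    exact le_antisymm (h2 _ (T.min'_mem h)) (T.min'_le z h1)
  · intro hh
    exact absurd (hTS (T.min'_mem h)) hh

lemma I1 (S : Finset ℕ) (x : ℕ) (g : Finset ℕ → Polynomial ℚ) (hg : g ∅ = 0) :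
    (∑ z ∈ S, if x < z then
      (∑ T ∈ (S.erase z).powerset, if ∀ t ∈ T, z < t then g (insert z T) else 0) else 0)
    = ∑ T ∈ S.powerset, if ∀ t ∈ T, x < t then g T else 0 := by
  have : (∑ z ∈ S, if x < z then
      (∑ T ∈ (S.erase z).powerset, if ∀ t ∈ T, z < t then g (insert z T) else 0) else 0)
    = ∑ z ∈ S, ∑ T ∈ S.powerset, if z ∈ T ∧ ∀ t ∈ T, z ≤ t then (if x < z then g T else 0) else 0 := by
    refine Finset.sum_congr rfl fun z hz => ?_
    rw [J1 S z hz]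
    by_cases h : x < z
    · simp [h]
    · simp [h]
  rw [this, Finset.sum_comm]
  refine Finset.sum_congr rfl fun T hT => ?_
  rw [Finset.mem_powerset] at hT
  rcases T.eq_empty_or_nonempty with rfl | hne
  · simp [hg]
  · rw [min_sum S T hT (fun z => if x < z then g T else 0) hne]
    have : x < T.min' hne ↔ ∀ t ∈ T, x < t := Finset.lt_min'_iff T hne
    simp [this]

lemma pair_count (R : Finset ℕ) :
    (∑ b ∈ R, ∑ c ∈ R, if c < b then (1 : Polynomial ℚ) else 0) = (R.card.choose 2 : ℕ) := by
  induction R using Finset.induction_on_max with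
  | empty => simp
  | insert a s h ih =>
    have ha : a ∉ s := fun h' => lt_irrefl _ (h a h')
    rw [Finset.sum_insert ha, Finset.card_insert_of_notMem ha, Finset.sum_insert ha]
    have e1 : (∑ c ∈ s, if c < a then (1 : Polynomial ℚ) else 0) = s.card := by
      rw [Finset.sum_congr rfl (fun c hc => if_pos (h c hc))]
      simp
    have e2 : (∑ b ∈ s, ∑ c ∈ insert a s, if c < b then (1 : Polynomial ℚ) else 0)
        = ∑ b ∈ s, ∑ c ∈ s, if c < b then (1 : Polynomial ℚ) else 0 := by
      refine Finset.sum_congr rfl fun b hb => ?_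
      rw [Finset.sum_insert ha, if_neg (by have := h b hb; omega), zero_add]
    rw [e1, e2, ih, Nat.choose_succ_succ' s.card 1]
    simp

lemma I2 (S : Finset ℕ) (x : ℕ) (g : Finset ℕ → Polynomial ℚ) :
    (∑ b ∈ S, ∑ c ∈ S.erase b, ∑ d ∈ (S.erase b).erase c,
        if x < d ∧ d < c ∧ c < b then
      (∑ T ∈ (((S.erase b).erase c).erase d).powerset,
        if ∀ t ∈ T, d < t then g (insert b (insert c (insert d T))) else 0) else 0)
    = ∑ T ∈ S.powerset, if ∀ t ∈ T, x < t then ((T.card - 1).choose 2 : ℕ) * g T else 0 := by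
  have : (∑ b ∈ S, ∑ c ∈ S.erase b, ∑ d ∈ (S.erase b).erase c,
        if x < d ∧ d < c ∧ c < b then
      (∑ T ∈ (((S.erase b).erase c).erase d).powerset,
        if ∀ t ∈ T, d < t then g (insert b (insert c (insert d T))) else 0) else 0)
    = ∑ b ∈ S, ∑ c ∈ S, ∑ d ∈ S, ∑ T ∈ S.powerset, if d ∈ T ∧ ∀ t ∈ T, d ≤ t then
       (if b ∈ T ∧ c ∈ T ∧ x < d ∧ d < c ∧ c < b then g T else 0) else 0 := by
    refine Finset.sum_congr rfl fun b hb => ?_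
    rw [← Finset.sum_subset (Finset.erase_subset b S)]
    · refine Finset.sum_congr rfl fun c hc => ?_
      rw [← Finset.sum_subset (Finset.erase_subset c (S.erase b) |>.trans (Finset.erase_subset b S))]
      · refine Finset.sum_congr rfl fun d hd => ?_
        by_cases h : x < d ∧ d < c ∧ c < b
        · rw [if_pos h, J2 S b c d hb (by grind) (by grind) h.2.1 h.2.2]
          refine Finset.sum_congr rfl fun T _ => ?_
          simp only [h, and_true]
          grind
        · rw [if_neg h]
          symm
          apply Finset.sum_eq_zero
          grind
      · intro d _ hd
        apply Finset.sum_eq_zero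
        grind
    · intro c _ hc
      apply Finset.sum_eq_zero
      intro d _
      apply Finset.sum_eq_zero
      grind
  rw [this]
  have : ∀ b ∈ S, (∑ c ∈ S, ∑ d ∈ S, ∑ T ∈ S.powerset, if d ∈ T ∧ ∀ t ∈ T, d ≤ t then
       (if b ∈ T ∧ c ∈ T ∧ x < d ∧ d < c ∧ c < b then g T else 0) else 0)
      = ∑ T ∈ S.powerset, ∑ c ∈ S, ∑ d ∈ S, if d ∈ T ∧ ∀ t ∈ T, d ≤ t then
       (if b ∈ T ∧ c ∈ T ∧ x < d ∧ d < c ∧ c < b then g T else 0) else 0 := by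
    intro b _
    rw [Finset.sum_comm]
    rw [Finset.sum_congr rfl (fun c _ => Finset.sum_comm)]
    rw [Finset.sum_comm]
    refine Finset.sum_congr rfl fun T _ => ?_
    rw [Finset.sum_comm]
  rw [Finset.sum_congr rfl this, Finset.sum_comm]
  refine Finset.sum_congr rfl fun T hT => ?_
  rw [Finset.mem_powerset] at hT
  rcases T.eq_empty_or_nonempty with rfl | hne
  · simp
  · have e : ∀ b ∈ S, ∀ c ∈ S, (∑ d ∈ S, if d ∈ T ∧ ∀ t ∈ T, d ≤ t then
       (if b ∈ T ∧ c ∈ T ∧ x < d ∧ d < c ∧ c < b then g T else 0) else 0) =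
       if b ∈ T ∧ c ∈ T ∧ x < T.min' hne ∧ T.min' hne < c ∧ c < b then g T else 0 := by
      intro b _ c _
      exact min_sum S T hT
        (fun d => if b ∈ T ∧ c ∈ T ∧ x < d ∧ d < c ∧ c < b then g T else 0) hne
    rw [Finset.sum_congr rfl (fun b hb => Finset.sum_congr rfl (fun c hc => e b hb c hc))]
    have hx : x < T.min' hne ↔ ∀ t ∈ T, x < t := Finset.lt_min'_iff T hne
    simp only [← hx]
    by_cases h : x < T.min' hne
    · simp only [h, true_and, if_true]
      have hm := T.min'_mem hne
      have hl : ∀ t ∈ T, T.min' hne ≤ t := fun t ht => T.min'_le t ht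
      rw [← Finset.card_erase_of_mem hm, ← pair_count, Finset.sum_mul]
      generalize T.min' hne = m at *
      have hsub : T.erase m ⊆ S := (Finset.erase_subset _ _).trans hT
      rw [← Finset.sum_subset hsub]
      · refine Finset.sum_congr rfl fun b hb => ?_
        rw [Finset.sum_mul, ← Finset.sum_subset hsub]
        · refine Finset.sum_congr rfl fun c hc => ?_
          have h1 : b ∈ T := Finset.mem_of_mem_erase hb
          have h2 : c ∈ T := Finset.mem_of_mem_erase hc
          have h3 : m < c := lt_of_le_of_ne (hl c h2) (Finset.ne_of_mem_erase hc).symm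
          simp [h1, h2, h3]
        · intro c _ hc
          rw [if_neg]
          rintro ⟨_, h2, h3, _⟩
          exact hc (Finset.mem_erase.2 ⟨by omega, h2⟩)
      · intro b _ hb
        apply Finset.sum_eq_zero
        intro c _
        rw [if_neg]
        rintro ⟨h1, h2, h3, _⟩
        exact hb (Finset.mem_erase.2 ⟨by omega, h1⟩)
    · simp [h]

lemma FS_formula (n : ℕ) : ∀ (S : Finset ℕ), S.card = n → ∀ x, FS x S =
    ∑ T ∈ S.powerset, if ∀ t ∈ T, x < t then X * wP (T.card + 1) * NS (S \ T) else 0 := by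
  induction n using Nat.strong_induction_on with
  | _ n ih =>
  intro S hS x
  have b1 : (∑ z ∈ S, if x < z then FS z (S.erase z) else 0) =
      ∑ T ∈ S.powerset, if ∀ t ∈ T, x < t then X * wP T.card * NS (S \ T) else 0 := by
    rw [← I1 S x (fun T => X * wP T.card * NS (S \ T)) (by simp [wP])]
    refine Finset.sum_congr rfl fun z hz => ?_
    rw [ih (S.erase z).card (hS ▸ Finset.card_erase_lt_of_mem hz) _ rfl z]
    congr 1
    refine Finset.sum_congr rfl fun T hT => ?_
    rw [Finset.mem_powerset] at hT
    have h1 : z ∉ T := by grind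
    have h2 : S.erase z \ T = S \ insert z T := by grind
    rw [Finset.card_insert_of_notMem h1, h2]
  have b2 : (∑ b ∈ S, ∑ c ∈ S.erase b, ∑ d ∈ (S.erase b).erase c,
        if x < d ∧ d < c ∧ c < b then FS d (((S.erase b).erase c).erase d) else 0) =
      ∑ T ∈ S.powerset, if ∀ t ∈ T, x < t then
        (((T.card - 1).choose 2 : ℕ) : Polynomial ℚ) * (X * wP (T.card - 2) * NS (S \ T)) else 0 := by
    rw [← I2 S x (fun T => X * wP (T.card - 2) * NS (S \ T))]
    refine Finset.sum_congr rfl fun b hb => ?_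
    refine Finset.sum_congr rfl fun c hc => ?_
    refine Finset.sum_congr rfl fun d hd => ?_
    have hlt : (((S.erase b).erase c).erase d).card < n := by
      have := Finset.card_erase_lt_of_mem hb
      have := Finset.card_erase_lt_of_mem hc
      have := Finset.card_erase_lt_of_mem hd
      omega
    rw [ih _ hlt _ rfl d]
    congr 1
    refine Finset.sum_congr rfl fun T hT => ?_
    rw [Finset.mem_powerset] at hT
    have h1 : d ∉ T := by grind
    have h3 : c ∉ insert d T := by grind
    have h4 : b ∉ insert c (insert d T) := by grind
    have h2 : ((S.erase b).erase c).erase d \ T = S \ insert b (insert c (insert d T)) := by grind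
    rw [Finset.card_insert_of_notMem h4, Finset.card_insert_of_notMem h3,
      Finset.card_insert_of_notMem h1, h2]
    rfl
  have b3 : X * NS S = ∑ T ∈ S.powerset, if T = ∅ then X * NS S else 0 := by
    rw [Finset.sum_ite_eq']; simp
  rw [FS_eq, b1, b2, b3, Finset.mul_sum, Finset.mul_sum, ← Finset.sum_add_distrib,
    ← Finset.sum_sub_distrib]
  refine Finset.sum_congr rfl fun T hT => ?_
  rcases T.eq_empty_or_nonempty with rfl | hne
  · simp [wP]
  · rw [if_neg hne.ne_empty]
    split_ifs
    · rw [wP_rec T.card hne.card_pos]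
      ring
    · ring

lemma NS_formula (S : Finset ℕ) (hS : S.Nonempty) :
    NS S = ∑ T ∈ S.powerset, X * wP T.card * NS (S \ T) := by
  rw [NS_eq S hS]
  have := FS_formula
  have e := J1 S
  have : ∀ z ∈ S, FS z (S.erase z) = ∑ T ∈ S.powerset, if z ∈ T ∧ ∀ t ∈ T, z ≤ t then
      X * wP T.card * NS (S \ T) else 0 := by
    intro z hz
    rw [← J1 S z hz (fun T => X * wP T.card * NS (S \ T)), FS_formula _ _ rfl z]
    refine Finset.sum_congr rfl fun T hT => ?_
    rw [Finset.mem_powerset] at hT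
    have h1 : z ∉ T := by grind
    have h2 : S.erase z \ T = S \ insert z T := by grind
    rw [Finset.card_insert_of_notMem h1, h2]
  rw [Finset.sum_congr rfl this, Finset.sum_comm]
  refine Finset.sum_congr rfl fun T hT => ?_
  rw [Finset.mem_powerset] at hT
  rcases T.eq_empty_or_nonempty with rfl | hne
  · simp [wP]
  · exact min_sum S T hT (fun _ => X * wP T.card * NS (S \ T)) hne

noncomputable def NN (n : ℕ) : Polynomial ℚ := NS (Finset.Icc 1 n)

lemma NS_card (n : ℕ) : ∀ S : Finset ℕ, S.card = n → NS S = NN n := by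
  induction n using Nat.strong_induction_on with
  | _ n ih =>
  intro S hS
  rcases S.eq_empty_or_nonempty with rfl | hne
  · simp at hS
    subst hS
    simp [NN]
  have hn : 0 < n := hS ▸ hne.card_pos
  have key : ∀ R : Finset ℕ, R.card = n →
      NS R = ∑ k ∈ Finset.range (n + 1), n.choose k • (X * wP k * if k = 0 then 0 else NN (n - k)) := by
    intro R hR
    rw [NS_formula R (Finset.card_pos.1 (by omega))]
    rw [← hR, ← Finset.sum_powerset_apply_card
      (fun k => X * wP k * if k = 0 then 0 else NN (R.card - k))]
    refine Finset.sum_congr rfl fun T hT => ?_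
    rw [Finset.mem_powerset] at hT
    rcases T.eq_empty_or_nonempty with rfl | hT'
    · simp [wP]
    · have h0 := hT'.card_pos
      have h1 := Finset.card_le_card hT
      rw [if_neg (by omega), ih (R.card - T.card) (by omega) (R \ T) (Finset.card_sdiff_of_subset hT)]
  rw [NN, key S hS, key (Finset.Icc 1 n) (by simp)]

lemma NN_formula (n : ℕ) (hn : 1 ≤ n) :
    NN n = ∑ k ∈ Finset.range (n + 1), n.choose k • (X * wP k * NN (n - k)) := by
  have hc : (Finset.Icc 1 n).card = n := by simp
  have h := NS_formula (Finset.Icc 1 n) (Finset.card_pos.1 (by omega))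
  rw [NN, h]
  have := Finset.sum_powerset_apply_card (fun k => X * wP k * NN (n - k)) (x := Finset.Icc 1 n)
  rw [hc] at this
  rw [← this]
  refine Finset.sum_congr rfl fun T hT => ?_
  rw [Finset.mem_powerset] at hT
  rw [NS_card (n - T.card) _ (by rw [Finset.card_sdiff_of_subset hT, hc])]

lemma NN_zero : NN 0 = 1 := by
  simp [NN, NS_empty]

lemma hasMatch_cons (x : ℕ) (l : List ℕ) : HasMatch {[1, 4, 3, 2]} (x :: l) ↔
    HasMatch {[1, 4, 3, 2]} l ∨
      ∃ b c d l', l = b :: c :: d :: l' ∧ x < d ∧ d < c ∧ c < b := by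
  constructor
  · rintro ⟨i, j, hj, hlen, hm⟩
    rcases i with _ | i
    · right
      have hl : j = 3 := by
        have := congrArg List.length hm
        simp [redL] at this
        simp at hlen
        omega
      subst hl
      rcases l with _ | ⟨b, _ | ⟨c, _ | ⟨d, l⟩⟩⟩
      · simp at hlen
      · simp at hlen
      · simp at hlen
      · refine ⟨b, c, d, l, rfl, ?_⟩
        simp [redL, List.countP_cons] at hm
        obtain ⟨h1, h2, h3, h4⟩ := hm
        by_contra hcon
        split_ifs at h1 h2 h3 h4 <;> omega
    · left
      exact ⟨i, j, hj, by simp at hlen; omega, by simpa using hm⟩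
  · rintro (⟨i, j, hj, hlen, hm⟩ | ⟨b, c, d, l', rfl, h1, h2, h3⟩)
    · exact ⟨i + 1, j, hj, by simp; omega, by simpa using hm⟩
    · refine ⟨0, 3, by omega, by simp, ?_⟩
      simp [redL, List.countP_cons]
      refine ⟨?_, ?_, ?_, ?_⟩ <;> (try split_ifs) <;> omega

lemma desL_cons (x b : ℕ) (l : List ℕ) :
    desL (x :: b :: l) = desL (b :: l) + if b < x then 1 else 0 := by
  simp [desL, List.countP_cons]

open scoped Classical in
lemma W_eq (l : List ℕ) (hn : l.Nodup) (hne : l ≠ []) :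
    W l = if HasMatch {[1, 4, 3, 2]} l then 0 else X ^ (1 + desL l) := by
  induction l with
  | nil => exact absurd rfl hne
  | cons x l ih =>
    rw [W]
    simp only [hasMatch_cons x l]
    rcases l with _ | ⟨b, l⟩
    · have : ¬ HasMatch {[1, 4, 3, 2]} [] := by
        rintro ⟨i, j, _, h, _⟩
        simp at h
      simp [W, eW, this, desL]
    · rw [ih (List.nodup_cons.1 hn).2 (by simp), desL_cons]
      have hxb : x ≠ b := by
        rintro rfl
        simp at hn
      by_cases hM : HasMatch {[1, 4, 3, 2]} (b :: l)
      · simp [hM]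
      · simp only [hM, false_or, if_false]
        by_cases hP : ∃ b' c d l', b :: l = b' :: c :: d :: l' ∧ x < d ∧ d < c ∧ c < b'
        · rw [if_pos hP]
          obtain ⟨b', c, d, l', he, h⟩ := hP
          rw [he, eW, if_pos (by omega), if_pos h, zero_mul]
        · rw [if_neg hP]
          have : eW x (b :: l) = if x < b then 1 else X := by
            rcases l with _ | ⟨c, _ | ⟨d, l⟩⟩
            · rfl
            · rfl
            · have : ¬ (x < d ∧ d < c ∧ c < b) := fun h => hP ⟨b, c, d, l, rfl, h⟩
              simp [eW, this]
          rw [this]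
          rcases lt_or_gt_of_ne hxb with h | h
          · simp [h, h.not_gt]
          · simp [h, h.not_gt]; ring

lemma NMpoly_eq (n : ℕ) : NMpoly {[1, 4, 3, 2]} n = NN n := by
  classical
  unfold NMpoly
  split_ifs with h
  · rw [h, NN_zero]
  · rw [NN, NS, NMfinset, Finset.sum_filter]
    have : (List.range' 1 n).permutations.toFinset = PL (Finset.Icc 1 n) := by
      ext l
      rw [mem_PL, List.mem_toFinset, List.mem_permutations]
      have hr : (List.range' 1 n).Nodup := List.nodup_range'
      have hf : (List.range' 1 n).toFinset = Finset.Icc 1 n := by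
        ext a; simp [List.mem_range'_1]; omega
      constructor
      · intro h
        exact ⟨h.nodup_iff.2 hr, by rw [← hf]; exact List.toFinset_eq_of_perm _ _ h⟩
      · rintro ⟨h1, h2⟩
        exact List.perm_of_nodup_nodup_toFinset_eq h1 hr (h2.trans hf.symm)
    rw [this]
    refine Finset.sum_congr rfl fun l hl => ?_
    rw [mem_PL] at hl
    rw [W_eq l hl.1]
    · split_ifs <;> simp_all
    · rintro rfl
      have := hl.2
      have h2 : (1 : ℕ) ∈ Finset.Icc 1 n := by simp; omega
      rw [← this] at h2
      simp at h2

lemma U_eq (U : ℤ → Polynomial ℚ) (hU0 : U 0 = 1)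
    (hUrec : ∀ n : ℕ, 1 ≤ n →
      ∑ k ∈ Finset.range (n + 1), (n.choose k : ℚ) • (U (k : ℤ) * NN (n - k)) = 0) (n : ℕ) :
    1 ≤ n → U n = - X * wP n := by
  induction n using Nat.strong_induction_on with
  | _ n ih =>
  intro hn
  have h1 := hUrec n hn
  have h2 := NN_formula n hn
  rw [Finset.sum_range_succ] at h1 h2
  obtain ⟨m, rfl⟩ : ∃ m, n = m + 1 := ⟨n - 1, by omega⟩
  rw [Finset.sum_range_succ'] at h1 h2
  have h3 : ∑ k ∈ Finset.range m, ((m + 1).choose (k + 1) : ℚ) •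
        (U ((k + 1 : ℕ) : ℤ) * NN (m + 1 - (k + 1)))
      = - ∑ k ∈ Finset.range m, (m + 1).choose (k + 1) • (X * wP (k + 1) * NN (m + 1 - (k + 1))) := by
    rw [← Finset.sum_neg_distrib]
    refine Finset.sum_congr rfl fun k hk => ?_
    rw [Finset.mem_range] at hk
    rw [ih (k + 1) (by omega) (by omega), Nat.cast_smul_eq_nsmul]
    simp only [nsmul_eq_mul]
    ring
  rw [h3] at h1
  simp [NN_zero, hU0, wP] at h1 h2
  have e : U ((m + 1 : ℕ) : ℤ) = U ((m : ℤ) + 1) := by push_cast; rfl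
  rw [e]
  linear_combination h1 - h2

theorem stmt17 (Γ : Set (List ℕ)) (hΓ : Γ = {[1, 4, 3, 2]})
    (U : ℤ → Polynomial ℚ)
    (hUneg : ∀ m : ℤ, m < 0 → U m = 0)
    (hU0 : U 0 = 1)
    (hUrec : ∀ n : ℕ, 1 ≤ n →
      ∑ k ∈ Finset.range (n + 1), (n.choose k : ℚ) • (U (k : ℤ) * NMpoly Γ (n - k)) = 0) :
    U 1 = -X ∧ ∀ n : ℕ, 2 ≤ n →
      U (n : ℤ) = (1 - X) * U ((n : ℤ) - 1) -
        X ^ 2 * ((n - 2).choose 2 : Polynomial ℚ) * U ((n : ℤ) - 3) := by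
  subst hΓ
  have hrec : ∀ n : ℕ, 1 ≤ n →
      ∑ k ∈ Finset.range (n + 1), (n.choose k : ℚ) • (U (k : ℤ) * NN (n - k)) = 0 := by
    intro n hn
    rw [← hUrec n hn]
    refine Finset.sum_congr rfl fun k _ => ?_
    rw [NMpoly_eq]
  have hU := U_eq U hU0 hrec
  constructor
  · have := hU 1 le_rfl
    simpa [wP] using this
  · intro n hn
    obtain ⟨k, rfl⟩ : ∃ k, n = k + 2 := ⟨n - 2, by omega⟩
    rw [hU (k + 2) (by omega)]
    have e1 : ((k + 2 : ℕ) : ℤ) - 1 = ((k + 1 : ℕ) : ℤ) := by push_cast; ring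
    rw [e1, hU (k + 1) (by omega), wP_rec (k + 1) (by omega)]
    rcases k with _ | _ | k
    · simp; ring
    · simp; ring
    · have e2 : ((k + 1 + 1 + 2 : ℕ) : ℤ) - 3 = ((k + 1 : ℕ) : ℤ) := by push_cast; ring
      rw [e2, hU (k + 1) (by omega)]
      have e3 : k + 1 + 1 + 1 - 1 = k + 1 + 1 + 2 - 2 := by omega
      have e4 : k + 1 + 1 + 1 - 2 = k + 1 := by omega
      rw [e3, e4]
      ring
end
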